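/- arXiv:2401.00925 — 4 statements merged into one kernel-verified Lean document; each statement's English description precedes it below -/
import Mathlib

section
/- Let (T,m) be a complete local ring with m ∉ Ass(T) and let p be a nonmaximal prime ideal of T. Let (R, R∩m) be an infinite p-subring of T and let u ∈ T. Then there exists a p-subring (S, S∩m) of T such that: (1) R ⊆ S ⊆ T; (2) u + m² is in the image of the map S → T/m²; (3) for every finitely generated ideal I of S, IT ∩ S = I; and (4) |S| = |R|. -/
open IsLocalRing

/-- The `q`-th Frobenius power `I^{[q]}` of an ideal: the ideal generated by `q`-th powers of
elements of `I`. -/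
def Ideal.frobPow {R : Type*} [CommRing R] (I : Ideal R) (q : ℕ) : Ideal R :=
  Ideal.span ((fun r => r ^ q) '' (I : Set R))

/-- Membership in the tight closure `I*` of an ideal `I` in a ring of characteristic `p`:
there is a `c` outside every minimal prime with `c * x^{p^e} ∈ I^{[p^e]}` for all `e ≫ 0`. -/
def Ideal.MemTightClosure {R : Type*} [CommRing R] (p : ℕ) (I : Ideal R) (x : R) : Prop :=
  ∃ c : R, (∀ P ∈ minimalPrimes R, c ∉ P) ∧
    ∃ E : ℕ, ∀ e : ℕ, E ≤ e → c * x ^ p ^ e ∈ I.frobPow (p ^ e)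

/-- A ring of characteristic `p` is weakly F-regular if every ideal is tightly closed. -/
def WeaklyFRegular (R : Type*) [CommRing R] (p : ℕ) : Prop :=
  ∀ (I : Ideal R) (x : R), I.MemTightClosure p x → x ∈ I

/-- A ring is F-regular if all of its localizations are weakly F-regular. -/
def FRegular (R : Type*) [CommRing R] (p : ℕ) : Prop :=
  ∀ S : Submonoid R, WeaklyFRegular (Localization S) p

/-- A ring is catenary if any two saturated chains of primes with the same endpoints have
the same length. -/
def IsCatenaryRing (R : Type*) [CommRing R] : Prop :=
  ∀ (n m : ℕ) (f : Fin (n + 1) → PrimeSpectrum R) (g : Fin (m + 1) → PrimeSpectrum R),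
    f 0 = g 0 → f (Fin.last n) = g (Fin.last m) →
    (∀ i : Fin n, f i.castSucc ⋖ f i.succ) → (∀ i : Fin m, g i.castSucc ⋖ g i.succ) →
    n = m

/-- `y` generates the socle of `T/I`, i.e. `(I : m) = I + (y)` and `y ∉ I`. -/
def IsSocleGenerator {T : Type*} [CommRing T] [IsLocalRing T] (I : Ideal T) (y : T) : Prop :=
  y ∉ I ∧ I.colon (maximalIdeal T) = I ⊔ Ideal.span {y}

/-- An approximately Gorenstein sequence: a descending chain of `m`-primary ideals with
Gorenstein quotients, cofinal with the powers of `m`. -/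
def IsApproxGorensteinSeq (T : Type*) [CommRing T] [IsLocalRing T] (I : ℕ → Ideal T) : Prop :=
  Antitone I ∧ (∀ s, (I s).radical = maximalIdeal T) ∧
  (∀ s, ∃ y, IsSocleGenerator (I s) y) ∧
  ∀ N : ℕ, ∃ S : ℕ, ∀ s : ℕ, S ≤ s → I s ≤ maximalIdeal T ^ N

/-- The set `M_{I,y} = ⋃_{e ≥ 1} ⋂_{f ≥ e} (I^{[p^f]} : y^{p^f})`. -/
def MIy {T : Type*} [CommRing T] (p : ℕ) (I : Ideal T) (y : T) : Set T :=
  {c : T | ∃ e : ℕ, 1 ≤ e ∧ ∀ f : ℕ, e ≤ f → c * y ^ p ^ f ∈ I.frobPow (p ^ f)}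

/-- `depth T ≥ n`: there is a regular sequence of length `n` in the maximal ideal. -/
def DepthGE (T : Type*) [CommRing T] [IsLocalRing T] (n : ℕ) : Prop :=
  ∃ rs : List T, rs.length = n ∧ (∀ x ∈ rs, x ∈ maximalIdeal T) ∧
    RingTheory.Sequence.IsRegular T rs

/-- A Noetherian local ring is Cohen–Macaulay iff there is a regular sequence in the maximal
ideal of length equal to the Krull dimension. -/
def IsCohenMacaulayLocal (T : Type*) [CommRing T] [IsLocalRing T] : Prop :=
  ∃ rs : List T, (∀ x ∈ rs, x ∈ maximalIdeal T) ∧ RingTheory.Sequence.IsRegular T rs ∧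
    (rs.length : WithBot (WithTop ℕ)) = ringKrullDim T

/-- A parameter ideal: generated by `dim T` elements, with radical the maximal ideal. -/
def IsParameterIdeal (T : Type*) [CommRing T] [IsLocalRing T] (I : Ideal T) : Prop :=
  ∃ (n : ℕ) (x : Fin n → T), I = Ideal.span (Set.range x) ∧ I.radical = maximalIdeal T ∧
    (n : WithBot (WithTop ℕ)) = ringKrullDim T

/-- A Noetherian local ring is Gorenstein iff it is Cohen–Macaulay and every parameter ideal
is irreducible (has one-dimensional socle). -/
def IsGorensteinLocal (T : Type*) [CommRing T] [IsLocalRing T] : Prop :=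
  IsCohenMacaulayLocal T ∧ ∀ I : Ideal T, IsParameterIdeal T I → ∃ y, IsSocleGenerator I y

/-- A `p`-subring of a local ring `T`: a quasi-local subring `(R, R ∩ m)` which is small,
misses `p`, and misses every associated prime of `T`. -/
def IsPSubring (T : Type*) [CommRing T] [IsLocalRing T] (P : Ideal T) (R : Subring T) : Prop :=
  IsLocalRing R ∧ (Ideal.comap R.subtype (maximalIdeal T)).IsMaximal ∧
  (Cardinal.mk R ≤ max Cardinal.aleph0 (Cardinal.mk (ResidueField T)) ∧
    (Cardinal.mk R = max Cardinal.aleph0 (Cardinal.mk (ResidueField T)) →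
      Cardinal.mk (ResidueField T) ≤ Cardinal.aleph0)) ∧
  Ideal.comap R.subtype P = ⊥ ∧
  ∀ Q ∈ associatedPrimes T T, Ideal.comap R.subtype Q = ⊥

/-- An N-subring of a local ring `T`: a quasi-local UFD `(R, R ∩ m)` inside `T` which is small,
misses every associated prime of `T`, and such that `R ∩ J` has height at most one for every
`J ∈ Ass(T/tT)`, `t` a nonzerodivisor. -/
def IsNSubring (T : Type*) [CommRing T] [IsLocalRing T] (R : Subring T) : Prop :=
  IsLocalRing R ∧ (Ideal.comap R.subtype (maximalIdeal T)).IsMaximal ∧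
  (∃ _ : IsDomain R, UniqueFactorizationMonoid R) ∧
  (Cardinal.mk R ≤ max Cardinal.aleph0 (Cardinal.mk (ResidueField T)) ∧
    (Cardinal.mk R = max Cardinal.aleph0 (Cardinal.mk (ResidueField T)) →
      Cardinal.mk (ResidueField T) ≤ Cardinal.aleph0)) ∧
  (∀ Q ∈ associatedPrimes T T, Ideal.comap R.subtype Q = ⊥) ∧
  ∀ t ∈ nonZeroDivisors T, ∀ J ∈ associatedPrimes T (T ⧸ Ideal.span {t}),
    ∀ q0 q1 : Ideal R, q0.IsPrime → q1.IsPrime →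
      ¬(q0 < q1 ∧ q1 < Ideal.comap R.subtype J)

universe u

/-- Krull's intersection theorem for `T ⧸ Q`: an element outside `Q` stays outside `Q` after a
perturbation by a high power of the maximal ideal. -/
theorem IsLocalRing.exists_pow_maximalIdeal_forall_add_notMem {T : Type*} [CommRing T]
    [IsLocalRing T] [IsNoetherianRing T] (Q : Ideal T) {w : T} (hw : w ∉ Q) :
    ∃ N : ℕ, ∀ z ∈ maximalIdeal T ^ N, w + z ∉ Q := by
  by_contra! h
  refine hw (Ideal.Quotient.eq_zero_iff_mem.mp
    (IsHausdorff.haus (I := maximalIdeal T) (M := T ⧸ Q) inferInstance _ fun n ↦ ?_))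
  obtain ⟨z, hz, hwz⟩ := h n
  rw [SModEq.zero]
  have hmk : Ideal.Quotient.mk Q w = (-z) • (1 : T ⧸ Q) := by
    rw [Algebra.smul_def, mul_one, Ideal.Quotient.algebraMap_eq, Ideal.Quotient.eq]
    simpa using hwz
  rw [hmk]
  exact Submodule.smul_mem_smul (neg_mem hz) Submodule.mem_top

theorem Ideal.IsPrime.not_pow_maximalIdeal_le {T : Type*} [CommRing T] [IsLocalRing T]
    {Q : Ideal T} (hQ : Q.IsPrime) (hQm : Q ≠ maximalIdeal T) (N : ℕ) :
    ¬ maximalIdeal T ^ N ≤ Q := fun h ↦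
  hQm ((IsLocalRing.le_maximalIdeal hQ.ne_top).antisymm (hQ.le_of_pow_le h))

/-- A complete Noetherian local ring is not a countable union of cosets of nonmaximal primes. -/
theorem IsLocalRing.exists_forall_sub_notMem_of_countable {T : Type*} [CommRing T]
    [IsLocalRing T] [IsNoetherianRing T] [IsAdicComplete (maximalIdeal T) T]
    {D : Set (Ideal T × T)} (hD : D.Countable)
    (hprime : ∀ q ∈ D, q.1.IsPrime ∧ q.1 ≠ maximalIdeal T) :
    ∃ t : T, ∀ q ∈ D, t - q.2 ∉ q.1 := by
  obtain rfl | hne := D.eq_empty_or_nonempty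
  · simp
  obtain ⟨q, rfl⟩ := hD.exists_eq_range hne
  have step : ∀ (n : ℕ) (s : T × ℕ), ∃ s' : T × ℕ, s'.1 - s.1 ∈ maximalIdeal T ^ s.2 ∧
      s.2 < s'.2 ∧ ∀ z ∈ maximalIdeal T ^ s'.2, s'.1 - (q n).2 + z ∉ (q n).1 := by
    rintro n ⟨x, N⟩
    obtain ⟨hp, hpm⟩ := hprime _ ⟨n, rfl⟩
    obtain ⟨x', hx', hx'q⟩ : ∃ x', x' - x ∈ maximalIdeal T ^ N ∧ x' - (q n).2 ∉ (q n).1 := by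
      by_cases hx : x - (q n).2 ∈ (q n).1
      · obtain ⟨y, hy, hyq⟩ := SetLike.not_le_iff_exists.mp (hp.not_pow_maximalIdeal_le hpm N)
        refine ⟨x + y, by simpa using hy, fun h ↦ hyq ?_⟩
        have := sub_mem h hx
        simpa using this
      · exact ⟨x, by simp, hx⟩
    obtain ⟨M, hM⟩ := exists_pow_maximalIdeal_forall_add_notMem _ hx'q
    exact ⟨(x', max M (N + 1)), hx', by simp,
      fun z hz ↦ hM z (Ideal.pow_le_pow_right (le_max_left _ _) hz)⟩
  choose next hnear hlt havoid using step
  let s : ℕ → T × ℕ := fun n ↦ Nat.rec (0, 0) next n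
  have hs_mono : StrictMono fun n ↦ (s n).2 := strictMono_nat_of_lt_succ fun n ↦ hlt n (s n)
  have hs_near : ∀ {n k}, n ≤ k → (s k).1 - (s n).1 ∈ maximalIdeal T ^ (s n).2 := by
    intro n k hnk
    induction k, hnk using Nat.le_induction with
    | base => simp
    | succ k hnk ih =>
      have := add_mem (Ideal.pow_le_pow_right (hs_mono.monotone hnk) (hnear k (s k))) ih
      simpa using this
  obtain ⟨L, hL⟩ := IsPrecomplete.prec (I := maximalIdeal T) (M := T) inferInstance
    (f := fun n ↦ (s n).1) fun {n k} hnk ↦ by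
      rw [SModEq.sub_mem, smul_eq_mul, Ideal.mul_top, ← neg_mem_iff, neg_sub]
      exact Ideal.pow_le_pow_right (hs_mono.id_le n) (hs_near hnk)
  have hL_near : ∀ n, L - (s n).1 ∈ maximalIdeal T ^ (s n).2 := by
    intro n
    have hLk := hL (s n).2
    rw [SModEq.sub_mem, smul_eq_mul, Ideal.mul_top, ← neg_mem_iff, neg_sub] at hLk
    simpa using add_mem hLk (hs_near (hs_mono.id_le n))
  refine ⟨L, ?_⟩
  rintro _ ⟨n, rfl⟩ hmem
  refine havoid n (s n) _ (hL_near (n + 1)) ?_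
  change (s (n + 1)).1 - (q n).2 + (L - (s (n + 1)).1) ∈ _
  convert hmem using 1
  ring

/-- A local ring is not a union of fewer cosets of proper ideals than there are elements of its
residue field. -/
theorem IsLocalRing.exists_forall_sub_notMem_of_card_lt {T : Type u} [CommRing T]
    [IsLocalRing T] {D : Set (Ideal T × T)} (hD : Cardinal.mk D < Cardinal.mk (ResidueField T))
    (hproper : ∀ q ∈ D, q.1 ≠ ⊤) :
    ∃ t : T, ∀ q ∈ D, t - q.2 ∉ q.1 := by
  by_contra! h
  choose q hqD hq using h
  let lift : ResidueField T → T := Function.surjInv residue_surjective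
  have hlift : ∀ a, residue T (lift a) = a := Function.surjInv_eq residue_surjective
  refine hD.not_ge (Cardinal.mk_le_of_injective
    (f := fun a ↦ (⟨q (lift a), hqD _⟩ : D)) fun a b hab ↦ ?_)
  have hab' : q (lift a) = q (lift b) := congrArg Subtype.val hab
  have hmem : lift a - lift b ∈ maximalIdeal T := by
    refine le_maximalIdeal (hproper _ (hqD (lift a))) ?_
    have := sub_mem (hq (lift a)) (hab' ▸ hq (lift b))
    simpa using this
  rw [← hlift a, ← hlift b, ← sub_eq_zero, ← map_sub]
  exact (residue_eq_zero_iff _).mpr hmem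

/-- A subring `S` of `T` that is closed under inverses of units of `T`, meets every ideal in `C`
only in `0`, and has at most `κ` elements. -/
structure Subring.IsSmallAvoiding {T : Type u} [CommRing T] (C : Set (Ideal T))
    (κ : Cardinal.{u}) (S : Subring T) : Prop where
  inv_mem : ∀ x ∈ S, ∀ y, x * y = 1 → y ∈ S
  eq_zero_of_mem : ∀ Q ∈ C, ∀ x ∈ S, x ∈ Q → x = 0
  card_le : Cardinal.mk S ≤ κ

/-- The subring of `T` of all fractions of elements of `A` whose denominator is a unit of `T`. -/
def Subring.unitFractions {T : Type*} [CommRing T] (A : Subring T) : Subring T where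
  carrier := {x | ∃ a ∈ A, ∃ b ∈ A, IsUnit b ∧ x * b = a}
  mul_mem' := by
    rintro x y ⟨a, ha, b, hb, hbu, rfl⟩ ⟨c, hc, d, hd, hdu, rfl⟩
    exact ⟨_, mul_mem ha hc, _, mul_mem hb hd, hbu.mul hdu, by ring⟩
  one_mem' := ⟨1, one_mem _, 1, one_mem _, isUnit_one, one_mul 1⟩
  add_mem' := by
    rintro x y ⟨a, ha, b, hb, hbu, rfl⟩ ⟨c, hc, d, hd, hdu, rfl⟩
    exact ⟨_, add_mem (mul_mem ha hd) (mul_mem hc hb), _, mul_mem hb hd, hbu.mul hdu, by ring⟩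
  zero_mem' := ⟨0, zero_mem _, 1, one_mem _, isUnit_one, zero_mul 1⟩
  neg_mem' := by
    rintro x ⟨a, ha, b, hb, hbu, rfl⟩
    exact ⟨_, neg_mem ha, b, hb, hbu, by ring⟩

theorem Subring.le_unitFractions {T : Type*} [CommRing T] (A : Subring T) :
    A ≤ A.unitFractions :=
  fun x hx ↦ ⟨x, hx, 1, one_mem _, isUnit_one, mul_one x⟩

theorem Subring.card_unitFractions_le {T : Type u} [CommRing T] (A : Subring T) :
    Cardinal.mk A.unitFractions ≤ Cardinal.mk A * Cardinal.mk A := by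
  have h : ∀ x : A.unitFractions, ∃ p : A × A, IsUnit (p.2 : T) ∧ (x : T) * p.2 = p.1 := by
    rintro ⟨x, a, ha, b, hb, hbu, h⟩
    exact ⟨(⟨a, ha⟩, ⟨b, hb⟩), hbu, h⟩
  choose f hfu hf using h
  rw [Cardinal.mul_def]
  refine Cardinal.mk_le_of_injective (f := f) fun x y hxy ↦ Subtype.ext ?_
  exact (hfu x).mul_right_cancel ((hf x).trans (hxy ▸ (hf y).symm))

theorem Subring.isSmallAvoiding_unitFractions {T : Type u} [CommRing T] {C : Set (Ideal T)}
    {κ : Cardinal.{u}} (hκ : Cardinal.aleph0 ≤ κ) {A : Subring T} (hcard : Cardinal.mk A ≤ κ)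
    (hA : ∀ Q ∈ C, ∀ x ∈ A, x ∈ Q → x = 0) : A.unitFractions.IsSmallAvoiding C κ where
  inv_mem := by
    rintro x ⟨a, ha, b, hb, hbu, rfl⟩ y hxy
    exact ⟨b, hb, x * b, ha, (IsUnit.of_mul_eq_one y hxy).mul hbu, by
      linear_combination b * hxy⟩
  eq_zero_of_mem := by
    rintro Q hQ x ⟨a, ha, b, hb, hbu, h⟩ hx
    have : x * b = 0 := hA Q hQ _ (h ▸ ha) (Q.mul_mem_right b hx)
    exact (hbu.mul_left_eq_zero).mp this
  card_le := A.card_unitFractions_le.trans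
    ((mul_le_mul' hcard hcard).trans (Cardinal.mul_eq_self hκ).le)

/-- If no nonzero element of `S[t]` lies in an ideal of `C`, then `S` can be enlarged to contain
`t`. -/
theorem Subring.IsSmallAvoiding.exists_adjoin {T : Type u} [CommRing T] {C : Set (Ideal T)}
    {κ : Cardinal.{u}} (hκ : Cardinal.aleph0 ≤ κ) {S : Subring T} (hS : S.IsSmallAvoiding C κ)
    (t : T) (ht : ∀ Q ∈ C, ∀ x ∈ Algebra.adjoin S {t}, x ∈ Q → x = 0) :
    ∃ S' : Subring T, S'.IsSmallAvoiding C κ ∧ S ≤ S' ∧ t ∈ S' := by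
  refine ⟨(Algebra.adjoin S {t}).toSubring.unitFractions,
    isSmallAvoiding_unitFractions hκ ?_ ht, fun x hx ↦ le_unitFractions _ ?_,
    le_unitFractions _ (Algebra.self_mem_adjoin_singleton S t)⟩
  · have hsurj : Function.Surjective fun f : Polynomial S ↦
        (⟨Polynomial.aeval t f, Polynomial.aeval_mem_adjoin_singleton S t⟩ :
          (Algebra.adjoin S {t}).toSubring) := by
      rintro ⟨x, hx⟩
      obtain ⟨f, rfl⟩ := Algebra.adjoin_mem_exists_aeval S t hx
      exact ⟨f, rfl⟩
    exact (Cardinal.mk_le_of_surjective hsurj).trans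
      (Polynomial.cardinalMk_le_max.trans (max_le hS.card_le hκ))
  · exact (Algebra.adjoin S {t}).algebraMap_mem ⟨x, hx⟩

/-- Adjoining a fraction `c / y` with `y` a nonzero element of `S`. -/
theorem Subring.IsSmallAvoiding.exists_adjoin_of_mul_mem {T : Type u} [CommRing T]
    {C : Set (Ideal T)} {κ : Cardinal.{u}} (hκ : Cardinal.aleph0 ≤ κ) {S : Subring T}
    (hS : S.IsSmallAvoiding C κ) {y t : T} (hy : y ∈ S) (hyreg : y ∈ nonZeroDivisors T)
    (hyt : y * t ∈ S) :
    ∃ S' : Subring T, S'.IsSmallAvoiding C κ ∧ S ≤ S' ∧ t ∈ S' := by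
  refine hS.exists_adjoin hκ t fun Q hQ x hx hxQ ↦ ?_
  obtain ⟨n, hn⟩ : ∃ n : ℕ, y ^ n * x ∈ S := by
    clear hxQ
    induction hx using Algebra.adjoin_induction with
    | mem x hx => exact ⟨1, by rw [Set.mem_singleton_iff.mp hx, pow_one]; exact hyt⟩
    | algebraMap r => exact ⟨0, by rw [pow_zero, one_mul]; exact r.2⟩
    | add a b _ _ iha ihb =>
      obtain ⟨m, hm⟩ := iha
      obtain ⟨n, hn⟩ := ihb
      refine ⟨m + n, ?_⟩
      rw [show y ^ (m + n) * (a + b) = y ^ n * (y ^ m * a) + y ^ m * (y ^ n * b) by ring]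
      exact add_mem (mul_mem (pow_mem hy n) hm) (mul_mem (pow_mem hy m) hn)
    | mul a b _ _ iha ihb =>
      obtain ⟨m, hm⟩ := iha
      obtain ⟨n, hn⟩ := ihb
      refine ⟨m + n, ?_⟩
      rw [show y ^ (m + n) * (a * b) = (y ^ m * a) * (y ^ n * b) by ring]
      exact mul_mem hm hn
  exact (mul_left_mem_nonZeroDivisors_eq_zero_iff (pow_mem hyreg n)).mp
    (hS.eq_zero_of_mem Q hQ _ hn (Q.mul_mem_left _ hxQ))

/-- A small subring avoiding finitely many nonmaximal primes can be enlarged by an element of any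
coset `a + I`, provided `I` is contained in none of these primes. -/
theorem Subring.IsSmallAvoiding.exists_adjoin_add {T : Type u} [CommRing T] [IsLocalRing T]
    [IsNoetherianRing T] [IsAdicComplete (maximalIdeal T) T] {C : Set (Ideal T)}
    (hCfin : C.Finite) (hC : ∀ Q ∈ C, Q.IsPrime ∧ Q ≠ maximalIdeal T)
    {κ : Cardinal.{u}} (hκ : Cardinal.aleph0 ≤ κ)
    (hκT : κ ≤ Cardinal.aleph0 ∨ κ < Cardinal.mk (ResidueField T))
    {S : Subring T} (hS : S.IsSmallAvoiding C κ) (a : T) {I : Ideal T}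
    (hI : ∀ Q ∈ C, ¬ I ≤ Q) :
    ∃ S' : Subring T, S'.IsSmallAvoiding C κ ∧ S ≤ S' ∧ ∃ x ∈ I, a + x ∈ S' := by
  obtain ⟨d, hdI, hd⟩ : ∃ d ∈ I, ∀ Q ∈ C, d ∉ Q := by
    by_contra! h
    obtain ⟨Q, hQ, hle⟩ := (I.subset_union_prime_finite hCfin (f := id) ⊥ ⊥
      fun Q hQ _ _ ↦ (hC Q hQ).1).mp fun d hd ↦ by simpa using h d hd
    exact hI Q hQ hle
  let D : Set (Ideal T × T) := Set.range fun v : Σ Q : C,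
    {v : T ⧸ Q.1 // IsAlgebraic S v ∧ ∃ t, Ideal.Quotient.mk Q.1 (a + d * t) = v} ↦
      (v.1.1, v.2.2.2.choose)
  have hDcard : Cardinal.mk D ≤ κ := by
    refine Cardinal.mk_range_le.trans ?_
    rw [Cardinal.mk_sigma]
    have := hCfin.to_subtype
    refine (Cardinal.sum_le_mk_mul_iSup _).trans ?_
    refine (mul_le_mul' (Cardinal.mk_le_aleph0.trans hκ) (ciSup_le' fun Q ↦ ?_)).trans
      (Cardinal.mul_eq_self hκ).le
    have := (hC Q.1 Q.2).1
    have hinj : Function.Injective (algebraMap S (T ⧸ Q.1)) := by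
      rw [injective_iff_map_eq_zero]
      intro s hs
      exact Subtype.ext (hS.eq_zero_of_mem Q.1 Q.2 s s.2 (Ideal.Quotient.eq_zero_iff_mem.mp hs))
    have : IsDomain S := hinj.isDomain _
    have : Module.IsTorsionFree S (T ⧸ Q.1) :=
      Module.isTorsionFree_iff_algebraMap_injective.mpr hinj
    exact (Cardinal.mk_subtype_mono fun _ h ↦ h.1).trans
      ((Algebraic.cardinalMk_le_max S (T ⧸ Q.1)).trans (max_le hS.card_le hκ))
  have hDprime : ∀ q ∈ D, q.1.IsPrime ∧ q.1 ≠ maximalIdeal T := by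
    rintro _ ⟨v, rfl⟩
    exact hC _ v.1.2
  obtain ⟨t, ht⟩ : ∃ t : T, ∀ q ∈ D, t - q.2 ∉ q.1 := by
    obtain h | h := hκT
    · exact exists_forall_sub_notMem_of_countable
        (Cardinal.le_aleph0_iff_set_countable.mp (hDcard.trans h)) hDprime
    · exact exists_forall_sub_notMem_of_card_lt (hDcard.trans_lt h)
        fun q hq ↦ (hDprime q hq).1.ne_top
  have htrans : ∀ Q ∈ C, Transcendental S (Ideal.Quotient.mk Q (a + d * t)) := by
    intro Q hQ halg
    have hex : ∃ t', Ideal.Quotient.mk Q (a + d * t') = Ideal.Quotient.mk Q (a + d * t) :=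
      ⟨t, rfl⟩
    refine ht _ ⟨⟨⟨Q, hQ⟩, ⟨_, halg, hex⟩⟩, rfl⟩ ?_
    have h := Ideal.Quotient.eq.mp hex.choose_spec.symm
    rw [add_sub_add_left_eq_sub, ← mul_sub] at h
    exact ((hC Q hQ).1.mem_or_mem h).resolve_left (hd Q hQ)
  obtain ⟨S', hS', hle, hmem⟩ := hS.exists_adjoin hκ (a + d * t) fun Q hQ x hx hxQ ↦ by
    obtain ⟨f, rfl⟩ := Algebra.adjoin_mem_exists_aeval S _ hx
    have hf : f = 0 := by
      refine transcendental_iff.mp (htrans Q hQ) f ?_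
      rw [← Ideal.Quotient.algebraMap_eq, Polynomial.aeval_algebraMap_apply]
      exact Ideal.Quotient.eq_zero_iff_mem.mpr hxQ
    rw [hf, map_zero]
  exact ⟨S', hS', hle, d * t, I.mul_mem_right t hdI, hmem⟩

theorem Subring.mem_span_of_le {T : Type*} [CommRing T] {S S' : Subring T} (h : S ≤ S')
    {s : Set T} {c : T} (hc : c ∈ Submodule.span S s) : c ∈ Submodule.span S' s := by
  induction hc using Submodule.span_induction with
  | mem x hx => exact Submodule.subset_span hx
  | zero => exact zero_mem _
  | add x y _ _ ihx ihy => exact add_mem ihx ihy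
  | smul r x _ ih => exact Submodule.smul_mem _ (⟨r, h r.2⟩ : S') ih

theorem Subring.IsSmallAvoiding.mem_nonZeroDivisors {T : Type u} [CommRing T]
    [IsNoetherianRing T] {C : Set (Ideal T)} (hCass : associatedPrimes T T ⊆ C)
    {κ : Cardinal.{u}} {S : Subring T} (hS : S.IsSmallAvoiding C κ) {y : T} (hy : y ∈ S)
    (hy0 : y ≠ 0) : y ∈ nonZeroDivisors T := by
  by_contra h
  have hmem : y ∈ ((nonZeroDivisors T : Set T))ᶜ := h
  rw [← biUnion_associatedPrimes_eq_compl_nonZeroDivisors] at hmem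
  obtain ⟨Q, hQ, hyQ⟩ := Set.mem_iUnion₂.mp hmem
  exact hy0 (hS.eq_zero_of_mem Q (hCass hQ) y hy hyQ)

/-- If `c ∈ S` lies in the extension to `T` of the ideal generated by a finite set `s ⊆ S`, then
`S` can be enlarged so that `c` becomes a combination of `s`. -/
theorem Subring.IsSmallAvoiding.exists_mem_span {T : Type u} [CommRing T] [IsLocalRing T]
    [IsNoetherianRing T] [IsAdicComplete (maximalIdeal T) T] {C : Set (Ideal T)}
    (hCfin : C.Finite) (hC : ∀ Q ∈ C, Q.IsPrime ∧ Q ≠ maximalIdeal T)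
    (hCass : associatedPrimes T T ⊆ C) {κ : Cardinal.{u}} (hκ : Cardinal.aleph0 ≤ κ)
    (hκT : κ ≤ Cardinal.aleph0 ∨ κ < Cardinal.mk (ResidueField T))
    {s : Set T} (hs : s.Finite) {S : Subring T} (hS : S.IsSmallAvoiding C κ) (hsS : s ⊆ S)
    {c : T} (hcS : c ∈ S) (hc : c ∈ Ideal.span s) :
    ∃ S' : Subring T, S'.IsSmallAvoiding C κ ∧ S ≤ S' ∧ c ∈ Submodule.span S' s := by
  induction s, hs using Set.Finite.induction_on generalizing S c with
  | empty =>
    refine ⟨S, hS, le_rfl, ?_⟩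
    rw [Ideal.span_empty, Ideal.mem_bot] at hc
    simp [hc]
  | @insert y s _ _ ih =>
    obtain ⟨hyS, hsS⟩ := Set.insert_subset_iff.mp hsS
    obtain ⟨t, w, hw, rfl⟩ := Ideal.mem_span_insert.mp hc
    by_cases hzero : ∃ y' ∈ s, y' ≠ 0
    · obtain ⟨y', hy's, hy'0⟩ := hzero
      obtain ⟨S₁, hS₁, hle₁, x, hx, hmem⟩ := hS.exists_adjoin_add hCfin hC hκ hκT t
        (I := Ideal.span {y'}) fun Q hQ h ↦ hy'0 (hS.eq_zero_of_mem Q hQ y' (hsS hy's)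
          (h (Ideal.mem_span_singleton_self y')))
      have hxs : x ∈ Ideal.span s := Ideal.span_mono (Set.singleton_subset_iff.mpr hy's) hx
      obtain ⟨S₂, hS₂, hle₂, hspan⟩ := ih hS₁ (hsS.trans hle₁) (c := w - x * y)
        (by
          have := sub_mem (hle₁ hcS) (mul_mem hmem (hle₁ hyS))
          convert this using 1
          ring)
        (sub_mem hw (Ideal.mul_mem_right y _ hxs))
      refine ⟨S₂, hS₂, hle₁.trans hle₂,
        Submodule.mem_span_insert.mpr ⟨⟨t + x, hle₂ hmem⟩, _, hspan, ?_⟩⟩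
      rw [Subring.smul_def, smul_eq_mul]
      ring
    · push Not at hzero
      obtain rfl : w = 0 := by
        rw [Ideal.span_eq_bot.mpr hzero, Ideal.mem_bot] at hw
        exact hw
      rw [add_zero] at hcS ⊢
      obtain rfl | hy0 := eq_or_ne y 0
      · exact ⟨S, hS, le_rfl, by simp⟩
      obtain ⟨S', hS', hle, ht⟩ := hS.exists_adjoin_of_mul_mem hκ hyS
        (hS.mem_nonZeroDivisors hCass hyS hy0) (mul_comm t y ▸ hcS)
      exact ⟨S', hS', hle, Submodule.smul_mem _ (⟨t, ht⟩ : S')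
        (Submodule.subset_span (Set.mem_insert y s))⟩

theorem Subring.isSmallAvoiding_sSup {T : Type u} [CommRing T] {C : Set (Ideal T)}
    {κ : Cardinal.{u}} (hκ : Cardinal.aleph0 ≤ κ) {F : Set (Subring T)} (hne : F.Nonempty)
    (hchain : IsChain (· ≤ ·) F) (hcard : Cardinal.mk F ≤ κ)
    (hF : ∀ S ∈ F, S.IsSmallAvoiding C κ) : (sSup F).IsSmallAvoiding C κ where
  inv_mem x hx y hxy := by
    obtain ⟨S, hS, hxS⟩ := (mem_sSup_of_directedOn hne hchain.directedOn).mp hx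
    exact le_sSup hS ((hF S hS).inv_mem x hxS y hxy)
  eq_zero_of_mem Q hQ x hx hxQ := by
    obtain ⟨S, hS, hxS⟩ := (mem_sSup_of_directedOn hne hchain.directedOn).mp hx
    exact (hF S hS).eq_zero_of_mem Q hQ x hxS hxQ
  card_le := by
    change Cardinal.mk ((sSup F : Subring T) : Set T) ≤ κ
    rw [coe_sSup_of_directedOn hne hchain.directedOn]
    refine (Cardinal.mk_biUnion_le _ _).trans ?_
    have hsup : ⨆ S : F, Cardinal.mk ((S : Subring T) : Set T) ≤ κ :=
      ciSup_le' fun S ↦ (hF S.1 S.2).card_le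
    exact (mul_le_mul' hcard hsup).trans (Cardinal.mul_eq_self hκ).le

/-- Transfinite iteration: if each of at most `κ` monotone requirements can be met by enlarging a
small avoiding subring, then all of them can be met simultaneously. -/
theorem Subring.IsSmallAvoiding.exists_forall {T : Type u} [CommRing T] {C : Set (Ideal T)}
    {κ : Cardinal.{u}} (hκ : Cardinal.aleph0 ≤ κ) {ι : Type u} (hι : Cardinal.mk ι ≤ κ)
    (p : ι → Subring T → Prop) (hp : ∀ i, Monotone (p i)) {S : Subring T}
    (hS : S.IsSmallAvoiding C κ)
    (hext : ∀ i, ∀ A : Subring T, A.IsSmallAvoiding C κ → S ≤ A →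
      ∃ B : Subring T, B.IsSmallAvoiding C κ ∧ A ≤ B ∧ p i B) :
    ∃ S' : Subring T, S'.IsSmallAvoiding C κ ∧ S ≤ S' ∧ ∀ i, p i S' := by
  obtain ⟨_, _⟩ := exists_wellFoundedLT ι
  choose! next hnext hle hpnext using hext
  let F : ι → Subring T := WellFoundedLT.fix fun i rec ↦
    next i (sSup (insert S (Set.range fun j : Set.Iio i ↦ rec j.1 j.2)))
  let G : Set ι → Subring T := fun J ↦ sSup (insert S (F '' J))
  have hF : ∀ i, F i = next i (G (Set.Iio i)) := by
    intro i
    simp only [F, G, Set.image_eq_range]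
    exact WellFoundedLT.fix_eq _ i
  have hSG : ∀ J, S ≤ G J := fun J ↦ le_sSup (Set.mem_insert _ _)
  have hFG : ∀ J : Set ι, ∀ i ∈ J, F i ≤ G J := fun J i hi ↦
    le_sSup (Set.mem_insert_of_mem _ (Set.mem_image_of_mem F hi))
  have hG : ∀ J : Set ι, (∀ i ∈ J, (G (Set.Iio i)).IsSmallAvoiding C κ) →
      (G J).IsSmallAvoiding C κ := by
    intro J hJ
    have hGF : ∀ i ∈ J, G (Set.Iio i) ≤ F i := fun i hi ↦ by
      rw [hF]
      exact hle i _ (hJ i hi) (hSG _)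
    refine isSmallAvoiding_sSup hκ (Set.insert_nonempty _ _) ?_ ?_ ?_
    · refine IsChain.insert ?_ ?_
      · rintro _ ⟨i, hi, rfl⟩ _ ⟨j, hj, rfl⟩ _
        obtain h | rfl | h := lt_trichotomy i j
        · exact Or.inl ((hFG _ i h).trans (hGF j hj))
        · exact Or.inl le_rfl
        · exact Or.inr ((hFG _ j h).trans (hGF i hi))
      · rintro _ ⟨i, hi, rfl⟩ _
        exact Or.inl ((hSG _).trans (hGF i hi))
    · refine Cardinal.mk_insert_le.trans ?_
      exact Cardinal.add_le_of_le hκ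
        (Cardinal.mk_image_le.trans ((Cardinal.mk_set_le J).trans hι))
        (Cardinal.one_le_aleph0.trans hκ)
    · rintro _ (rfl | ⟨i, hi, rfl⟩)
      · exact hS
      · rw [hF]
        exact hnext i _ (hJ i hi) (hSG _)
  have hGood : ∀ i, (G (Set.Iio i)).IsSmallAvoiding C κ := fun i ↦
    WellFoundedLT.induction i fun i ih ↦ hG _ ih
  refine ⟨G Set.univ, hG _ fun i _ ↦ hGood i, hSG _, fun i ↦ ?_⟩
  exact hp i (hFG _ i (Set.mem_univ i)) (hF i ▸ hpnext i _ (hGood i) (hSG _))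

/-- A small avoiding subring `A` can be enlarged to `B` such that every ideal `I` of `A`
generated by a finite set satisfies `IT ∩ A ⊆ IB`. -/
theorem Subring.IsSmallAvoiding.exists_forall_mem_span_of_mem {T : Type u} [CommRing T]
    [IsLocalRing T] [IsNoetherianRing T] [IsAdicComplete (maximalIdeal T) T] {C : Set (Ideal T)}
    (hCfin : C.Finite) (hC : ∀ Q ∈ C, Q.IsPrime ∧ Q ≠ maximalIdeal T)
    (hCass : associatedPrimes T T ⊆ C) {κ : Cardinal.{u}} (hκ : Cardinal.aleph0 ≤ κ)
    (hκT : κ ≤ Cardinal.aleph0 ∨ κ < Cardinal.mk (ResidueField T))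
    {A : Subring T} (hA : A.IsSmallAvoiding C κ) :
    ∃ B : Subring T, B.IsSmallAvoiding C κ ∧ A ≤ B ∧
      ∀ s : Finset T, (s : Set T) ⊆ A → ∀ c ∈ A, c ∈ Ideal.span (s : Set T) →
        c ∈ Submodule.span B (s : Set T) := by
  have hcard : Cardinal.mk (Finset A × A) ≤ κ := by
    rw [Cardinal.mk_prod, Cardinal.lift_id, Cardinal.lift_id]
    refine (mul_le_mul' ?_ hA.card_le).trans (Cardinal.mul_eq_self hκ).le
    cases finite_or_infinite A
    · exact Cardinal.mk_le_aleph0.trans hκ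
    · rw [Cardinal.mk_finset_of_infinite]
      exact hA.card_le
  let gens : Finset A × A → Set T := fun i ↦ Subtype.val '' (i.1 : Set A)
  let p : Finset A × A → Subring T → Prop := fun i B ↦
    (i.2 : T) ∈ Ideal.span (gens i) → (i.2 : T) ∈ Submodule.span B (gens i)
  have hp : ∀ i, Monotone (p i) := fun i B B' hBB' h hc ↦ mem_span_of_le hBB' (h hc)
  obtain ⟨B, hB, hAB, h⟩ := hA.exists_forall hκ hcard p hp fun i A' hA' hle ↦ by
    by_cases hc : (i.2 : T) ∈ Ideal.span (gens i)
    · have hgens : gens i ⊆ A' := by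
        rintro _ ⟨x, _, rfl⟩
        exact hle x.2
      obtain ⟨B, hB, hAB, h⟩ := hA'.exists_mem_span hCfin hC hCass hκ hκT
        (i.1.finite_toSet.image _) hgens (hle i.2.2) hc
      exact ⟨B, hB, hAB, fun _ ↦ h⟩
    · exact ⟨A', hA', le_rfl, fun h ↦ absurd h hc⟩
  refine ⟨B, hB, hAB, fun s hs c hc hcs ↦ ?_⟩
  let s' : Finset A := s.preimage Subtype.val Subtype.val_injective.injOn
  have hgens : gens (s', ⟨c, hc⟩) = s := by
    simp only [gens, s', Finset.coe_preimage]
    exact Set.image_preimage_eq_iff.mpr fun x hx ↦ ⟨⟨x, hs hx⟩, rfl⟩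
  have hmem := h (s', ⟨c, hc⟩)
  simp only [p, hgens] at hmem
  exact hmem hcs

/-- A small avoiding subring can be enlarged to a subring `S'` all of whose finitely generated
ideals are contracted from `T`. -/
theorem Subring.IsSmallAvoiding.exists_forall_mem_span {T : Type u} [CommRing T] [IsLocalRing T]
    [IsNoetherianRing T] [IsAdicComplete (maximalIdeal T) T] {C : Set (Ideal T)}
    (hCfin : C.Finite) (hC : ∀ Q ∈ C, Q.IsPrime ∧ Q ≠ maximalIdeal T)
    (hCass : associatedPrimes T T ⊆ C) {κ : Cardinal.{u}} (hκ : Cardinal.aleph0 ≤ κ)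
    (hκT : κ ≤ Cardinal.aleph0 ∨ κ < Cardinal.mk (ResidueField T))
    {S : Subring T} (hS : S.IsSmallAvoiding C κ) :
    ∃ S' : Subring T, S'.IsSmallAvoiding C κ ∧ S ≤ S' ∧
      ∀ s : Finset T, (s : Set T) ⊆ S' → ∀ c ∈ S', c ∈ Ideal.span (s : Set T) →
        c ∈ Submodule.span S' (s : Set T) := by
  choose! next hnext hle hspan using fun (A : Subring T) (hA : A.IsSmallAvoiding C κ) ↦
    hA.exists_forall_mem_span_of_mem hCfin hC hCass hκ hκT
  let A : ℕ → Subring T := fun n ↦ next^[n] S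
  have hAsucc : ∀ n, A (n + 1) = next (A n) := fun n ↦ Function.iterate_succ_apply' next n S
  have hA : ∀ n, (A n).IsSmallAvoiding C κ := by
    intro n
    induction n with
    | zero => exact hS
    | succ n ih => exact hAsucc n ▸ hnext _ ih
  have hmono : Monotone A := monotone_nat_of_le_succ fun n ↦ hAsucc n ▸ hle _ (hA n)
  have hchain : IsChain (· ≤ ·) (Set.range A) := hmono.isChain_range
  have hmem : ∀ {x}, x ∈ sSup (Set.range A) ↔ ∃ n, x ∈ A n := by
    intro x
    rw [mem_sSup_of_directedOn (Set.range_nonempty A) hchain.directedOn, Set.exists_range_iff]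
  refine ⟨sSup (Set.range A), isSmallAvoiding_sSup hκ (Set.range_nonempty A) hchain
    ?_ (Set.forall_mem_range.mpr hA), le_sSup ⟨0, rfl⟩, fun s hs c hc hcs ↦ ?_⟩
  · exact ((Set.countable_range A).le_aleph0).trans hκ
  obtain ⟨k, hk⟩ := hmem.mp hc
  obtain ⟨n, hn⟩ : ∃ n, (s : Set T) ⊆ A n := by
    choose! f hf using fun x (hx : x ∈ s) ↦ hmem.mp (hs hx)
    exact ⟨s.sup f, fun x hx ↦ hmono (Finset.le_sup hx) (hf x hx)⟩
  have := hspan (A (max n k)) (hA _) s (hn.trans (hmono (le_max_left n k))) c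
    (hmono (le_max_right n k) hk) hcs
  exact mem_span_of_le (hAsucc _ ▸ le_sSup (Set.mem_range_self (max n k + 1))) this

theorem Subring.comap_map_subtype_eq_of_mem_span {T : Type*} [CommRing T] {S : Subring T}
    (h : ∀ s : Finset T, (s : Set T) ⊆ S → ∀ c ∈ S, c ∈ Ideal.span (s : Set T) →
      c ∈ Submodule.span S (s : Set T)) {I : Ideal S} (hI : I.FG) :
    Ideal.comap S.subtype (Ideal.map S.subtype I) = I := by
  classical
  refine le_antisymm (fun c hc ↦ ?_) Ideal.le_comap_map
  obtain ⟨s, rfl⟩ := hI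
  rw [Ideal.mem_comap, Ideal.map_span, ← Finset.coe_image] at hc
  have hmem := h (s.image S.subtype) (by simp +contextual [Set.subset_def]) c c.2 hc
  rw [Finset.coe_image] at hmem
  have hmap := Submodule.map_span (Algebra.linearMap S T) (s : Set S)
  obtain ⟨d, hd, hdc⟩ := (Submodule.mem_map).mp (hmap.symm ▸ hmem)
  rwa [← Subtype.ext (a1 := d) (a2 := c) hdc]

theorem isPSubring_iff_isSmallAvoiding {T : Type u} [CommRing T] [IsLocalRing T] {P : Ideal T}
    {R : Subring T} : IsPSubring T P R ↔
      R.IsSmallAvoiding (insert P (associatedPrimes T T)) (Cardinal.mk R) ∧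
      (Cardinal.mk R ≤ max Cardinal.aleph0 (Cardinal.mk (ResidueField T)) ∧
        (Cardinal.mk R = max Cardinal.aleph0 (Cardinal.mk (ResidueField T)) →
          Cardinal.mk (ResidueField T) ≤ Cardinal.aleph0)) := by
  have hcomap : ∀ Q : Ideal T, Ideal.comap R.subtype Q = ⊥ ↔ ∀ x ∈ R, x ∈ Q → x = 0 := by
    intro Q
    rw [eq_bot_iff]
    exact ⟨fun h x hx hxQ ↦ congrArg Subtype.val (h (x := ⟨x, hx⟩) hxQ),
      fun h x hx ↦ Subtype.ext (h x x.2 hx)⟩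
  constructor
  · rintro ⟨hloc, hmax, hcard, hP, hass⟩
    refine ⟨⟨fun x hx y hxy ↦ ?_, ?_, le_rfl⟩, hcard⟩
    · have hunit : IsUnit (⟨x, hx⟩ : R) := by
        rw [← notMem_maximalIdeal, ← eq_maximalIdeal hmax]
        exact fun h ↦ h (IsUnit.of_mul_eq_one y hxy)
      obtain ⟨z, hz⟩ := hunit.exists_right_inv
      have hz' : x * z = 1 := congrArg Subtype.val hz
      have hyz : y = z := by linear_combination z * hxy - y * hz'
      exact hyz ▸ z.2
    · rintro Q (rfl | hQ)
      · exact (hcomap Q).mp hP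
      · exact (hcomap Q).mp (hass Q hQ)
  · rintro ⟨h, hcard⟩
    have : IsLocalHom R.subtype := ⟨fun x hx ↦ by
      obtain ⟨y, hy⟩ := hx.exists_right_inv
      exact IsUnit.of_mul_eq_one ⟨y, h.inv_mem x x.2 y hy⟩ (Subtype.ext hy)⟩
    have hloc : IsLocalRing R := R.subtype.domain_isLocalRing
    refine ⟨hloc, ?_, hcard, (hcomap P).mpr (h.eq_zero_of_mem P (Or.inl rfl)),
      fun Q hQ ↦ (hcomap Q).mpr (h.eq_zero_of_mem Q (Or.inr hQ))⟩
    rw [maximalIdeal_comap R.subtype]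
    infer_instance

/-- Enlarging a `p`-subring to hit a prescribed coset of `m²` while also
achieving `IT ∩ S = I` for every finitely generated ideal `I` of `S`. -/
theorem pSubring_adjoin_coset_ideal_contraction
    (T : Type*) [CommRing T] [IsLocalRing T] [IsNoetherianRing T]
    [IsAdicComplete (maximalIdeal T) T]
    (hm : maximalIdeal T ∉ associatedPrimes T T)
    (P : Ideal T) (hP : P.IsPrime) (hPm : P ≠ maximalIdeal T)
    (R : Subring T) (hR : IsPSubring T P R) (hRinf : Infinite R) (u : T) :
    ∃ S : Subring T, IsPSubring T P S ∧ R ≤ S ∧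
      (∃ a ∈ S, a - u ∈ maximalIdeal T ^ 2) ∧
      (∀ I : Ideal S, I.FG → Ideal.comap S.subtype (Ideal.map S.subtype I) = I) ∧
      Cardinal.mk S = Cardinal.mk R := by
  have hC : ∀ Q ∈ insert P (associatedPrimes T T), Q.IsPrime ∧ Q ≠ maximalIdeal T := by
    rintro Q (rfl | hQ)
    · exact ⟨hP, hPm⟩
    · exact ⟨hQ.isPrime, fun h ↦ hm (h ▸ hQ)⟩
  have hCfin : (insert P (associatedPrimes T T)).Finite := (associatedPrimes.finite T T).insert P
  obtain ⟨hRavoid, hcard, hcard_eq⟩ := isPSubring_iff_isSmallAvoiding.mp hR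
  have hκ : Cardinal.aleph0 ≤ Cardinal.mk R := Cardinal.aleph0_le_mk R
  have hκT : Cardinal.mk R ≤ Cardinal.aleph0 ∨ Cardinal.mk R < Cardinal.mk (ResidueField T) := by
    obtain h | h := le_total (Cardinal.mk (ResidueField T)) Cardinal.aleph0
    · exact Or.inl (hcard.trans (max_le le_rfl h))
    · rw [max_eq_right h] at hcard hcard_eq
      exact hcard.eq_or_lt.imp (fun h' ↦ h'.le.trans (hcard_eq h')) id
  obtain ⟨S₁, hS₁, hRS₁, x, hx, hux⟩ := hRavoid.exists_adjoin_add hCfin hC hκ hκT u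
    (I := maximalIdeal T ^ 2) fun Q hQ ↦ (hC Q hQ).1.not_pow_maximalIdeal_le (hC Q hQ).2 2
  obtain ⟨S, hS, hS₁S, hspan⟩ := hS₁.exists_forall_mem_span hCfin hC (Set.subset_insert _ _) hκ hκT
  have hRS : R ≤ S := hRS₁.trans hS₁S
  have hcardS : Cardinal.mk S = Cardinal.mk R :=
    hS.card_le.antisymm (Cardinal.mk_le_mk_of_subset hRS)
  refine ⟨S, isPSubring_iff_isSmallAvoiding.mpr ?_, hRS, ⟨u + x, hS₁S hux, by simpa using hx⟩,
    fun I hI ↦ Subring.comap_map_subtype_eq_of_mem_span hspan hI, hcardS⟩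
  rw [hcardS]
  exact ⟨hS, hcard, hcard_eq⟩
end

section
/- Let (T,m) be a complete local ring with depth T ≥ 2 and let p be a nonmaximal prime ideal of T. Let (R, R∩m) be an infinite N-subring of T with R ∩ p = (0) and let u ∈ T. Then there exists an N-subring (S, S∩m) of T such that R ⊆ S ⊆ T, u + m² is in the image of the map S → T/m², |S| = |R|, S ∩ p = (0), and prime elements of R remain prime in S. -/
open IsLocalRing

open Polynomial Cardinal

universe u

/-- A polynomial that is nonzero modulo a prime `Q` takes values outside `Q` off a finite set
of residues. -/
lemma finite_setOf_eval_mem_of_map_ne_zero {T κ : Type*} [CommRing T] (Q : Ideal T) [Q.IsPrime]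
    {f : T[X]} (hf : f.map (Ideal.Quotient.mk Q) ≠ 0) {s : κ → T}
    (hs : Function.Injective fun c => Ideal.Quotient.mk Q (s c)) :
    {c | f.eval (s c) ∈ Q}.Finite := by
  refine Set.Finite.of_finite_image (f := fun c => Ideal.Quotient.mk Q (s c)) ?_ hs.injOn
  refine (Polynomial.finite_setOfPred_isRoot hf).subset ?_
  rintro _ ⟨c, hc, rfl⟩
  simpa [Polynomial.IsRoot, Polynomial.eval_map, Polynomial.eval₂_at_apply,
    Ideal.Quotient.eq_zero_iff_mem] using hc

/-- Over a large residue field, an ideal contained in none of the primes `Q i` has an element `t`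
such that `u + t` is a root of `f i` modulo `Q i` for no `i`. -/
lemma exists_mem_eval_notMem_of_card_lt {T ι : Type u} [CommRing T] [IsLocalRing T]
    [IsNoetherianRing T] (I : Ideal T) (u : T) (Q : ι → Ideal T) [∀ i, (Q i).IsPrime]
    (f : ι → T[X]) (hI : ∀ i, ¬ I ≤ Q i)
    (hf : ∀ i, (f i).map (Ideal.Quotient.mk (Q i)) ≠ 0)
    (hcard : max ℵ₀ #ι < #(ResidueField T)) :
    ∃ t ∈ I, ∀ i, (f i).eval (u + t) ∉ Q i := by
  obtain ⟨n, x, hx⟩ := Submodule.fg_iff_exists_fin_generating_family.mp (IsNoetherian.noetherian I)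
  set g : T[X] := ∑ i : Fin n, C (x i) * X ^ (i.val + 1) with hg
  have hgI (c : T) : g.eval c ∈ I := by
    rw [hg, Polynomial.eval_finsetSum]
    refine Ideal.sum_mem _ fun i _ => ?_
    have : x i ∈ I := hx ▸ Submodule.subset_span ⟨i, rfl⟩
    simpa using Ideal.mul_mem_right _ _ this
  have hcoeff (i : Fin n) : (C u + g).coeff (i + 1) = x i := by
    simp [hg, Polynomial.finsetSum_coeff, Polynomial.coeff_X_pow, Fin.val_inj]
  let s : ResidueField T → T := Function.surjInv residue_surjective
  have hfin (i : ι) : {c | ((f i).comp (C u + g)).eval (s c) ∈ Q i}.Finite := by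
    refine finite_setOf_eval_mem_of_map_ne_zero (Q i) ?_ ?_
    · rw [Polynomial.map_comp, Ne, Polynomial.comp_eq_zero_iff]
      rintro (h | ⟨-, h⟩)
      · exact hf i h
      · refine hI i ?_
        rw [← hx, Ideal.submodule_span_eq, Ideal.span_le]
        rintro _ ⟨j, rfl⟩
        have := congrArg (fun p => p.coeff (j + 1)) h
        simp only [Polynomial.coeff_map, hcoeff, Polynomial.coeff_C_succ] at this
        exact Ideal.Quotient.eq_zero_iff_mem.mp this
    · intro c d hcd
      have h := Ideal.Quotient.eq.mp hcd
      have h' := le_maximalIdeal (Ideal.IsPrime.ne_top inferInstance : Q i ≠ ⊤) h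
      have : residue T (s c) = residue T (s d) := Ideal.Quotient.eq.mpr h'
      simpa [s, Function.surjInv_eq] using this
  have hlt : #(⋃ i, {c | ((f i).comp (C u + g)).eval (s c) ∈ Q i}) < #(ResidueField T) := by
    refine lt_of_le_of_lt (Cardinal.mk_iUnion_le _) (lt_of_le_of_lt ?_ hcard)
    refine (mul_le_mul' le_rfl (ciSup_le' (a := ℵ₀) fun i => ?_)).trans ?_
    · exact (hfin i).lt_aleph0.le
    · exact (Cardinal.mul_le_max _ _).trans (by simp [le_total])
  obtain ⟨c, hc⟩ : ∃ c, c ∉ ⋃ i, {c | ((f i).comp (C u + g)).eval (s c) ∈ Q i} := by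
    by_contra! h
    rw [Set.eq_univ_of_forall h, Cardinal.mk_univ] at hlt
    exact hlt.false
  refine ⟨g.eval (s c), hgI _, fun i hi => hc (Set.mem_iUnion.mpr ⟨i, ?_⟩)⟩
  simpa [Polynomial.eval_comp] using hi

lemma exists_notMem_sup_pow {T : Type*} [CommRing T] [IsLocalRing T] [IsNoetherianRing T]
    (Q : Ideal T) {y : T} (hy : y ∉ Q) : ∃ n, y ∉ Q ⊔ maximalIdeal T ^ n := by
  by_contra! h
  refine hy (Ideal.Quotient.eq_zero_iff_mem.mp ?_)
  rw [← Submodule.mem_bot T, ← Ideal.iInf_pow_smul_eq_bot_of_isLocalRing (maximalIdeal T)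
    (Ideal.IsPrime.ne_top inferInstance), Submodule.mem_iInf]
  intro n
  obtain ⟨a, ha, b, hb, rfl⟩ := Submodule.mem_sup.mp (h n)
  rw [map_add, Ideal.Quotient.eq_zero_iff_mem.mpr ha, zero_add,
    show Ideal.Quotient.mk Q b = b • (1 : T ⧸ Q) by
      rw [Algebra.smul_def, mul_one]; rfl]
  exact Submodule.smul_mem_smul hb trivial

lemma exists_mem_pow_eval_notMem {T : Type*} [CommRing T] [IsLocalRing T]
    (Q : Ideal T) [Q.IsPrime] (hQ : Q ≠ maximalIdeal T) {f : T[X]}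
    (hf : f.map (Ideal.Quotient.mk Q) ≠ 0) (u : T) (n : ℕ) :
    ∃ t ∈ maximalIdeal T ^ n, f.eval (u + t) ∉ Q := by
  obtain ⟨z, hz, hzQ⟩ : ∃ z ∈ maximalIdeal T, z ∉ Q := by
    by_contra! h
    exact hQ (le_antisymm (le_maximalIdeal (Ideal.IsPrime.ne_top inferInstance)) h)
  have hfin := finite_setOf_eval_mem_of_map_ne_zero Q hf (s := fun k : ℕ => u + z ^ (n + k)) ?_
  · obtain ⟨k, hk⟩ := hfin.infinite_compl.nonempty
    exact ⟨z ^ (n + k), Ideal.pow_le_pow_right (by lia) (Ideal.pow_mem_pow hz _), hk⟩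
  · have key (k d : ℕ) : Ideal.Quotient.mk Q (u + z ^ (n + k)) ≠
        Ideal.Quotient.mk Q (u + z ^ (n + (k + d + 1))) := by
      intro h
      rw [Ideal.Quotient.eq, show u + z ^ (n + k) - (u + z ^ (n + (k + d + 1))) =
        z ^ (n + k) * (1 - z ^ (d + 1)) by ring] at h
      have h1 : IsUnit (1 - z ^ (d + 1)) :=
        isUnit_one_sub_self_of_mem_nonunits _ (Ideal.pow_mem_of_mem _ hz _ (by lia))
      exact hzQ (Ideal.IsPrime.mem_of_pow_mem inferInstance _ ((Q.mul_unit_mem_iff_mem h1).mp h))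
    intro k l hkl
    by_contra hne
    rcases lt_or_gt_of_ne hne with h | h
    · obtain ⟨d, rfl⟩ := Nat.exists_eq_add_of_lt h
      exact key _ _ hkl
    · obtain ⟨d, rfl⟩ := Nat.exists_eq_add_of_lt h
      exact key _ _ hkl.symm

/-- Over a complete local ring, any power of the maximal ideal has an element `t` such that `u + t`
is a root of `f i` modulo `Q i` for no `i`, for countably many nonmaximal primes `Q i`. -/
lemma exists_mem_pow_eval_notMem_of_countable {T ι : Type*} [CommRing T] [IsLocalRing T]
    [IsNoetherianRing T] [IsAdicComplete (maximalIdeal T) T] [Countable ι] (N : ℕ) (u : T)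
    (Q : ι → Ideal T) [∀ i, (Q i).IsPrime] (f : ι → T[X]) (hQ : ∀ i, Q i ≠ maximalIdeal T)
    (hf : ∀ i, (f i).map (Ideal.Quotient.mk (Q i)) ≠ 0) :
    ∃ t ∈ maximalIdeal T ^ N, ∀ i, (f i).eval (u + t) ∉ Q i := by
  rcases isEmpty_or_nonempty ι with h | h
  · exact ⟨0, zero_mem _, fun i => h.elim i⟩
  obtain ⟨e, he⟩ := exists_surjective_nat ι
  have step (i : ι) (p : T × ℕ) : ∃ q : T × ℕ, p.2 < q.2 ∧ q.1 - p.1 ∈ maximalIdeal T ^ p.2 ∧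
      ∀ y, y - q.1 ∈ maximalIdeal T ^ q.2 → (f i).eval (u + y) ∉ Q i := by
    obtain ⟨t, ht, htQ⟩ := exists_mem_pow_eval_notMem (Q i) (hQ i) (hf i) (u + p.1) p.2
    obtain ⟨n, hn⟩ := exists_notMem_sup_pow (Q i) htQ
    refine ⟨(p.1 + t, n + p.2 + 1), by dsimp only; lia, by simpa using ht, fun y hy hyQ => hn ?_⟩
    have h1 : (u + y) - (u + p.1 + t) ∈ maximalIdeal T ^ n := by
      refine Ideal.pow_le_pow_right (by lia : n ≤ n + p.2 + 1) ?_
      convert hy using 1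
      simp only; ring
    have h2 := Ideal.mem_of_dvd _ (Polynomial.sub_dvd_eval_sub (u + y) (u + p.1 + t) (f i)) h1
    rw [← sub_sub_cancel ((f i).eval (u + y)) ((f i).eval (u + p.1 + t))]
    exact sub_mem (Ideal.mem_sup_left hyQ) (Ideal.mem_sup_right h2)
  choose F hF1 hF2 hF3 using step
  let a : ℕ → T × ℕ := fun n => Nat.rec (0, N) (fun n p => F (e n) p) n
  have ha (n : ℕ) : a (n + 1) = F (e n) (a n) := rfl
  have hmono : StrictMono fun n => (a n).2 := strictMono_nat_of_lt_succ fun n => hF1 _ _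
  have hcauchy (n k : ℕ) : (a (n + k)).1 - (a n).1 ∈ maximalIdeal T ^ (a n).2 := by
    induction k with
    | zero => simp
    | succ k ih =>
      rw [← sub_add_sub_cancel _ (a (n + k)).1]
      exact add_mem (Ideal.pow_le_pow_right (hmono.monotone (Nat.le_add_right n k)) (hF2 _ _)) ih
  obtain ⟨L, hL⟩ := IsPrecomplete.prec' (I := maximalIdeal T) (fun n => (a n).1) (by
    intro m n hmn
    obtain ⟨k, rfl⟩ := Nat.exists_eq_add_of_le hmn
    rw [SModEq.sub_mem, ← neg_mem_iff, neg_sub, smul_eq_mul, Ideal.mul_top]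
    exact Ideal.pow_le_pow_right (hmono.id_le m) (hcauchy m k))
  have hlim (n : ℕ) : L - (a n).1 ∈ maximalIdeal T ^ (a n).2 := by
    rw [← sub_add_sub_cancel _ (a (n + (a n).2)).1]
    refine add_mem ?_ (hcauchy _ _)
    have := hL (n + (a n).2)
    rw [SModEq.sub_mem, ← neg_mem_iff, neg_sub, smul_eq_mul, Ideal.mul_top] at this
    exact Ideal.pow_le_pow_right (by lia) this
  refine ⟨L, by simpa [a] using hlim 0, fun i => ?_⟩
  obtain ⟨n, rfl⟩ := he i
  exact hF3 _ _ _ (hlim (n + 1))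

lemma mem_associatedPrimes_quotient_span_singleton_iff {T : Type*} [CommRing T]
    [IsNoetherianRing T] {t : T} {J : Ideal T} :
    J ∈ associatedPrimes T (T ⧸ Ideal.span {t}) ↔
      J.IsPrime ∧ ∃ z, ∀ j, j ∈ J ↔ t ∣ j * z := by
  rw [AssociatedPrimes.mem_iff, isAssociatedPrime_iff]
  refine and_congr_right fun _ => ?_
  rw [Ideal.Quotient.mk_surjective.exists]
  refine exists_congr fun z => ?_
  rw [SetLike.ext_iff]
  refine forall_congr' fun j => ?_
  rw [Submodule.mem_colon_singleton, Submodule.mem_bot, ← Ideal.mem_span_singleton,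
    ← Ideal.Quotient.eq_zero_iff_mem (I := Ideal.span {t}), map_mul, Algebra.smul_def]
  rfl

/-- Being associated to a regular principal ideal does not depend on the regular element chosen
in the prime. -/
lemma mem_associatedPrimes_quotient_span_singleton_of_mem {T : Type*} [CommRing T]
    [IsNoetherianRing T] {t r : T} {J : Ideal T} (ht : t ∈ nonZeroDivisors T)
    (hr : r ∈ nonZeroDivisors T) (hrJ : r ∈ J)
    (hJ : J ∈ associatedPrimes T (T ⧸ Ideal.span {t})) :
    J ∈ associatedPrimes T (T ⧸ Ideal.span {r}) := by
  rw [mem_associatedPrimes_quotient_span_singleton_iff] at hJ ⊢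
  obtain ⟨hp, z, hz⟩ := hJ
  obtain ⟨w, hw⟩ := (hz r).mp hrJ
  refine ⟨hp, w, fun j => (hz j).trans ⟨?_, ?_⟩⟩
  · rintro ⟨s, hs⟩
    refine ⟨s, (mul_cancel_left_mem_nonZeroDivisors ht).mp ?_⟩
    linear_combination r * hs - j * hw
  · rintro ⟨s, hs⟩
    refine ⟨s, (mul_cancel_left_mem_nonZeroDivisors hr).mp ?_⟩
    linear_combination t * hs + j * hw

lemma exists_regular_pair_of_depthGE_two {T : Type*} [CommRing T] [IsLocalRing T]
    (h : DepthGE T 2) : ∃ x ∈ maximalIdeal T, ∃ y ∈ maximalIdeal T, x ∈ nonZeroDivisors T ∧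
      ∀ a, x ∣ y * a → x ∣ a := by
  obtain ⟨rs, hlen, hmem, hreg⟩ := h
  obtain ⟨x, y, rfl⟩ := List.length_eq_two.mp hlen
  have h := hreg.toIsWeaklyRegular
  rw [RingTheory.Sequence.isWeaklyRegular_cons_iff,
    RingTheory.Sequence.isWeaklyRegular_singleton_iff] at h
  refine ⟨x, hmem x (by simp), y, hmem y (by simp), ?_, fun a ⟨b, hb⟩ => ?_⟩
  · exact mem_nonZeroDivisors_iff_right.mpr fun z hz => h.1 (by simpa [mul_comm] using hz)
  · have h2 := @h.2 (Submodule.Quotient.mk a) 0 (by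
      simp only [smul_zero]
      rw [← Submodule.Quotient.mk_smul, Submodule.Quotient.mk_eq_zero, smul_eq_mul, hb]
      exact Submodule.smul_mem_pointwise_smul b x ⊤ trivial)
    rw [Submodule.Quotient.mk_eq_zero] at h2
    obtain ⟨c, -, hc⟩ := h2
    exact ⟨c, hc.symm⟩

lemma maximalIdeal_notMem_associatedPrimes_of_depthGE_two {T : Type*} [CommRing T] [IsLocalRing T]
    [IsNoetherianRing T] (h : DepthGE T 2) : maximalIdeal T ∉ associatedPrimes T T := by
  obtain ⟨x, hx, -, -, hreg, -⟩ := exists_regular_pair_of_depthGE_two h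
  intro hm
  have : x ∈ ⋃ p ∈ associatedPrimes T T, (p : Set T) := Set.mem_biUnion hm hx
  rw [biUnion_associatedPrimes_eq_compl_nonZeroDivisors] at this
  exact this hreg

lemma maximalIdeal_notMem_associatedPrimes_quotient_of_depthGE_two {T : Type*} [CommRing T]
    [IsLocalRing T] [IsNoetherianRing T] (h : DepthGE T 2) {r : T} (hr : r ∈ nonZeroDivisors T) :
    maximalIdeal T ∉ associatedPrimes T (T ⧸ Ideal.span {r}) := by
  obtain ⟨x, hx, y, hy, hreg, hdvd⟩ := exists_regular_pair_of_depthGE_two h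
  rw [mem_associatedPrimes_quotient_span_singleton_iff]
  rintro ⟨hp, z, hz⟩
  obtain ⟨a, ha⟩ := (hz x).mp hx
  obtain ⟨b, hb⟩ := (hz y).mp hy
  obtain ⟨c, rfl⟩ := hdvd a ⟨b, (mul_cancel_left_mem_nonZeroDivisors hr).mp (by
    linear_combination x * hb - y * ha)⟩
  refine hp.ne_top ((Ideal.eq_top_iff_one _).mpr ((hz 1).mpr ⟨c, ?_⟩))
  exact (mul_cancel_left_mem_nonZeroDivisors hreg).mp (by linear_combination ha)

/-- A prime of `R[X]` over the zero ideal of the domain `R` has height at most one. -/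
lemma eq_bot_of_lt_of_comap_C_eq_bot {R : Type*} [CommRing R] [IsDomain R] {p q : Ideal R[X]}
    (hp : p.IsPrime) (hq : q.IsPrime) (hpq : p < q) (h : q.comap C = ⊥) : p = ⊥ := by
  by_contra hne
  let K := FractionRing R
  let M : Submonoid R[X] := (nonZeroDivisors R).map C
  algebraize [Polynomial.mapRingHom (algebraMap R K)]
  have : IsLocalization M K[X] := Polynomial.isLocalization _ _
  have hdq : Disjoint (M : Set R[X]) q := by
    rw [Set.disjoint_left]
    rintro _ ⟨r, hr, rfl⟩ hrq
    have : r ∈ q.comap C := hrq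
    rw [h] at this
    exact nonZeroDivisors.ne_zero hr this
  have hdp : Disjoint (M : Set R[X]) p := hdq.mono_right hpq.le
  have hp' := IsLocalization.isPrime_of_isPrime_disjoint M K[X] p hp hdp
  have hq' := IsLocalization.isPrime_of_isPrime_disjoint M K[X] q hq hdq
  have hup := IsLocalization.under_map_of_isPrime_disjoint M K[X] hp hdp
  have huq := IsLocalization.under_map_of_isPrime_disjoint M K[X] hq hdq
  have hmax : (p.map (algebraMap R[X] K[X])).IsMaximal := by
    refine IsPrime.to_maximal_ideal fun h0 => hne ?_
    rw [← hup, h0]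
    exact Ideal.comap_bot_of_injective _ (Polynomial.map_injective _ (IsFractionRing.injective R K))
  have := hmax.eq_of_le hq'.ne_top (Ideal.map_mono hpq.le)
  rw [this, huq] at hup
  exact hpq.ne hup.symm

/-- A principal prime of a unique factorization domain has height at most one. -/
lemma eq_bot_of_lt_span_singleton {A : Type*} [CommRing A] [IsDomain A]
    [UniqueFactorizationMonoid A] {p : Ideal A} (hp : p.IsPrime) {z : A} (hz : Prime z)
    (h : p < Ideal.span {z}) : p = ⊥ := by
  by_contra hne
  obtain ⟨w, hw, hwp⟩ := hp.exists_mem_prime_of_ne_bot hne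
  have hzw : Associated z w :=
    hz.associated_of_dvd hwp (Ideal.mem_span_singleton.mp (h.le hw))
  refine h.not_ge ?_
  rw [Ideal.span_singleton_le_iff_mem]
  exact p.mem_of_dvd hzw.symm.dvd hw

lemma prime_algebraMap_of_not_isUnit {A B : Type*} [CommRing A] [IsDomain A] [CommRing B]
    [Algebra A B] (M : Submonoid A) [IsLocalization M B] (hM : M ≤ nonZeroDivisors A) {x : A}
    (hx : Prime x) (hxB : ¬ IsUnit (algebraMap A B x)) : Prime (algebraMap A B x) := by
  have hinj := IsLocalization.injective B hM
  rw [← Ideal.span_singleton_prime ((map_ne_zero_iff _ hinj).mpr hx.ne_zero),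
    ← Set.image_singleton, ← Ideal.map_span]
  have hx' : (Ideal.span {x}).IsPrime := (Ideal.span_singleton_prime hx.ne_zero).mpr hx
  refine IsLocalization.isPrime_of_isPrime_disjoint M B _ hx' (Set.disjoint_left.mpr ?_)
  intro m hm hmx
  obtain ⟨c, hc⟩ := Ideal.mem_span_singleton.mp hmx
  have : IsUnit (algebraMap A B m) := IsLocalization.map_units B ⟨m, hm⟩
  rw [hc, map_mul] at this
  exact hxB (isUnit_of_mul_isUnit_left this)

lemma uniqueFactorizationMonoid_of_isLocalization {A B : Type*} [CommRing A] [IsDomain A]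
    [UniqueFactorizationMonoid A] [CommRing B] [IsDomain B] [Algebra A B] (M : Submonoid A)
    [IsLocalization M B] (hM : M ≤ nonZeroDivisors A) : UniqueFactorizationMonoid B := by
  refine UniqueFactorizationMonoid.iff_exists_prime_mem_of_isPrime.mpr fun p hp hpp => ?_
  have h0 : p.comap (algebraMap A B) ≠ ⊥ := fun h0 => hp (by
    rw [← IsLocalization.map_under M B p, Ideal.under, h0, Ideal.map_bot])
  obtain ⟨x, hxp, hx⟩ := (hpp.comap (algebraMap A B)).exists_mem_prime_of_ne_bot h0
  exact ⟨_, hxp, prime_algebraMap_of_not_isUnit M hM hx fun hu =>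
    hpp.ne_top (p.eq_top_of_isUnit_mem hxp hu)⟩

/-- A localization `B` of `A` embeds in any extension of `A` in which the denominators are units. -/
lemma exists_subring_isLocalization {A T : Type*} (B : Type*) [CommRing A] [CommRing B]
    [CommRing T] [Algebra A B] (M : Submonoid A) [IsLocalization M B] (φ : A →+* T)
    (hφ : Function.Injective φ) (hunit : ∀ y : M, IsUnit (φ y)) :
    ∃ (S : Subring T) (θ : A →+* S), (∀ a, (θ a : T) = φ a) ∧
      letI := θ.toAlgebra
      IsLocalization M S := by
  let ψ : B →+* T := IsLocalization.lift hunit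
  have hψ : Function.Injective ψ := by
    rw [IsLocalization.lift_injective_iff]
    have hA : Function.Injective (algebraMap A B) := fun a b hab => by
      have := congrArg ψ hab
      simp only [ψ, IsLocalization.lift_eq] at this
      exact hφ this
    exact fun x y => by rw [hA.eq_iff, hφ.eq_iff]
  refine ⟨ψ.range, ψ.rangeRestrict.comp (algebraMap A B),
    fun a => IsLocalization.lift_eq hunit a, ?_⟩
  let := (ψ.rangeRestrict.comp (algebraMap A B)).toAlgebra
  let e : B ≃ₐ[A] ψ.range :=
    AlgEquiv.ofBijective { ψ.rangeRestrict with commutes' := fun _ => rfl }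
      ⟨fun a b hab => hψ (congrArg Subtype.val hab), ψ.rangeRestrict_surjective⟩
  exact IsLocalization.isLocalization_of_algEquiv M e

/-- An element of the coset `u + m²` transcendental over `R` modulo every prime in `𝒞`. -/
lemma exists_transcendental_modulo {T : Type u} [CommRing T] [IsLocalRing T] [IsNoetherianRing T]
    [IsAdicComplete (maximalIdeal T) T] (R : Subring T) [Infinite R]
    (hle : #R ≤ max ℵ₀ #(ResidueField T))
    (heq : #R = max ℵ₀ #(ResidueField T) → #(ResidueField T) ≤ ℵ₀)
    (𝒞 : Set (Ideal T)) (hcard : #𝒞 ≤ #R) (hprime : ∀ Q ∈ 𝒞, Q.IsPrime)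
    (hmax : maximalIdeal T ∉ 𝒞) (u : T) :
    ∃ w, w - u ∈ maximalIdeal T ^ 2 ∧
      ∀ Q ∈ 𝒞, ∀ f : R[X], aeval w f ∈ Q → ∀ n, (f.coeff n : T) ∈ Q := by
  let ι := {p : 𝒞 × R[X] // (p.2.map R.subtype).map (Ideal.Quotient.mk p.1.1) ≠ 0}
  have hR : ℵ₀ ≤ #R := Cardinal.infinite_iff.mp inferInstance
  have hι : #ι ≤ #R := by
    refine (Cardinal.mk_subtype_le _).trans ?_
    rw [Cardinal.mk_prod, Cardinal.lift_id, Cardinal.lift_id]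
    refine (mul_le_mul' hcard Polynomial.cardinalMk_le_max).trans ?_
    rw [max_eq_left hR, Cardinal.mul_eq_self hR]
  have hp (i : ι) : i.1.1.1.IsPrime := hprime _ i.1.1.2
  have hne (i : ι) : i.1.1.1 ≠ maximalIdeal T := fun h => hmax (h ▸ i.1.1.2)
  obtain ⟨t, ht, htQ⟩ : ∃ t ∈ maximalIdeal T ^ 2, ∀ i : ι,
      (i.1.2.map R.subtype).eval (u + t) ∉ i.1.1.1 := by
    by_cases hk : #(ResidueField T) ≤ ℵ₀
    · have : Countable ι := by
        rw [← Cardinal.mk_le_aleph0_iff]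
        exact hι.trans (hle.trans (max_le le_rfl hk))
      exact exists_mem_pow_eval_notMem_of_countable 2 u (fun i : ι => i.1.1.1)
        (fun i => i.1.2.map R.subtype) hne fun i => i.2
    · refine exists_mem_eval_notMem_of_card_lt (maximalIdeal T ^ 2) u (fun i : ι => i.1.1.1)
        (fun i => i.1.2.map R.subtype) (fun i h => hne i ?_) (fun i => i.2) ?_
      · exact le_antisymm (le_maximalIdeal (hp i).ne_top) ((hp i).le_of_pow_le h)
      · have := lt_of_le_of_ne hle fun h => hk (heq h)
        rw [max_eq_right (not_le.mp hk).le] at this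
        exact max_lt (not_le.mp hk) (hι.trans_lt this)
  refine ⟨u + t, by simpa using ht, fun Q hQ f hf n => ?_⟩
  by_contra hn
  refine htQ ⟨(⟨Q, hQ⟩, f), fun h => hn ?_⟩ ?_
  · have := congrArg (fun p => p.coeff n) h
    simpa [Ideal.Quotient.eq_zero_iff_mem] using this
  · simp only [Polynomial.eval_map]
    exact hf

/-- Enlarging an N-subring to hit a prescribed coset of `m²`, preserving
avoidance of `p` and primality of prime elements. -/
theorem NSubring_adjoin_coset
    (T : Type*) [CommRing T] [IsLocalRing T] [IsNoetherianRing T]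
    [IsAdicComplete (maximalIdeal T) T]
    (hdepth : DepthGE T 2)
    (P : Ideal T) (hP : P.IsPrime) (hPm : P ≠ maximalIdeal T)
    (R : Subring T) (hR : IsNSubring T R)
    (hRP : Ideal.comap R.subtype P = ⊥) (hRinf : Infinite R) (u : T) :
    ∃ (S : Subring T) (hRS : R ≤ S), IsNSubring T S ∧
      (∃ a ∈ S, a - u ∈ maximalIdeal T ^ 2) ∧
      Cardinal.mk S = Cardinal.mk R ∧
      Ideal.comap S.subtype P = ⊥ ∧
      ∀ r : R, Prime r → Prime (Subring.inclusion hRS r) := by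
  obtain ⟨hRloc, hRmax, ⟨hRdom, hRufd⟩, ⟨hle, heq⟩, hRass, hRht⟩ := hR
  have hreg (r : R) (hr : r ≠ 0) : (r : T) ∈ nonZeroDivisors T := by
    by_contra h
    rw [← SetLike.mem_coe, ← Set.mem_compl_iff,
      ← biUnion_associatedPrimes_eq_compl_nonZeroDivisors] at h
    obtain ⟨Q, hQ, hrQ⟩ := Set.mem_iUnion₂.mp h
    have : r ∈ Q.comap R.subtype := hrQ
    rw [hRass Q hQ] at this
    exact hr this
  let 𝒞 : Set (Ideal T) := insert P (associatedPrimes T T ∪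
    ⋃ r : {r : R // r ≠ 0}, associatedPrimes T (T ⧸ Ideal.span {(r.1 : T)}))
  have hRcard : ℵ₀ ≤ #R := Cardinal.infinite_iff.mp hRinf
  have hcard : #𝒞 ≤ #R := by
    have h1 : #(⋃ r : {r : R // r ≠ 0}, associatedPrimes T (T ⧸ Ideal.span {(r.1 : T)})) ≤ #R := by
      refine (Cardinal.mk_iUnion_le _).trans ?_
      refine (mul_le_mul' (Cardinal.mk_subtype_le _) (ciSup_le' (a := ℵ₀) fun r => ?_)).trans ?_
      · exact (associatedPrimes.finite T (T ⧸ Ideal.span {(r.1 : T)})).lt_aleph0.le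
      · exact (Cardinal.mul_aleph0_eq hRcard).le
    refine Cardinal.mk_insert_le.trans ?_
    refine Cardinal.add_le_of_le hRcard ((Cardinal.mk_union_le _ _).trans
      (Cardinal.add_le_of_le hRcard ?_ h1)) (Cardinal.one_le_aleph0.trans hRcard)
    exact (associatedPrimes.finite T T).lt_aleph0.le.trans hRcard
  obtain ⟨w, hwu, hw⟩ := exists_transcendental_modulo R hle heq 𝒞 hcard (by
    rintro Q (rfl | hQ | hQ)
    · exact hP
    · exact hQ.1
    · obtain ⟨r, hr⟩ := Set.mem_iUnion.mp hQ
      exact hr.1) (by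
    rintro (h | h | h)
    · exact hPm h.symm
    · exact maximalIdeal_notMem_associatedPrimes_of_depthGE_two hdepth h
    · obtain ⟨r, hr⟩ := Set.mem_iUnion.mp h
      exact maximalIdeal_notMem_associatedPrimes_quotient_of_depthGE_two hdepth
        (hreg r.1 r.2) hr) u
  have hzero (Q : Ideal T) (hQ : Q ∈ 𝒞) (hRQ : Q.comap R.subtype = ⊥) (f : R[X])
      (hf : aeval w f ∈ Q) : f = 0 := by
    ext n
    have : f.coeff n ∈ Q.comap R.subtype := hw Q hQ f hf n
    rw [hRQ, Ideal.mem_bot] at this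
    simp [this]
  have hinj : Function.Injective (aeval (R := R) w) :=
    (injective_iff_map_eq_zero _).mpr fun f hf =>
      hzero P (Set.mem_insert _ _) hRP f (hf ▸ zero_mem _)
  let q : Ideal R[X] := (maximalIdeal T).comap (aeval (R := R) w)
  obtain ⟨S, θ, hθ, hloc⟩ : ∃ (S : Subring T) (θ : R[X] →+* S),
      (∀ f, (θ f : T) = aeval w f) ∧ letI := θ.toAlgebra; IsLocalization.AtPrime S q :=
    exists_subring_isLocalization (Localization.AtPrime q) q.primeCompl
      (aeval (R := R) w : R[X] →ₐ[R] T).toRingHom hinj fun y => by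
        by_contra h
        exact y.2 ((mem_maximalIdeal _).mpr h)
  let := θ.toAlgebra
  have hqM : q.primeCompl ≤ nonZeroDivisors R[X] := q.primeCompl_le_nonZeroDivisors
  have hSloc : IsLocalRing S := IsLocalization.AtPrime.isLocalRing S q
  have hSdom : IsDomain S := IsLocalization.isDomain_of_le_nonZeroDivisors S hqM
  have hSufd : UniqueFactorizationMonoid S :=
    uniqueFactorizationMonoid_of_isLocalization q.primeCompl hqM
  have hSmax : (maximalIdeal T).comap S.subtype = maximalIdeal S := by
    refine le_antisymm (le_maximalIdeal (Ideal.IsPrime.ne_top inferInstance)) ?_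
    rw [← IsLocalization.AtPrime.map_eq_maximalIdeal q S, Ideal.map_le_iff_le_comap]
    intro f hf
    change (θ f : T) ∈ maximalIdeal T
    rw [hθ]
    exact hf
  have hScard : #S = #R := by
    rw [IsLocalization.cardinalMk S q.primeCompl hqM]
    refine le_antisymm (Polynomial.cardinalMk_le_max.trans (by simp [hRcard])) ?_
    exact Cardinal.mk_le_of_injective Polynomial.C_injective
  have hunder (I : Ideal T) : (I.comap S.subtype).comap (algebraMap R[X] S) =
      I.comap (aeval (R := R) w) := by
    ext f
    change (θ f : T) ∈ I ↔ _
    rw [hθ]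
    rfl
  have hSzero (Q : Ideal T) (hQ : Q ∈ 𝒞) (hRQ : Q.comap R.subtype = ⊥) :
      Q.comap S.subtype = ⊥ := by
    rw [← IsLocalization.map_under q.primeCompl S (Q.comap S.subtype), Ideal.under, hunder,
      Ideal.map_eq_bot_iff_le_ker]
    intro f hf
    rw [hzero Q hQ hRQ f hf]
    exact zero_mem _
  have hunder_lt {I J : Ideal S} (h : I < J) :
      I.comap (algebraMap R[X] S) < J.comap (algebraMap R[X] S) := by
    refine lt_of_le_of_ne (Ideal.comap_mono h.le) fun he => h.ne ?_
    rw [← IsLocalization.map_under q.primeCompl S I, ← IsLocalization.map_under q.primeCompl S J,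
      Ideal.under, he]
  have hC (r : R) : (θ (C r) : T) = r := by
    rw [hθ, aeval_C]
    rfl
  have hRS : R ≤ S := fun r hr => by
    have := (θ (C ⟨r, hr⟩)).2
    rwa [hC] at this
  refine ⟨S, hRS, ⟨hSloc, hSmax ▸ inferInstance, ⟨hSdom, hSufd⟩, hScard.symm ▸ ⟨hle, heq⟩,
    fun Q hQ => hSzero Q (Or.inr (Or.inl hQ)) (hRass Q hQ), ?_⟩, ⟨w, ?_, hwu⟩, hScard,
    hSzero P (Set.mem_insert _ _) hRP, ?_⟩
  · rintro t ht J hJ q0 q1 hq0 hq1 ⟨h01, h1J⟩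
    have hJp : J.IsPrime := hJ.1
    have h01' := hunder_lt h01
    have h1J' := hunder_lt h1J
    rw [hunder] at h1J'
    have hq1' := hq1.comap (algebraMap R[X] S)
    refine (bot_le.trans_lt h01').ne' ?_
    by_cases hRJ : J.comap R.subtype = ⊥
    · refine eq_bot_of_lt_of_comap_C_eq_bot hq1' (hJp.comap (aeval (R := R) w)) h1J' ?_
      rw [← hRJ]
      ext r
      simp only [Ideal.mem_comap, aeval_C]
      rfl
    · obtain ⟨z, hzJ, hz⟩ := (hJp.comap R.subtype).exists_mem_prime_of_ne_bot hRJ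
      have hJC : J ∈ 𝒞 := Or.inr (Or.inr (Set.mem_iUnion.mpr ⟨⟨z, hz.ne_zero⟩,
        mem_associatedPrimes_quotient_span_singleton_of_mem ht (hreg z hz.ne_zero) hzJ hJ⟩))
      have hspan : J.comap R.subtype = Ideal.span {z} := by
        by_contra hne
        refine hRht t ht J hJ ⊥ (Ideal.span {z}) Ideal.isPrime_bot
          ((Ideal.span_singleton_prime hz.ne_zero).mpr hz) ⟨?_, ?_⟩
        · rw [bot_lt_iff_ne_bot, Ne, Ideal.span_singleton_eq_bot]
          exact hz.ne_zero
        · exact lt_of_le_of_ne ((Ideal.span_singleton_le_iff_mem _).mpr hzJ) (Ne.symm hne)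
      refine eq_bot_of_lt_span_singleton hq1' (Polynomial.prime_C_iff.mpr hz)
        (h1J'.trans_le fun f hf => ?_)
      rw [Ideal.mem_span_singleton, Polynomial.C_dvd_iff_dvd_coeff]
      intro n
      rw [← Ideal.mem_span_singleton, ← hspan]
      exact hw J hJC f hf n
  · have := (θ X).2
    rwa [hθ, aeval_X] at this
  · intro r hr
    have hincl : Subring.inclusion hRS r = algebraMap R[X] S (C r) := Subtype.ext (hC r).symm
    rw [hincl]
    refine prime_algebraMap_of_not_isUnit q.primeCompl hqM (Polynomial.prime_C_iff.mpr hr)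
      fun hu => hr.not_isUnit ?_
    by_contra hnu
    have hrm : r ∈ (maximalIdeal T).comap R.subtype := by
      rw [eq_maximalIdeal hRmax]
      exact hnu
    have hu' : IsUnit (r : T) := by
      have := hu.map S.subtype
      rwa [← hincl] at this
    exact hrm hu'
end

section
/- Let (T,m) be a complete local ring with depth T ≥ 2 and let p be a nonmaximal prime ideal of T. Let (R, R∩m) be an infinite N-subring of T with R ∩ p = (0) and let u ∈ T. Then there exists an N-subring (S, S∩m) of T such that: (1) R ⊆ S ⊆ T; (2) u + m² is in the image of the map S → T/m²; (3) |S| = |R|; (4) S ∩ p = (0); (5) prime elements of R remain prime in S; and (6) for every finitely generated ideal I of S, IT ∩ S = I. -/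
open IsLocalRing

section AssociatedPrimes

variable {T : Type*} [CommRing T] [IsNoetherianRing T]

/-- In a Noetherian ring, an associated prime of `T / rT` is of the form `(rT : s)`. -/
theorem exists_mem_iff_dvd_mul_of_mem_associatedPrimes {r : T} {J : Ideal T}
    (hJ : J ∈ associatedPrimes T (T ⧸ Ideal.span {r})) :
    ∃ s, ¬ r ∣ s ∧ ∀ a, a ∈ J ↔ r ∣ a * s := by
  obtain ⟨hp, x, hx⟩ := isAssociatedPrime_iff.1 hJ
  obtain ⟨s, rfl⟩ := Ideal.Quotient.mk_surjective x
  have key : ∀ a, a ∈ J ↔ r ∣ a * s := by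
    intro a
    rw [hx, Submodule.mem_colon_singleton, Submodule.mem_bot, ← Ideal.mem_span_singleton,
      ← Ideal.Quotient.eq_zero_iff_mem, map_mul]
    rfl
  refine ⟨s, fun h => hp.ne_top ?_, key⟩
  rw [Ideal.eq_top_iff_one, key, one_mul]
  exact h

theorem exists_mem_associatedPrimes_of_dvd_mul {r w τ : T} (h : r ∣ w * τ) (hτ : ¬ r ∣ τ) :
    ∃ J ∈ associatedPrimes T (T ⧸ Ideal.span {r}), w ∈ J := by
  have hne : Ideal.Quotient.mk (Ideal.span {r}) τ ≠ 0 := by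
    rwa [Ne, Ideal.Quotient.eq_zero_iff_mem, Ideal.mem_span_singleton]
  obtain ⟨J, hJ, hle⟩ := exists_le_isAssociatedPrime_of_isNoetherianRing T _ hne
  refine ⟨J, hJ, hle ?_⟩
  rw [Submodule.mem_colon_singleton, Submodule.mem_bot]
  change Ideal.Quotient.mk (Ideal.span {r}) (w * τ) = 0
  rwa [Ideal.Quotient.eq_zero_iff_mem, Ideal.mem_span_singleton]

theorem mem_of_mem_associatedPrimes_quotient_span {r : T} {J : Ideal T}
    (hJ : J ∈ associatedPrimes T (T ⧸ Ideal.span {r})) : r ∈ J := by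
  obtain ⟨s, -, hs⟩ := exists_mem_iff_dvd_mul_of_mem_associatedPrimes hJ
  exact (hs r).2 (dvd_mul_right r s)

/-- An associated prime of `T / tT`, with `t` regular, contains no regular sequence of
length two. -/
theorem false_of_regular_pair_mem_associatedPrimes {t : T} (ht : t ∈ nonZeroDivisors T)
    {J : Ideal T} (hJ : J ∈ associatedPrimes T (T ⧸ Ideal.span {t})) {p x : T}
    (hp : p ∈ nonZeroDivisors T) (hpJ : p ∈ J) (hxJ : x ∈ J) (hx : ∀ e, p ∣ x * e → p ∣ e) :
    False := by
  obtain ⟨s, hs, hs'⟩ := exists_mem_iff_dvd_mul_of_mem_associatedPrimes hJ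
  obtain ⟨a, ha⟩ := (hs' p).1 hpJ
  obtain ⟨b, hb⟩ := (hs' x).1 hxJ
  have h1 : x * a = p * b := by
    refine (mul_cancel_left_mem_nonZeroDivisors ht).1 ?_
    linear_combination p * hb - x * ha
  obtain ⟨a', rfl⟩ := hx a ⟨b, h1⟩
  refine hs ⟨a', (mul_cancel_left_mem_nonZeroDivisors hp).1 ?_⟩
  linear_combination ha

/-- In depth at least two, the maximal ideal is not associated to a regular principal ideal. -/
theorem DepthGE.maximalIdeal_notMem_associatedPrimes [IsLocalRing T] (hd : DepthGE T 2) {r : T}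
    (hr : r = 0 ∨ r ∈ nonZeroDivisors T) :
    maximalIdeal T ∉ associatedPrimes T (T ⧸ Ideal.span {r}) := by
  intro hJ
  obtain ⟨rs, hlen, hmem, hreg⟩ := hd
  obtain ⟨a, b, rfl⟩ := List.length_eq_two.1 hlen
  have hw := hreg.toIsWeaklyRegular
  rw [RingTheory.Sequence.isWeaklyRegular_cons_iff] at hw
  obtain ⟨h1, h2⟩ := hw
  rw [RingTheory.Sequence.isWeaklyRegular_singleton_iff] at h2
  have ha : a ∈ nonZeroDivisors T := by
    rw [mem_nonZeroDivisors_iff_right]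
    intro x hx
    exact h1 (by simpa [mul_comm] using hx)
  have hb : ∀ e, a ∣ b * e → a ∣ e := by
    intro e ⟨c, hc⟩
    have h3 := @h2 (Submodule.Quotient.mk e) 0 (by
      simp only [smul_zero]
      rw [← Submodule.Quotient.mk_smul, Submodule.Quotient.mk_eq_zero]
      exact ⟨c, trivial, by simpa using hc.symm⟩)
    rw [Submodule.Quotient.mk_eq_zero] at h3
    obtain ⟨c, -, hc⟩ := h3
    exact ⟨c, by simpa using hc.symm⟩
  have ham := hmem a (by simp)
  have hbm := hmem b (by simp)
  rcases hr with rfl | hr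
  · obtain ⟨s, hs, hs'⟩ := exists_mem_iff_dvd_mul_of_mem_associatedPrimes hJ
    have := zero_dvd_iff.1 ((hs' a).1 ham)
    refine hs ?_
    rw [(mul_left_mem_nonZeroDivisors_eq_zero_iff ha).1 this]
  · exact false_of_regular_pair_mem_associatedPrimes hr hJ ha ham hbm hb

end AssociatedPrimes

section Avoidance

open Polynomial Cardinal

theorem Polynomial.setOf_eval_mem_finite {T : Type*} [CommRing T] {J : Ideal T} (hJ : J.IsPrime)
    {f : T[X]} (hf : f.map (Ideal.Quotient.mk J) ≠ 0) :
    {x : T ⧸ J | ∃ y, Ideal.Quotient.mk J y = x ∧ f.eval y ∈ J}.Finite := by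
  refine (Polynomial.finite_setOfPred_isRoot hf).subset ?_
  rintro _ ⟨y, rfl, hy⟩
  change (f.map (Ideal.Quotient.mk J)).IsRoot _
  rw [IsRoot, eval_map_apply, Ideal.Quotient.eq_zero_iff_mem]
  exact hy

/-- A polynomial that does not vanish modulo `J` does not vanish modulo `J` after substituting
a polynomial that is not constant modulo `J`. -/
theorem Polynomial.map_comp_ne_zero {T : Type*} [CommRing T] {J : Ideal T} (hJ : J.IsPrime)
    {f g : T[X]} (hf : f.map (Ideal.Quotient.mk J) ≠ 0) {n : ℕ} (hn : n ≠ 0)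
    (hg : g.coeff n ∉ J) : (f.comp g).map (Ideal.Quotient.mk J) ≠ 0 := by
  intro h
  rw [Polynomial.map_comp, comp_eq_zero_iff] at h
  rcases h with h | ⟨-, h⟩
  · exact hf h
  · have := congrArg (fun q => q.coeff n) h
    simp only [coeff_map, coeff_C, hn, if_false, Ideal.Quotient.eq_zero_iff_mem] at this
    exact hg this

theorem Polynomial.exists_coeff_succ_eq {T : Type*} [CommRing T] {n : ℕ} (z : Fin n → T) :
    ∃ Z : T[X], (∀ k : Fin n, Z.coeff (k + 1) = z k) ∧
      ∀ l, Z.eval l = ∑ k, z k * l ^ ((k : ℕ) + 1) := by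
  refine ⟨∑ k : Fin n, C (z k) * X ^ ((k : ℕ) + 1), fun k => ?_, fun l => ?_⟩
  · simp only [finsetSum_coeff, coeff_C_mul, coeff_X_pow]
    rw [Finset.sum_eq_single k]
    · simp
    · intro b _ hb
      have : (k : ℕ) ≠ b := fun h => hb (Fin.ext h.symm)
      simp [this]
    · simp
  · simp [eval_finsetSum]

universe u

variable {T : Type u} [CommRing T] [IsLocalRing T] [IsNoetherianRing T]

theorem exists_pow_forall_eval_notMem {J : Ideal T} (hJ : J.IsPrime) (hJm : J ≠ maximalIdeal T)
    {f : T[X]} (hf : f.map (Ideal.Quotient.mk J) ≠ 0) (x : T) (N : ℕ) :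
    ∃ (y : T) (N' : ℕ), N < N' ∧ y - x ∈ maximalIdeal T ^ N ∧
      ∀ z, z - y ∈ maximalIdeal T ^ N' → f.eval z ∉ J := by
  obtain ⟨a, ham, haJ⟩ : ∃ a ∈ maximalIdeal T, a ∉ J := by
    by_contra! h
    exact hJm (le_antisymm (le_maximalIdeal hJ.ne_top) h)
  obtain ⟨k, hk, hkJ⟩ : ∃ k, N ≤ k ∧ f.eval (x + a ^ k) ∉ J := by
    by_contra! h
    have hfin := Polynomial.setOf_eval_mem_finite hJ hf
    have hinj : Function.Injective
        fun k : ℕ => Ideal.Quotient.mk J (x + a ^ (N + k)) := by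
      have aux : ∀ k l : ℕ, k < l → x + a ^ (N + k) - (x + a ^ (N + l)) ∉ J := by
        intro k l hkl hmem
        obtain ⟨d, rfl⟩ := Nat.exists_eq_add_of_lt hkl
        have h1 : x + a ^ (N + k) - (x + a ^ (N + (k + d + 1))) =
            a ^ (N + k) * (1 - a ^ (d + 1)) := by ring
        rw [h1] at hmem
        rcases hJ.mem_or_mem hmem with h2 | h2
        · exact haJ (hJ.mem_of_pow_mem _ h2)
        · have hu : IsUnit (1 - a ^ (d + 1)) :=
            isUnit_one_sub_self_of_mem_nonunits _
              ((mem_maximalIdeal _).1 (Ideal.pow_mem_of_mem _ ham _ (Nat.succ_pos d)))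
          exact hJ.ne_top (Ideal.eq_top_of_isUnit_mem _ h2 hu)
      intro k l hkl
      have hkl' := Ideal.Quotient.eq.1 hkl
      rcases lt_trichotomy k l with h1 | h1 | h1
      · exact (aux k l h1 hkl').elim
      · exact h1
      · refine (aux l k h1 ?_).elim
        rw [← neg_sub]
        exact J.neg_mem hkl'
    refine Set.infinite_of_injective_forall_mem hinj (fun k => ?_) hfin
    exact ⟨_, rfl, h (N + k) (Nat.le_add_right N k)⟩
  obtain ⟨M, hM⟩ : ∃ M, f.eval (x + a ^ k) ∉ J ⊔ maximalIdeal T ^ M := by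
    by_contra! h
    apply hkJ
    have := IsHausdorff.of_le_jacobson (M := T ⧸ J) (maximalIdeal T)
      (maximalIdeal_le_jacobson _)
    rw [← Ideal.Quotient.eq_zero_iff_mem]
    refine this.haus _ fun n => ?_
    rw [SModEq.zero]
    obtain ⟨j, hj, b, hb, hjb⟩ := Submodule.mem_sup.1 (h n)
    rw [← hjb, map_add, Ideal.Quotient.eq_zero_iff_mem.2 hj, zero_add]
    have h1 : Ideal.Quotient.mk J b = b • (1 : T ⧸ J) := by
      rw [Algebra.smul_def, mul_one]; rfl
    rw [h1]
    exact Submodule.smul_mem_smul hb trivial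
  refine ⟨x + a ^ k, max (N + 1) M, by omega, ?_, fun z hz hzJ => hM ?_⟩
  · rw [add_sub_cancel_left]
    exact Ideal.pow_le_pow_right hk (Ideal.pow_mem_pow ham k)
  · have h1 : f.eval z - f.eval (x + a ^ k) ∈ maximalIdeal T ^ M :=
      Ideal.mem_of_dvd _ (sub_dvd_eval_sub _ _ _)
        (Ideal.pow_le_pow_right (le_max_right (N + 1) M) hz)
    have h2 : f.eval (x + a ^ k) = f.eval z - (f.eval z - f.eval (x + a ^ k)) := by ring
    rw [h2]
    exact Ideal.sub_mem _ (Ideal.mem_sup_left hzJ) (Ideal.mem_sup_right h1)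

theorem exists_mem_sq_forall_eval_notMem_nat [IsAdicComplete (maximalIdeal T) T]
    (J : ℕ → Ideal T) (hJ : ∀ i, (J i).IsPrime) (hJm : ∀ i, J i ≠ maximalIdeal T)
    (f : ℕ → T[X]) (hf : ∀ i, (f i).map (Ideal.Quotient.mk (J i)) ≠ 0) :
    ∃ t ∈ maximalIdeal T ^ 2, ∀ i, (f i).eval t ∉ J i := by
  choose Y N' hN hY hav using fun i =>
    exists_pow_forall_eval_notMem (hJ i) (hJm i) (hf i)
  let s : ℕ → T × ℕ := fun n =>
    Nat.rec (0, 2) (fun n p => (Y n p.1 p.2, N' n p.1 p.2)) n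
  have hs : ∀ n, s (n + 1) = (Y n (s n).1 (s n).2, N' n (s n).1 (s n).2) := fun _ => rfl
  have hlt : ∀ n, (s n).2 < (s (n + 1)).2 := fun n => by rw [hs]; exact hN _ _ _
  have hmono : StrictMono fun n => (s n).2 := strictMono_nat_of_lt_succ hlt
  have hge : ∀ n, n ≤ (s n).2 := fun n => hmono.le_apply
  have hdiff : ∀ n k, (s (n + k)).1 - (s n).1 ∈ maximalIdeal T ^ (s n).2 := by
    intro n k
    induction k with
    | zero => simp
    | succ k ih =>
      have h1 : (s (n + k + 1)).1 - (s (n + k)).1 ∈ maximalIdeal T ^ (s (n + k)).2 := by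
        rw [hs]; exact hY _ _ _
      have h2 := Ideal.add_mem _ (Ideal.pow_le_pow_right
        (hmono.monotone (Nat.le_add_right n k)) h1) ih
      rwa [sub_add_sub_cancel] at h2
  obtain ⟨L, hL⟩ := IsPrecomplete.prec (inferInstance : IsPrecomplete (maximalIdeal T) T)
    (f := fun n => (s n).1) (by
      intro m n hmn
      obtain ⟨k, rfl⟩ := Nat.exists_eq_add_of_le hmn
      rw [SModEq.sub_mem, ← neg_sub]
      refine Submodule.neg_mem _ ?_
      simpa using Ideal.pow_le_pow_right (hge m) (hdiff m k))
  have hlim : ∀ n, L - (s n).1 ∈ maximalIdeal T ^ (s n).2 := by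
    intro n
    have h1 := hL (n + (s n).2)
    rw [SModEq.sub_mem] at h1
    have h2 : (s (n + (s n).2)).1 - L ∈ maximalIdeal T ^ (n + (s n).2) := by simpa using h1
    have h3 := Ideal.sub_mem _ (hdiff n (s n).2)
      (Ideal.pow_le_pow_right (Nat.le_add_left (s n).2 n) h2)
    convert! h3 using 1
    ring
  refine ⟨L, by simpa [s] using hlim 0, fun i => hav i _ _ L (hlim (i + 1))⟩

theorem exists_mem_sq_forall_eval_notMem_of_lt {ι : Type u}
    (J : ι → Ideal T) (hJ : ∀ i, (J i).IsPrime) (hJm : ∀ i, J i ≠ maximalIdeal T)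
    (f : ι → T[X]) (hf : ∀ i, (f i).map (Ideal.Quotient.mk (J i)) ≠ 0)
    (hT : ℵ₀ < #(ResidueField T)) (hι : #ι < #(ResidueField T)) :
    ∃ t ∈ maximalIdeal T ^ 2, ∀ i, (f i).eval t ∉ J i := by
  obtain ⟨n, z, hz⟩ := Submodule.fg_iff_exists_fin_generating_family.1
    ((isNoetherianRing_iff_ideal_fg T).1 inferInstance (maximalIdeal T ^ 2))
  obtain ⟨Z, hZc, hZe⟩ := Polynomial.exists_coeff_succ_eq z
  have hZm : ∀ l, Z.eval l ∈ maximalIdeal T ^ 2 := by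
    intro l
    rw [hZe]
    refine Ideal.sum_mem _ fun k _ => Ideal.mul_mem_right _ _ ?_
    rw [← hz]
    exact Submodule.subset_span ⟨k, rfl⟩
  have hF : ∀ i, ((f i).comp Z).map (Ideal.Quotient.mk (J i)) ≠ 0 := by
    intro i
    obtain ⟨k, hk⟩ : ∃ k, z k ∉ J i := by
      by_contra! h
      have h1 : maximalIdeal T ^ 2 ≤ J i := by
        rw [← hz, Submodule.span_le]
        rintro _ ⟨k, rfl⟩
        exact h k
      exact hJm i (le_antisymm (le_maximalIdeal (hJ i).ne_top) ((hJ i).le_of_pow_le h1))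
    exact Polynomial.map_comp_ne_zero (hJ i) (hf i) (Nat.succ_ne_zero k) (by rwa [hZc])
  obtain ⟨σ, hσ⟩ := (residue_surjective (R := T)).hasRightInverse
  let B : ι → Set (ResidueField T) := fun i => {l | ((f i).comp Z).eval (σ l) ∈ J i}
  have hB : ∀ i, (B i).Finite := by
    intro i
    have hinj : Function.Injective fun l => Ideal.Quotient.mk (J i) (σ l) := by
      intro l l' h
      have h1 := le_maximalIdeal (hJ i).ne_top (Ideal.Quotient.eq.1 h)
      rw [← hσ l, ← hσ l']
      exact Ideal.Quotient.eq.2 h1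
    exact ((Polynomial.setOf_eval_mem_finite (hJ i) (hF i)).preimage hinj.injOn).subset
      fun l hl => ⟨σ l, rfl, hl⟩
  have hcard : #(⋃ i, B i : Set (ResidueField T)) < #(ResidueField T) := by
    refine (Cardinal.mk_iUnion_le B).trans_lt (Cardinal.mul_lt_of_lt hT.le hι ?_)
    exact lt_of_le_of_lt (ciSup_le' fun i => (hB i).lt_aleph0.le) hT
  obtain ⟨l, hl⟩ : ∃ l, l ∉ ⋃ i, B i := by
    by_contra! h
    rw [Set.eq_univ_of_forall h, Cardinal.mk_univ] at hcard
    exact hcard.false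
  refine ⟨Z.eval (σ l), hZm _, fun i hi => hl (Set.mem_iUnion.2 ⟨i, ?_⟩)⟩
  change ((f i).comp Z).eval (σ l) ∈ J i
  rwa [eval_comp]

/-- A family of polynomial conditions modulo nonmaximal primes can be avoided simultaneously
inside `m²`, if the family is countable or smaller than an uncountable residue field. -/
theorem exists_mem_sq_forall_eval_notMem [IsAdicComplete (maximalIdeal T) T] {ι : Type u}
    (J : ι → Ideal T) (hJ : ∀ i, (J i).IsPrime) (hJm : ∀ i, J i ≠ maximalIdeal T)
    (f : ι → T[X]) (hf : ∀ i, (f i).map (Ideal.Quotient.mk (J i)) ≠ 0)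
    (hι : #ι ≤ ℵ₀ ∨ (ℵ₀ < #(ResidueField T) ∧ #ι < #(ResidueField T))) :
    ∃ t ∈ maximalIdeal T ^ 2, ∀ i, (f i).eval t ∉ J i := by
  rcases hι with hι | ⟨hT, hι⟩
  · rcases isEmpty_or_nonempty ι with _ | _
    · exact ⟨0, zero_mem _, fun i => isEmptyElim i⟩
    · have : Countable ι := Cardinal.mk_le_aleph0_iff.1 hι
      obtain ⟨e, he⟩ := exists_surjective_nat ι
      obtain ⟨t, ht, h⟩ := exists_mem_sq_forall_eval_notMem_nat (fun n => J (e n))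
        (fun _ => hJ _) (fun _ => hJm _) (fun n => f (e n)) (fun _ => hf _)
      refine ⟨t, ht, fun i => ?_⟩
      obtain ⟨n, rfl⟩ := he i
      exact h n
  · exact exists_mem_sq_forall_eval_notMem_of_lt J hJ hJm f hf hT hι

end Avoidance

section FactorialSubrings

variable {T : Type*} [CommRing T] [IsLocalRing T]

/-- An element `p` of `S ⊆ T` generating a prime ideal of `S` in the strong sense that every
element of `S` not divisible by `p` is a nonzerodivisor on `T / pT`. -/
structure Subring.IsStrongPrime (S : Subring T) (p : T) : Prop where
  mem : p ∈ S
  ne_zero : p ≠ 0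
  mem_maximalIdeal : p ∈ maximalIdeal T
  dvd_or_dvd : ∀ w ∈ S, ∀ τ, p ∣ w * τ → p ∣ w ∨ p ∣ τ

/-- Subrings of `T` that meet `P` trivially, are closed under exact division in `T` by regular
elements, and in which every nonzero nonunit has a strong prime factor. Apart from the cardinality
condition, these are the N-subrings meeting `P` trivially. -/
structure Subring.IsFactorialIn (P : Ideal T) (S : Subring T) : Prop where
  regular : ∀ a ∈ S, a ≠ 0 → a ∈ nonZeroDivisors T
  saturated : ∀ a ∈ S, a ≠ 0 → ∀ t, a * t ∈ S → t ∈ S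
  eq_zero_of_mem : ∀ a ∈ S, a ∈ P → a = 0
  exists_strongPrime : ∀ f ∈ S, f ≠ 0 → f ∈ maximalIdeal T → ∃ p, S.IsStrongPrime p ∧ p ∣ f

/-- An inclusion of subrings preserving strong primes. -/
structure Subring.IsPrimeExtension (S S' : Subring T) : Prop where
  le : S ≤ S'
  strongPrime : ∀ p, S.IsStrongPrime p → S'.IsStrongPrime p

theorem Subring.IsPrimeExtension.refl (S : Subring T) : S.IsPrimeExtension S :=
  ⟨le_rfl, fun _ h => h⟩

theorem Subring.IsPrimeExtension.trans {S₁ S₂ S₃ : Subring T} (h : S₁.IsPrimeExtension S₂)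
    (h' : S₂.IsPrimeExtension S₃) : S₁.IsPrimeExtension S₃ :=
  ⟨h.le.trans h'.le, fun p hp => h'.strongPrime p (h.strongPrime p hp)⟩

theorem Subring.IsStrongPrime.of_associated {S : Subring T} {p a : T} (hp : S.IsStrongPrime p)
    (ha : a ∈ S) (h : Associated p a) : S.IsStrongPrime a where
  mem := ha
  ne_zero h0 := hp.ne_zero (by rwa [h0, associated_zero_iff_eq_zero] at h)
  mem_maximalIdeal := Ideal.mem_of_dvd _ h.dvd hp.mem_maximalIdeal
  dvd_or_dvd w hw τ := by
    rw [← h.dvd_iff_dvd_left, ← h.dvd_iff_dvd_left, ← h.dvd_iff_dvd_left]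
    exact hp.dvd_or_dvd w hw τ

namespace Subring.IsFactorialIn

variable {P : Ideal T} {S : Subring T}

theorem isDomain (hS : S.IsFactorialIn P) : IsDomain S := by
  have : NoZeroDivisors S := ⟨by
    rintro ⟨a, ha⟩ ⟨b, hb⟩ hab
    rw [or_iff_not_imp_left]
    intro h0
    have h1 : a ≠ 0 := fun h => h0 (Subtype.ext h)
    have h2 : a * b = 0 := congrArg Subtype.val hab
    exact Subtype.ext ((mul_left_mem_nonZeroDivisors_eq_zero_iff (hS.regular a ha h1)).1 h2)⟩
  exact NoZeroDivisors.to_isDomain S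

theorem dvd_iff (hS : S.IsFactorialIn P) {a b : S} : a ∣ b ↔ (a : T) ∣ b := by
  refine ⟨fun ⟨c, hc⟩ => ⟨c, by rw [hc]; rfl⟩, fun ⟨c, hc⟩ => ?_⟩
  by_cases h : (a : T) = 0
  · rw [h, zero_mul] at hc
    have hb : b = 0 := Subtype.ext hc
    rw [hb]
    exact dvd_zero _
  · exact ⟨⟨c, hS.saturated a a.2 h c (hc ▸ b.2)⟩, Subtype.ext hc⟩

theorem isUnit_iff (hS : S.IsFactorialIn P) {a : S} : IsUnit a ↔ IsUnit (a : T) := by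
  rw [isUnit_iff_dvd_one, isUnit_iff_dvd_one, hS.dvd_iff]; rfl

theorem isUnit_iff_notMem (hS : S.IsFactorialIn P) {a : S} : IsUnit a ↔ (a :
    T) ∉ maximalIdeal T := by
  rw [hS.isUnit_iff, IsLocalRing.notMem_maximalIdeal]

theorem isLocalRing (hS : S.IsFactorialIn P) : IsLocalRing S := by
  have : IsLocalHom S.subtype := ⟨fun a ha => hS.isUnit_iff.2 ha⟩
  exact RingHom.domain_isLocalRing S.subtype

theorem wfDvdMonoid (hS : S.IsFactorialIn P) [IsNoetherianRing T] : WfDvdMonoid S := by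
  have := hS.isDomain
  refine ⟨?_⟩
  refine Subrelation.wf (r := InvImage (· > ·) fun a : S => Ideal.span {(a : T)}) ?_
    (InvImage.wf _ wellFounded_gt)
  intro a b h
  obtain ⟨hdvd, hndvd⟩ := dvd_and_not_dvd_iff.2 h
  refine lt_of_le_of_ne (Ideal.span_singleton_le_span_singleton.2 (hS.dvd_iff.1 hdvd)) ?_
  intro h1
  have h2 : b ∣ a := hS.dvd_iff.2 (Ideal.span_singleton_le_span_singleton.1 h1.ge)
  exact hndvd h2

theorem prime_of_strongPrime (hS : S.IsFactorialIn P) {p : S} (hp : S.IsStrongPrime p) :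
    Prime p := by
  refine ⟨fun h => hp.ne_zero (by rw [h]; rfl), fun h => ?_, fun a b h => ?_⟩
  · exact hS.isUnit_iff_notMem.1 h hp.mem_maximalIdeal
  · rw [hS.dvd_iff, hS.dvd_iff]
    exact hp.dvd_or_dvd a a.2 b (hS.dvd_iff.1 h)

theorem exists_strongPrime_dvd (hS : S.IsFactorialIn P) {f : S} (hf : f ≠ 0) (hfu : ¬ IsUnit f) :
    ∃ p : S, S.IsStrongPrime p ∧ p ∣ f := by
  obtain ⟨p, hp, hpf⟩ := hS.exists_strongPrime f f.2 (fun h => hf (Subtype.ext h))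
    (by by_contra h; exact hfu (hS.isUnit_iff_notMem.2 h))
  exact ⟨⟨p, hp.mem⟩, hp, hS.dvd_iff.2 hpf⟩

theorem strongPrime_of_irreducible (hS : S.IsFactorialIn P) {p : S} (hp : Irreducible p) :
    S.IsStrongPrime p := by
  obtain ⟨q, hq, hqp⟩ := hS.exists_strongPrime_dvd (f := p) (by
    have := hS.isDomain
    exact hp.ne_zero) hp.not_isUnit
  have h1 := hp.dvd_iff.1 hqp
  have h2 : Associated q p :=
    (h1.resolve_left (hS.prime_of_strongPrime hq).not_isUnit).symm
  refine hq.of_associated p.2 ?_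
  exact h2.map S.subtype

theorem prime_iff (hS : S.IsFactorialIn P) {p : S} : Prime p ↔ S.IsStrongPrime p := by
  have := hS.isDomain
  exact ⟨fun h => hS.strongPrime_of_irreducible h.irreducible, hS.prime_of_strongPrime⟩

theorem uniqueFactorizationMonoid (hS : S.IsFactorialIn P) [IsNoetherianRing T] :
    UniqueFactorizationMonoid S := by
  have := hS.isDomain
  have := hS.wfDvdMonoid
  refine { irreducible_iff_prime := fun {a} => ⟨fun h => ?_, Prime.irreducible⟩ }
  exact hS.prime_iff.2 (hS.strongPrime_of_irreducible h)

theorem isNSubring (hS : S.IsFactorialIn P) [IsNoetherianRing T]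
    (hcard : Cardinal.mk S ≤ max Cardinal.aleph0 (Cardinal.mk (ResidueField T)) ∧
      (Cardinal.mk S = max Cardinal.aleph0 (Cardinal.mk (ResidueField T)) →
        Cardinal.mk (ResidueField T) ≤ Cardinal.aleph0)) : IsNSubring T S := by
  have hd := hS.isDomain
  have hu := hS.uniqueFactorizationMonoid
  have hl := hS.isLocalRing
  refine ⟨hl, ?_, ⟨hd, hu⟩, hcard, ?_, ?_⟩
  · have : Ideal.comap S.subtype (maximalIdeal T) = maximalIdeal S := by
      ext a
      rw [mem_maximalIdeal, mem_nonunits_iff, hS.isUnit_iff_notMem, not_not]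
      rfl
    rw [this]
    infer_instance
  · intro Q hQ
    rw [eq_bot_iff]
    intro a ha
    by_contra h0
    have h1 := hS.regular a a.2 (fun h => h0 (Subtype.ext h))
    have h2 : (a : T) ∈ ⋃ p ∈ associatedPrimes T T, (p : Set T) := Set.mem_biUnion hQ ha
    rw [biUnion_associatedPrimes_eq_compl_nonZeroDivisors] at h2
    exact h2 h1
  · rintro t ht J hJ q0 q1 hq0 hq1 ⟨h01, h1J⟩
    obtain ⟨p, hpq, hp⟩ := hq1.exists_mem_prime_of_ne_bot (bot_le.trans_lt h01).ne'
    obtain ⟨x, hxJ, hxq⟩ := Set.exists_of_ssubset h1J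
    have hps := hS.prime_iff.1 hp
    refine false_of_regular_pair_mem_associatedPrimes ht hJ (hS.regular p p.2 hps.ne_zero)
      (h1J.le hpq) hxJ fun e he => ?_
    refine (hps.dvd_or_dvd x x.2 e he).resolve_left fun h => hxq ?_
    exact Ideal.mem_of_dvd _ (hS.dvd_iff.2 h) hpq

end Subring.IsFactorialIn

theorem IsNSubring.isFactorialIn [IsNoetherianRing T] {P : Ideal T} {R : Subring T}
    (hR : IsNSubring T R) (hRP : Ideal.comap R.subtype P = ⊥) : R.IsFactorialIn P := by
  obtain ⟨hl, hm, ⟨hd, hu⟩, -, hass, hht⟩ := hR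
  have hreg : ∀ a ∈ R, a ≠ 0 → a ∈ nonZeroDivisors T := by
    intro a ha h0
    by_contra h
    have h2 : a ∈ (⋃ p ∈ associatedPrimes T T, (p : Set T)) := by
      rw [biUnion_associatedPrimes_eq_compl_nonZeroDivisors]
      exact h
    simp only [Set.mem_iUnion] at h2
    obtain ⟨Q, hQ, haQ⟩ := h2
    have h3 : (⟨a, ha⟩ : R) ∈ Ideal.comap R.subtype Q := haQ
    rw [hass Q hQ, Ideal.mem_bot] at h3
    exact h0 (congrArg Subtype.val h3)
  have hmax : ∀ a : R, ¬ IsUnit a → (a : T) ∈ maximalIdeal T := by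
    intro a ha
    have h1 := (mem_maximalIdeal a).2 ha
    rwa [← IsLocalRing.eq_maximalIdeal hm] at h1
  have hprime : ∀ p : R, Prime p → ∀ w : R, ∀ τ, (p : T) ∣ w * τ → p ∣ w ∨ (p : T) ∣ τ := by
    intro p hp w τ hdvd
    by_contra! h
    obtain ⟨J, hJ, hwJ⟩ := exists_mem_associatedPrimes_of_dvd_mul hdvd h.2
    refine hht p (hreg p p.2 fun h => hp.ne_zero (Subtype.ext h)) J hJ ⊥ (Ideal.span {p})
      Ideal.isPrime_bot ((Ideal.span_singleton_prime hp.ne_zero).2 hp) ⟨?_, ?_⟩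
    · rw [bot_lt_iff_ne_bot, Ne, Ideal.span_singleton_eq_bot]
      exact hp.ne_zero
    · refine lt_of_le_of_ne ?_ fun heq => h.1 ?_
      · rw [Ideal.span_singleton_le_iff_mem]
        exact (mem_of_mem_associatedPrimes_quotient_span hJ : (p : T) ∈ J)
      · rw [← Ideal.mem_span_singleton, heq]
        exact hwJ
  have hstrong : ∀ p : R, Prime p → R.IsStrongPrime p := by
    intro p hp
    refine ⟨p.2, fun h => hp.ne_zero (Subtype.ext h), hmax p hp.not_isUnit, ?_⟩
    intro w hw τ h
    refine (hprime p hp ⟨w, hw⟩ τ h).imp_left ?_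
    rintro ⟨c, hc⟩
    exact ⟨c, congrArg Subtype.val hc⟩
  refine ⟨hreg, ?_, ?_, ?_⟩
  · have key : ∀ a : R, a ≠ 0 → ∀ t, (a : T) * t ∈ R → t ∈ R := by
      intro a
      induction a using UniqueFactorizationMonoid.induction_on_prime with
      | h₁ => exact fun h => absurd rfl h
      | h₂ x hx =>
        intro _ t ht
        obtain ⟨v, rfl⟩ := hx
        have h1 := R.mul_mem (v⁻¹ : Rˣ).1.2 ht
        rwa [← mul_assoc, ← Subring.coe_mul, Units.inv_mul, Subring.coe_one, one_mul] at h1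
      | h₃ a p ha hp ih =>
        intro _ t ht
        refine ih ha t ?_
        rw [Subring.coe_mul, mul_assoc] at ht
        have h1 : (p : T) ∣ (⟨_, ht⟩ : R) * 1 := by
          rw [mul_one]
          exact dvd_mul_right _ _
        rcases hprime p hp _ _ h1 with ⟨c, hc⟩ | h
        · have h2 : (p : T) * (a * t) = p * c := congrArg Subtype.val hc
          rw [mul_cancel_left_mem_nonZeroDivisors
            (hreg p p.2 fun h => hp.ne_zero (Subtype.ext h))] at h2
          rw [h2]
          exact c.2
        · exact absurd (isUnit_of_dvd_one h)
            ((mem_maximalIdeal _).1 (hmax p hp.not_isUnit))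
    exact fun a ha h0 => key ⟨a, ha⟩ fun h => h0 (congrArg Subtype.val h)
  · intro a ha haP
    have h3 : (⟨a, ha⟩ : R) ∈ Ideal.comap R.subtype P := haP
    rw [hRP, Ideal.mem_bot] at h3
    exact congrArg Subtype.val h3
  · intro f hf h0 hfm
    have hnu : ¬ IsUnit (⟨f, hf⟩ : R) := fun h =>
      (mem_maximalIdeal f).1 hfm (h.map R.subtype)
    obtain ⟨p, hp, c, hc⟩ := WfDvdMonoid.exists_irreducible_factor hnu
      fun h => h0 (congrArg Subtype.val h)
    exact ⟨p, hstrong p hp.prime, c, congrArg Subtype.val hc⟩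

end FactorialSubrings

section FractionClosure

open Polynomial

theorem Polynomial.exists_leadingCoeff_pow_mul_eq_of_minimal {R : Type*} [CommRing R] [IsDomain R]
    {Q : Ideal R[X]} (hQ : ∀ r, C r ∈ Q → r = 0) {q : R[X]} (hq : q ∈ Q) (hq0 : q ≠ 0)
    (hmin : ∀ g ∈ Q, g ≠ 0 → q.natDegree ≤ g.natDegree) {g : R[X]} (hg : g ∈ Q) :
    ∃ k h, C q.leadingCoeff ^ k * g = q * h := by
  have hpos : 0 < q.natDegree := by
    by_contra! h
    rw [Nat.le_zero] at h
    rw [eq_C_of_natDegree_eq_zero h] at hq hq0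
    exact hq0 (by rw [hQ _ hq, map_zero])
  induction hd : g.natDegree using Nat.strong_induction_on generalizing g with
  | _ d ih =>
    by_cases hg0 : g = 0
    · exact ⟨0, 0, by simp [hg0]⟩
    · have hle := hmin g hg hg0
      have hlt := natDegree_cancelLeads_lt_of_natDegree_le_natDegree hle (hpos.trans_le hle)
      have hmem : q.cancelLeads g ∈ Q :=
        Ideal.sub_mem _ (Ideal.mul_mem_left _ _ hg) (Ideal.mul_mem_left _ _ hq)
      obtain ⟨k, h, hk⟩ := ih _ (hd ▸ hlt) hmem rfl
      rw [cancelLeads, Nat.sub_eq_zero_of_le hle, pow_zero, mul_one] at hk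
      exact ⟨k + 1, h + C q.leadingCoeff ^ k *
        (C g.leadingCoeff * X ^ (g.natDegree - q.natDegree)), by linear_combination hk⟩

/-- A prime ideal of `R[X]` contracting to zero is generated by any of its prime elements. -/
theorem Polynomial.dvd_of_mem_of_prime {R : Type*} [CommRing R] [IsDomain R] {Q : Ideal R[X]}
    (hQ : ∀ r, C r ∈ Q → r = 0) {π : R[X]} (hπ : Prime π) (hπQ : π ∈ Q) {g : R[X]} (hg : g ∈ Q) :
    π ∣ g := by
  classical
  have hdeg : ∀ r : R, r ≠ 0 → ¬ π ∣ C r := by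
    intro r hr h
    have h1 := natDegree_le_of_dvd h (C_ne_zero.2 hr)
    rw [natDegree_C, Nat.le_zero] at h1
    rw [eq_C_of_natDegree_eq_zero h1] at hπQ hπ
    exact hπ.ne_zero (by rw [hQ _ hπQ, map_zero])
  have hex : ∃ n, ∃ q ∈ Q, q ≠ 0 ∧ q.natDegree = n := ⟨_, π, hπQ, hπ.ne_zero, rfl⟩
  obtain ⟨q, hq, hq0, hqn⟩ := Nat.find_spec hex
  have hmin : ∀ g ∈ Q, g ≠ 0 → q.natDegree ≤ g.natDegree := fun g hg hg0 => by
    rw [hqn]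
    exact Nat.find_min' hex ⟨g, hg, hg0, rfl⟩
  have hlc : ∀ k, C q.leadingCoeff ^ k ≠ 0 := fun k =>
    pow_ne_zero k (C_ne_zero.2 (leadingCoeff_ne_zero.2 hq0))
  have hπq : π ∣ q := by
    obtain ⟨k, h, hk⟩ := exists_leadingCoeff_pow_mul_eq_of_minimal hQ hq hq0 hmin hπQ
    rcases hπ.dvd_or_dvd ⟨C q.leadingCoeff ^ k, hk.symm.trans (mul_comm _ _)⟩ with h1 | ⟨h', rfl⟩
    · exact h1
    · exfalso
      have h2 : C q.leadingCoeff ^ k = q * h' :=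
        mul_left_cancel₀ hπ.ne_zero (by linear_combination hk)
      have h3 : C (q.leadingCoeff ^ k) ∈ Q := by
        rw [C_pow, h2]
        exact Ideal.mul_mem_right _ _ hq
      exact hlc k (by rw [← C_pow, hQ _ h3, map_zero])
  obtain ⟨k, h, hk⟩ := exists_leadingCoeff_pow_mul_eq_of_minimal hQ hq hq0 hmin hg
  have h1 : π ∣ C q.leadingCoeff ^ k * g := hk ▸ hπq.mul_right h
  refine (hπ.dvd_or_dvd h1).resolve_left fun h2 => ?_
  exact hdeg _ (leadingCoeff_ne_zero.2 hq0) (hπ.dvd_of_dvd_pow h2)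

universe u

variable {T : Type u} [CommRing T]

/-- The elements of `T` that are fractions of elements of `A` with regular denominator. -/
def Subring.fractionClosure (A : Subring T) : Subring T where
  carrier := {w | ∃ s ∈ A, s ∈ nonZeroDivisors T ∧ s * w ∈ A}
  mul_mem' := by
    rintro v w ⟨s, hs, hs0, hv⟩ ⟨s', hs', hs0', hw⟩
    refine ⟨s * s', A.mul_mem hs hs', mul_mem hs0 hs0', ?_⟩
    rw [mul_mul_mul_comm]
    exact A.mul_mem hv hw
  one_mem' := ⟨1, A.one_mem, one_mem _, by simp⟩
  add_mem' := by
    rintro v w ⟨s, hs, hs0, hv⟩ ⟨s', hs', hs0', hw⟩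
    refine ⟨s * s', A.mul_mem hs hs', mul_mem hs0 hs0', ?_⟩
    have : s * s' * (v + w) = s' * (s * v) + s * (s' * w) := by ring
    rw [this]
    exact A.add_mem (A.mul_mem hs' hv) (A.mul_mem hs hw)
  zero_mem' := ⟨1, A.one_mem, one_mem _, by simp⟩
  neg_mem' := by
    rintro v ⟨s, hs, hs0, hv⟩
    exact ⟨s, hs, hs0, by rw [mul_neg]; exact A.neg_mem hv⟩

theorem Subring.mem_fractionClosure {A : Subring T} {w : T} :
    w ∈ A.fractionClosure ↔ ∃ s ∈ A, s ∈ nonZeroDivisors T ∧ s * w ∈ A := Iff.rfl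

theorem Subring.le_fractionClosure (A : Subring T) : A ≤ A.fractionClosure :=
  fun w hw => ⟨1, A.one_mem, one_mem _, by simpa using hw⟩

theorem Subring.fractionClosure_le {A B : Subring T} (h : A ≤ B.fractionClosure) :
    A.fractionClosure ≤ B.fractionClosure := by
  rintro w ⟨s, hs, hs0, hw⟩
  obtain ⟨t, ht, ht0, hts⟩ := h hs
  obtain ⟨t', ht', ht0', htw⟩ := h hw
  refine ⟨t' * (t * s), B.mul_mem ht' hts, mul_mem ht0' (mul_mem ht0 hs0), ?_⟩
  have : t' * (t * s) * w = t * (t' * (s * w)) := by ring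
  rw [this]
  exact B.mul_mem ht htw

/-- The subring `R[x]` of `T`. -/
noncomputable abbrev Subring.adjoinOne (R : Subring T) (x : T) : Subring T :=
  (aeval (R := R) x).toRingHom.range

theorem Subring.le_adjoinOne (R : Subring T) (x : T) : R ≤ R.adjoinOne x :=
  fun r hr => ⟨C ⟨r, hr⟩, aeval_C x _⟩

theorem Subring.self_mem_adjoinOne (R : Subring T) (x : T) : x ∈ R.adjoinOne x :=
  ⟨X, aeval_X x⟩

theorem Subring.adjoinOne_le {R B : Subring T} {x : T} (hR : R ≤ B) (hx : x ∈ B) :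
    R.adjoinOne x ≤ B := by
  rintro _ ⟨f, rfl⟩
  change aeval x f ∈ B
  rw [aeval_eq_sum_range]
  refine B.sum_mem fun i _ => ?_
  rw [Algebra.smul_def]
  exact B.mul_mem (hR (f.coeff i).2) (B.pow_mem hx i)

/-- `x` is transcendental over `R / (R ∩ J)` modulo `J`. -/
def Subring.IsGenericAt (R : Subring T) (x : T) (J : Ideal T) : Prop :=
  ∀ f : R[X], aeval x f ∈ J → ∀ n, (f.coeff n : T) ∈ J

variable [IsLocalRing T] [IsNoetherianRing T]

namespace Subring.IsFactorialIn

variable {P : Ideal T} {R : Subring T}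

theorem mem_iff_dvd_of_strongPrime {p : T} (hp : R.IsStrongPrime p)
    {J : Ideal T} (hJ : J ∈ associatedPrimes T (T ⧸ Ideal.span {p})) {a : T} (ha : a ∈ R) :
    a ∈ J ↔ p ∣ a := by
  obtain ⟨s, hs, hs'⟩ := exists_mem_iff_dvd_mul_of_mem_associatedPrimes hJ
  rw [hs']
  exact ⟨fun h => (hp.dvd_or_dvd a ha s h).resolve_right hs, fun h => h.mul_right s⟩

theorem eq_zero_of_mem_associatedPrimes_zero (hR : R.IsFactorialIn P) {J : Ideal T}
    (hJ : J ∈ associatedPrimes T (T ⧸ Ideal.span {(0 : T)})) {a : T} (ha : a ∈ R) (haJ : a ∈ J) :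
    a = 0 := by
  obtain ⟨s, hs, hs'⟩ := exists_mem_iff_dvd_mul_of_mem_associatedPrimes hJ
  by_contra h0
  have h1 := zero_dvd_iff.1 ((hs' a).1 haJ)
  exact hs (zero_dvd_iff.2
    ((mul_left_mem_nonZeroDivisors_eq_zero_iff (hR.regular a ha h0)).1 h1))

theorem aeval_mem_nonZeroDivisors (hR : R.IsFactorialIn P) {x : T}
    (hx : ∀ J ∈ associatedPrimes T (T ⧸ Ideal.span {(0 : T)}), R.IsGenericAt x J)
    {f : R[X]} (hf : f ≠ 0) : aeval x f ∈ nonZeroDivisors T := by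
  rw [mem_nonZeroDivisors_iff_left]
  intro τ hτ
  by_contra h0
  obtain ⟨J, hJ, hfJ⟩ := exists_mem_associatedPrimes_of_dvd_mul (r := (0 : T))
    (by rw [hτ]) (fun h => h0 (zero_dvd_iff.1 h))
  refine hf (Polynomial.ext fun n => Subtype.ext ?_)
  exact hR.eq_zero_of_mem_associatedPrimes_zero hJ (f.coeff n).2 (hx J hJ f hfJ n)

/-- Elements of the fraction closure of `R[x]` are fractions in lowest terms. -/
theorem exists_isRelPrime (hR : R.IsFactorialIn P) {x : T}
    {w : T} (hw : w ∈ (R.adjoinOne x).fractionClosure) :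
    ∃ s g : R[X], s ≠ 0 ∧ IsRelPrime s g ∧ aeval x s ∈ nonZeroDivisors T ∧
      aeval x s * w = aeval x g := by
  have := hR.isDomain
  have := hR.uniqueFactorizationMonoid
  obtain ⟨_, ⟨s, rfl⟩, hs0, ⟨g, hg⟩⟩ := hw
  change aeval x s ∈ _ at hs0
  change aeval x g = aeval x s * w at hg
  have hs : s ≠ 0 := by
    rintro rfl
    rw [map_zero] at hs0
    exact zero_notMem_nonZeroDivisors hs0
  obtain ⟨s', g', c, hrel, rfl, rfl⟩ := UniqueFactorizationMonoid.exists_reduced_factors s hs g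
  rw [map_mul] at hs0
  have hc := (mul_mem_nonZeroDivisors.1 hs0).1
  refine ⟨s', g', right_ne_zero_of_mul hs, hrel, (mul_mem_nonZeroDivisors.1 hs0).2, ?_⟩
  rw [map_mul, map_mul, mul_assoc] at hg
  exact ((mul_cancel_left_mem_nonZeroDivisors hc).1 hg).symm

theorem C_dvd_of_aeval_mem (hR : R.IsFactorialIn P) {x p : T}
    (hp : R.IsStrongPrime p) {J : Ideal T} (hJ : J ∈ associatedPrimes T (T ⧸ Ideal.span {p}))
    (hx : R.IsGenericAt x J) {f : R[X]} (hf : aeval x f ∈ J) : C ⟨p, hp.mem⟩ ∣ f := by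
  rw [C_dvd_iff_dvd_coeff]
  intro n
  rw [hR.dvd_iff]
  exact (mem_iff_dvd_of_strongPrime hp hJ (f.coeff n).2).1 (hx f hf n)

theorem strongPrime_fractionClosure (hR : R.IsFactorialIn P) {x p : T} (hp : R.IsStrongPrime p)
    (hx : ∀ J ∈ associatedPrimes T (T ⧸ Ideal.span {p}), R.IsGenericAt x J) :
    (R.adjoinOne x).fractionClosure.IsStrongPrime p := by
  have := hR.isDomain
  refine ⟨le_fractionClosure _ (le_adjoinOne R x hp.mem), hp.ne_zero, hp.mem_maximalIdeal, ?_⟩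
  intro w hw τ h
  by_contra! hn
  obtain ⟨J, hJ, hwJ⟩ := exists_mem_associatedPrimes_of_dvd_mul h hn.2
  obtain ⟨s, g, -, hrel, -, hsg⟩ := hR.exists_isRelPrime hw
  have hg : C ⟨p, hp.mem⟩ ∣ g := hR.C_dvd_of_aeval_mem hp hJ (hx J hJ) (by
    rw [← hsg]
    exact Ideal.mul_mem_left _ _ hwJ)
  have hpg : p ∣ aeval x g := by
    obtain ⟨h, rfl⟩ := hg
    rw [map_mul, aeval_C]
    exact dvd_mul_right _ _
  obtain ⟨J', hJ', hsJ'⟩ := exists_mem_associatedPrimes_of_dvd_mul (hsg ▸ hpg) hn.1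
  have hs := hR.C_dvd_of_aeval_mem hp hJ' (hx J' hJ') hsJ'
  exact (hR.prime_of_strongPrime (p := ⟨p, hp.mem⟩) hp).not_isUnit (isUnit_C.1 (hrel hs hg))

/-- An element not divisible by a strong prime of `R` is coprime to all elements of `R`. -/
theorem dvd_of_dvd_mul_of_forall_not_dvd (hR : R.IsFactorialIn P) {S : Subring T}
    (hRS : R.IsPrimeExtension S) {f : T} (hf : f ∈ S)
    (hn : ∀ p, R.IsStrongPrime p → ¬ p ∣ f) :
    ∀ r : R, r ≠ 0 → ∀ τ, (r : T) ∣ f * τ → (r : T) ∣ τ := by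
  have := hR.isDomain
  have := hR.uniqueFactorizationMonoid
  intro r
  induction r using UniqueFactorizationMonoid.induction_on_prime with
  | h₁ => exact fun h => absurd rfl h
  | h₂ x hx => exact fun _ τ _ => (hR.isUnit_iff.1 hx).dvd
  | h₃ a p ha hp ih =>
    intro _ τ hτ
    have hps := hR.prime_iff.1 hp
    rw [Subring.coe_mul] at hτ
    obtain ⟨τ', rfl⟩ := ((hRS.strongPrime p hps).dvd_or_dvd f hf τ
      ((dvd_mul_right _ _).trans hτ)).resolve_left (hn p hps)
    rw [mul_left_comm] at hτ
    rw [Subring.coe_mul]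
    refine mul_dvd_mul_left _ (ih ha τ' ?_)
    obtain ⟨c, hc⟩ := hτ
    refine ⟨c, (mul_cancel_left_mem_nonZeroDivisors (hR.regular p p.2 hps.ne_zero)).1 ?_⟩
    linear_combination hc

theorem eq_zero_of_mem_associatedPrimes {f : T} (hf : f ∈ nonZeroDivisors T)
    (hR : R.IsFactorialIn P)
    (hcop : ∀ r : R, r ≠ 0 → ∀ τ, (r : T) ∣ f * τ → (r : T) ∣ τ) {J : Ideal T}
    (hJ : J ∈ associatedPrimes T (T ⧸ Ideal.span {f})) (r : R) (hr : (r : T) ∈ J) : r = 0 := by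
  by_contra h0
  refine false_of_regular_pair_mem_associatedPrimes hf hJ
    (hR.regular r r.2 fun h => h0 (Subtype.ext h)) hr
    (mem_of_mem_associatedPrimes_quotient_span hJ) (hcop r h0)

/-- Removing all factors from `R` of a nonzero element of `S`. -/
theorem exists_eq_mul_forall_not_dvd (hR : R.IsFactorialIn P) {S : Subring T}
    (hreg : ∀ a ∈ S, a ≠ 0 → a ∈ nonZeroDivisors T)
    (hsat : ∀ a ∈ S, a ≠ 0 → ∀ t, a * t ∈ S → t ∈ S) (hRS : R ≤ S) {w : T} (hw : w ∈ S)
    (hw0 : w ≠ 0) :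
    ∃ r : R, r ≠ 0 ∧ ∃ f ∈ S, w = r * f ∧ ∀ p, R.IsStrongPrime p → ¬ p ∣ f := by
  have := hR.isDomain
  induction hI : Ideal.span {w} using WellFoundedGT.induction generalizing w with
  | _ I ih =>
    by_cases h : ∃ p, R.IsStrongPrime p ∧ p ∣ w
    · obtain ⟨p, hp, w', rfl⟩ := h
      have hw'0 : w' ≠ 0 := right_ne_zero_of_mul hw0
      have hlt : I < Ideal.span {w'} := by
        rw [← hI]
        refine lt_of_le_of_ne
          (Ideal.span_singleton_le_span_singleton.2 (dvd_mul_left _ _)) fun heq => ?_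
        obtain ⟨c, hc⟩ := Ideal.span_singleton_le_span_singleton.1 heq.ge
        have hw' := hsat p (hRS hp.mem) hp.ne_zero w' hw
        have h1 : p * c = 1 :=
          (mul_cancel_left_mem_nonZeroDivisors (hreg w' hw' hw'0)).1 (by linear_combination -hc)
        exact (mem_maximalIdeal p).1 hp.mem_maximalIdeal (IsUnit.of_mul_eq_one c h1)
      obtain ⟨r, hr, f, hf, rfl, hn⟩ :=
        ih _ hlt (hsat p (hRS hp.mem) hp.ne_zero w' hw) hw'0 rfl
      refine ⟨⟨p, hp.mem⟩ * r, mul_ne_zero (fun h => hp.ne_zero (congrArg Subtype.val h)) hr,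
        f, hf, ?_, hn⟩
      rw [Subring.coe_mul, mul_assoc]
    · push Not at h
      exact ⟨1, one_ne_zero, w, hw, by simp, h⟩

theorem exists_strongPrime_fractionClosure (hR : R.IsFactorialIn P) {x : T}
    (hreg : ∀ a ∈ (R.adjoinOne x).fractionClosure, a ≠ 0 → a ∈ nonZeroDivisors T)
    (hsat : ∀ a ∈ (R.adjoinOne x).fractionClosure, a ≠ 0 →
      ∀ t, a * t ∈ (R.adjoinOne x).fractionClosure → t ∈ (R.adjoinOne x).fractionClosure)
    (hinj : ∀ f : R[X], f ≠ 0 → aeval x f ≠ 0)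
    (hRS : R.IsPrimeExtension (R.adjoinOne x).fractionClosure)
    {f : T} (hf : f ∈ (R.adjoinOne x).fractionClosure) (hf0 : f ≠ 0)
    (hfm : f ∈ maximalIdeal T) :
    ∃ p, (R.adjoinOne x).fractionClosure.IsStrongPrime p ∧ p ∣ f := by
  have := hR.isDomain
  have := hR.uniqueFactorizationMonoid
  by_cases hn : ∃ p, R.IsStrongPrime p ∧ p ∣ f
  · obtain ⟨p, hp, hpf⟩ := hn
    exact ⟨p, hRS.strongPrime p hp, hpf⟩
  push Not at hn
  have hmemS : ∀ g : R[X], aeval x g ∈ (R.adjoinOne x).fractionClosure :=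
    fun g => le_fractionClosure _ ⟨g, rfl⟩
  -- for `f` coprime to `R`, associated primes of `T / fT` pull back to primes over zero
  have hcontr : ∀ f ∈ (R.adjoinOne x).fractionClosure, f ≠ 0 →
      (∀ p, R.IsStrongPrime p → ¬ p ∣ f) → ∀ J ∈ associatedPrimes T (T ⧸ Ideal.span {f}),
      ∀ r : R, (r : T) ∈ J → r = 0 := fun f hf hf0 hn J hJ r hr =>
    eq_zero_of_mem_associatedPrimes (hreg f hf hf0) hR
      (hR.dvd_of_dvd_mul_of_forall_not_dvd hRS hf hn) hJ r hr
  have hdvd : ∀ f ∈ (R.adjoinOne x).fractionClosure, f ≠ 0 →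
      (∀ p, R.IsStrongPrime p → ¬ p ∣ f) → ∀ J ∈ associatedPrimes T (T ⧸ Ideal.span {f}),
      ∀ π : R[X], Prime π → aeval x π ∈ J → ∀ g : R[X], aeval x g ∈ J → π ∣ g := by
    intro f hf hf0 hn J hJ π hπ hπJ g hg
    refine Polynomial.dvd_of_mem_of_prime (Q := J.comap (aeval (R := R) x)) (fun r hr => ?_)
      hπ hπJ hg
    rw [Ideal.mem_comap, aeval_C] at hr
    exact hcontr f hf hf0 hn J hJ r hr
  obtain ⟨J, hJ, hfJ⟩ := exists_mem_associatedPrimes_of_dvd_mul (r := f) (w := f) (τ := 1)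
    (by simp) fun h => (mem_maximalIdeal f).1 hfm (isUnit_of_dvd_one h)
  have hJp : J.IsPrime := hJ.isPrime
  obtain ⟨s, g, hs0, hrel, -, hsg⟩ := hR.exists_isRelPrime hf
  have hgJ : aeval x g ∈ J := hsg ▸ Ideal.mul_mem_left _ _ hfJ
  have hg0 : g ≠ 0 := by
    rintro rfl
    rw [map_zero, mul_left_mem_nonZeroDivisors_eq_zero_iff
      (hreg _ (hmemS s) (hinj s hs0))] at hsg
    exact hf0 hsg
  obtain ⟨π, hπJ, hπ⟩ := (Ideal.IsPrime.comap (aeval (R := R) x) (K := J)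
    (hK := hJp)).exists_mem_prime_of_ne_bot (fun h => hg0 (by
      have h1 : g ∈ J.comap (aeval (R := R) x) := hgJ
      rwa [h, Ideal.mem_bot] at h1))
  rw [Ideal.mem_comap] at hπJ
  obtain ⟨h, rfl⟩ := hdvd f hf hf0 hn J hJ π hπ hπJ g hgJ
  have hsJ : aeval x s ∉ J := fun hsJ =>
    hπ.not_isUnit (hrel (hdvd f hf hf0 hn J hJ π hπ hπJ s hsJ) (dvd_mul_right _ _))
  obtain ⟨r, hr0, q, hq, hπq, hqn⟩ := hR.exists_eq_mul_forall_not_dvd hreg hsat hRS.le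
    (hmemS π) (hinj π hπ.ne_zero)
  have hq0 : q ≠ 0 := by
    rintro rfl
    exact hinj π hπ.ne_zero (by rw [hπq, mul_zero])
  have hqJ : q ∈ J := (hJp.mem_or_mem (hπq ▸ hπJ)).resolve_left fun h1 =>
    hr0 (hcontr f hf hf0 hn J hJ r h1)
  have hqdvd : ∀ g : R[X], π ∣ g → q ∣ aeval x g := by
    rintro _ ⟨g, rfl⟩
    rw [map_mul, hπq]
    exact (dvd_mul_left q r).mul_right _
  have hπJ' : ∀ J' ∈ associatedPrimes T (T ⧸ Ideal.span {q}), aeval x π ∈ J' :=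
    fun J' hJ' => hπq ▸ Ideal.mul_mem_left _ _ (mem_of_mem_associatedPrimes_quotient_span hJ')
  have hqs : (R.adjoinOne x).fractionClosure.IsStrongPrime q := by
    refine ⟨hq, hq0, le_maximalIdeal hJp.ne_top hqJ, fun w hw τ hwτ => ?_⟩
    by_contra! hnd
    obtain ⟨J', hJ', hwJ'⟩ := exists_mem_associatedPrimes_of_dvd_mul hwτ hnd.2
    obtain ⟨s', g', -, hrel', -, hsg'⟩ := hR.exists_isRelPrime hw
    have hπg' : π ∣ g' := hdvd q hq hq0 hqn J' hJ' π hπ (hπJ' J' hJ') g'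
      (hsg' ▸ Ideal.mul_mem_left _ _ hwJ')
    obtain ⟨J'', hJ'', hsJ''⟩ := exists_mem_associatedPrimes_of_dvd_mul
      (hsg'.symm ▸ hqdvd g' hπg' : q ∣ aeval x s' * w) hnd.1
    exact hπ.not_isUnit (hrel' (hdvd q hq hq0 hqn J'' hJ'' π hπ (hπJ' J'' hJ'') s' hsJ'') hπg')
  refine ⟨q, hqs, (hqs.dvd_or_dvd _ (hmemS s) f ?_).resolve_left fun h1 =>
    hsJ (Ideal.mem_of_dvd _ h1 hqJ)⟩
  rw [hsg]
  exact hqdvd _ (dvd_mul_right _ _)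

end Subring.IsFactorialIn

end FractionClosure

section GenericExtensions

open Polynomial Cardinal

universe u

variable {T : Type u} [CommRing T]

theorem Subring.mk_fractionClosure_adjoinOne_le {R : Subring T} (x : T) {κ : Cardinal.{u}}
    (hκ : ℵ₀ ≤ κ) (hR : #R ≤ κ) : #((R.adjoinOne x).fractionClosure) ≤ κ := by
  have h1 : #(R[X]) ≤ κ := Polynomial.cardinalMk_le_max.trans (max_le hR hκ)
  have h2 : #(R.adjoinOne x) ≤ κ := Cardinal.mk_range_le.trans h1
  choose! s hs hs0 hsw using fun (w : T) (hw : w ∈ (R.adjoinOne x).fractionClosure) =>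
    Subring.mem_fractionClosure.1 hw
  have h3 : #((R.adjoinOne x).fractionClosure) ≤ #(R.adjoinOne x × R.adjoinOne x) := by
    refine Cardinal.mk_le_of_injective
      (f := fun w => (⟨s w, hs w w.2⟩, ⟨s w * w, hsw w w.2⟩)) fun v w hvw => Subtype.ext ?_
    have e1 : s v = s w := congrArg (fun q => (q.1 : T)) hvw
    have e2 : s v * v = s w * w := congrArg (fun q => (q.2 : T)) hvw
    rw [e1] at e2
    exact (mul_cancel_left_mem_nonZeroDivisors (hs0 w w.2)).1 e2
  rw [← Cardinal.mul_def] at h3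
  exact h3.trans ((mul_le_mul' h2 h2).trans (Cardinal.mul_eq_self hκ).le)

/-- The primes modulo which new elements should be transcendental over `R`. -/
def Subring.relevantPrimes (R : Subring T) (P : Ideal T) : Set (Ideal T) :=
  {J | J = P ∨ ∃ r ∈ R, J ∈ associatedPrimes T (T ⧸ Ideal.span {r})}

theorem Subring.isPrime_of_mem_relevantPrimes {R : Subring T} {P : Ideal T} (hP : P.IsPrime)
    {J : Ideal T} (hJ : J ∈ R.relevantPrimes P) : J.IsPrime := by
  rcases hJ with rfl | ⟨r, -, hJ⟩
  · exact hP
  · exact hJ.isPrime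

theorem Subring.mk_relevantPrimes_le [IsNoetherianRing T] {R : Subring T} (P : Ideal T)
    {κ : Cardinal.{u}} (hκ : ℵ₀ ≤ κ) (hR : #R ≤ κ) : #(R.relevantPrimes P) ≤ κ := by
  have h1 : R.relevantPrimes P ⊆
      {P} ∪ ⋃ r : R, associatedPrimes T (T ⧸ Ideal.span {(r : T)}) := by
    rintro J (rfl | ⟨r, hr, hJ⟩)
    · exact Or.inl rfl
    · exact Or.inr (Set.mem_iUnion.2 ⟨⟨r, hr⟩, hJ⟩)
  refine (Cardinal.mk_le_mk_of_subset h1).trans ((Cardinal.mk_union_le _ _).trans ?_)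
  refine Cardinal.add_le_of_le hκ ?_ ((Cardinal.mk_iUnion_le _).trans ?_)
  · rw [Cardinal.mk_singleton]
    exact Cardinal.one_le_aleph0.trans hκ
  · refine (mul_le_mul' hR (ciSup_le' (a := κ) fun r => ?_)).trans (Cardinal.mul_eq_self hκ).le
    exact (associatedPrimes.finite T _).lt_aleph0.le.trans hκ

variable [IsLocalRing T]

namespace Subring.IsFactorialIn

variable {P : Ideal T} {R : Subring T}

theorem fractionClosure_adjoinOne_le (hR : R.IsFactorialIn P) {y₁ y₂ c x₁ x₂ : T} (hy₁ : y₁ ∈ R)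
    (hy₂ : y₂ ∈ R) (hc : c ∈ R) (h0 : y₁ ≠ 0) (h : y₁ * x₁ + y₂ * x₂ = c) :
    (R.adjoinOne x₁).fractionClosure ≤ (R.adjoinOne x₂).fractionClosure := by
  have hle := le_adjoinOne R x₂
  refine fractionClosure_le (adjoinOne_le (hle.trans (le_fractionClosure _)) ?_)
  refine ⟨y₁, hle hy₁, hR.regular y₁ hy₁ h0, ?_⟩
  have : y₁ * x₁ = c - y₂ * x₂ := by linear_combination h
  rw [this]
  exact sub_mem (hle hc) (mul_mem (hle hy₂) (self_mem_adjoinOne R x₂))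

variable [IsNoetherianRing T]

theorem ne_maximalIdeal_of_mem_relevantPrimes (hd : DepthGE T 2) (hPm : P ≠ maximalIdeal T)
    (hR : R.IsFactorialIn P) {J : Ideal T} (hJ : J ∈ R.relevantPrimes P) :
    J ≠ maximalIdeal T := by
  rcases hJ with rfl | ⟨r, hr, hJ⟩
  · exact hPm
  · rintro rfl
    refine hd.maximalIdeal_notMem_associatedPrimes ?_ hJ
    by_cases h : r = 0
    · exact Or.inl h
    · exact Or.inr (hR.regular r hr h)

/-- A relevant prime contracts to zero or to a principal prime ideal. -/
theorem contraction_of_mem_relevantPrimes (hR : R.IsFactorialIn P) {J : Ideal T}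
    (hJ : J ∈ R.relevantPrimes P) :
    (∀ a ∈ R, a ∈ J → a = 0) ∨ ∃ p, R.IsStrongPrime p ∧ ∀ a ∈ R, a ∈ J → p ∣ a := by
  have := hR.isDomain
  have := hR.uniqueFactorizationMonoid
  rcases hJ with rfl | ⟨r, hr, hJ⟩
  · exact Or.inl hR.eq_zero_of_mem
  by_cases h0 : r = 0
  · subst h0
    exact Or.inl fun a ha haJ => hR.eq_zero_of_mem_associatedPrimes_zero hJ ha haJ
  · right
    have hJp : J.IsPrime := hJ.isPrime
    obtain ⟨p, hpJ, hp⟩ := (Ideal.IsPrime.comap R.subtype (K := J)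
      (hK := hJp)).exists_mem_prime_of_ne_bot (fun h => h0 (by
        have h1 : (⟨r, hr⟩ : R) ∈ J.comap R.subtype :=
          (mem_of_mem_associatedPrimes_quotient_span hJ : r ∈ J)
        rw [h, Ideal.mem_bot] at h1
        exact congrArg Subtype.val h1))
    have hps := hR.prime_iff.1 hp
    refine ⟨p, hps, fun a ha haJ => ?_⟩
    by_contra hn
    exact false_of_regular_pair_mem_associatedPrimes (hR.regular r hr h0) hJ
      (hR.regular p p.2 hps.ne_zero) hpJ haJ fun e he =>
      (hps.dvd_or_dvd a ha e he).resolve_left hn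

theorem isFactorialIn_fractionClosure (hR : R.IsFactorialIn P) {x : T}
    (hinj : ∀ f : R[X], f ≠ 0 → aeval x f ∈ nonZeroDivisors T) (hxP : R.IsGenericAt x P)
    (hRS : R.IsPrimeExtension (R.adjoinOne x).fractionClosure) :
    (R.adjoinOne x).fractionClosure.IsFactorialIn P := by
  have hreg : ∀ a ∈ (R.adjoinOne x).fractionClosure, a ≠ 0 → a ∈ nonZeroDivisors T := by
    rintro a ha ha0
    obtain ⟨s, g, hs0, -, hs, hsg⟩ := hR.exists_isRelPrime ha
    have hg0 : g ≠ 0 := by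
      rintro rfl
      rw [map_zero, mul_left_mem_nonZeroDivisors_eq_zero_iff hs] at hsg
      exact ha0 hsg
    have := hinj g hg0
    rw [← hsg] at this
    exact (mul_mem_nonZeroDivisors.1 this).2
  have hsat : ∀ a ∈ (R.adjoinOne x).fractionClosure, a ≠ 0 →
      ∀ t, a * t ∈ (R.adjoinOne x).fractionClosure →
        t ∈ (R.adjoinOne x).fractionClosure := by
    intro a ha ha0 t hat
    refine Subring.fractionClosure_le (B := R.adjoinOne x)
      (A := (R.adjoinOne x).fractionClosure) le_rfl ?_
    exact ⟨a, ha, hreg a ha ha0, hat⟩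
  refine ⟨hreg, hsat, ?_, ?_⟩
  · intro a ha haP
    obtain ⟨s, g, hs0, -, hs, hsg⟩ := hR.exists_isRelPrime ha
    have hgP : aeval x g ∈ P := hsg ▸ Ideal.mul_mem_left _ _ haP
    have hg0 : g = 0 := Polynomial.ext fun n =>
      Subtype.ext (hR.eq_zero_of_mem _ (g.coeff n).2 (hxP g hgP n))
    rw [hg0, map_zero, mul_left_mem_nonZeroDivisors_eq_zero_iff hs] at hsg
    exact hsg
  · intro f hf hf0 hfm
    exact hR.exists_strongPrime_fractionClosure hreg hsat
      (fun f hf => nonZeroDivisors.ne_zero (hinj f hf)) hRS hf hf0 hfm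

/-- Adjoining a generic solution `(x₁, x₂)` of `y₁ x₁ + y₂ x₂ = c` with `y₁, y₂` coprime. -/
theorem exists_extension_of_isGenericAt (hR : R.IsFactorialIn P) {y₁ y₂ c x₁ x₂ : T}
    (hy₁ : y₁ ∈ R) (hy₂ : y₂ ∈ R) (hc : c ∈ R) (h0 : y₂ ≠ 0) (hP : y₂ ∉ P)
    (hcop : ∀ p, R.IsStrongPrime p → p ∣ y₁ → ¬ p ∣ y₂) (h : y₁ * x₁ + y₂ * x₂ = c)
    (h₁ : ∀ J ∈ R.relevantPrimes P, y₂ ∉ J → R.IsGenericAt x₁ J)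
    (h₂ : ∀ J ∈ R.relevantPrimes P, y₁ ∉ J → R.IsGenericAt x₂ J)
    {κ : Cardinal.{u}} (hκ : ℵ₀ ≤ κ) (hcard : #R ≤ κ) :
    ∃ S : Subring T, S.IsFactorialIn P ∧ R.IsPrimeExtension S ∧ #S ≤ κ ∧ x₁ ∈ S ∧ x₂ ∈ S := by
  have hle := le_adjoinOne R x₁
  have hinj : ∀ f : R[X], f ≠ 0 → aeval x₁ f ∈ nonZeroDivisors T := fun f hf =>
    hR.aeval_mem_nonZeroDivisors (fun J hJ => h₁ J (Or.inr ⟨0, zero_mem _, hJ⟩) fun hyJ =>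
      h0 (hR.eq_zero_of_mem_associatedPrimes_zero hJ hy₂ hyJ)) hf
  have hRS : R.IsPrimeExtension (R.adjoinOne x₁).fractionClosure := by
    refine ⟨hle.trans (le_fractionClosure _), fun p hp => ?_⟩
    by_cases hp2 : p ∣ y₂
    · have hp1 : ¬ p ∣ y₁ := fun h => hcop p hp h hp2
      have hy₁0 : y₁ ≠ 0 := by
        rintro rfl
        exact hp1 (dvd_zero p)
      have heq : (R.adjoinOne x₁).fractionClosure = (R.adjoinOne x₂).fractionClosure :=
        le_antisymm (hR.fractionClosure_adjoinOne_le hy₁ hy₂ hc hy₁0 h)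
          (hR.fractionClosure_adjoinOne_le hy₂ hy₁ hc h0 (by rw [add_comm, h]))
      rw [heq]
      exact hR.strongPrime_fractionClosure hp fun J hJ => h₂ J (Or.inr ⟨p, hp.mem, hJ⟩)
        fun hyJ => hp1 ((mem_iff_dvd_of_strongPrime hp hJ hy₁).1 hyJ)
    · exact hR.strongPrime_fractionClosure hp fun J hJ => h₁ J (Or.inr ⟨p, hp.mem, hJ⟩)
        fun hyJ => hp2 ((mem_iff_dvd_of_strongPrime hp hJ hy₂).1 hyJ)
  have hx₁ : x₁ ∈ R.adjoinOne x₁ := self_mem_adjoinOne R x₁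
  refine ⟨(R.adjoinOne x₁).fractionClosure,
    hR.isFactorialIn_fractionClosure hinj (h₁ P (Or.inl rfl) hP) hRS, hRS,
    mk_fractionClosure_adjoinOne_le x₁ hκ hcard, le_fractionClosure _ hx₁,
    ⟨y₂, hle hy₂, hR.regular y₂ hy₂ h0, ?_⟩⟩
  have : y₂ * x₂ = c - y₁ * x₁ := by linear_combination h
  rw [this]
  exact sub_mem (hle hc) (mul_mem (hle hy₁) hx₁)

/-- Simultaneous generic specialization of two polynomials, each modulo the relevant primes
where it is nonconstant. -/
theorem exists_eval_isGenericAt [IsAdicComplete (maximalIdeal T) T] (hd : DepthGE T 2)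
    (hP : P.IsPrime) (hPm : P ≠ maximalIdeal T) (hR : R.IsFactorialIn P)
    {κ : Cardinal.{u}} (hκ : ℵ₀ ≤ κ)
    (hκT : κ ≤ ℵ₀ ∨ (ℵ₀ < #(ResidueField T) ∧ κ < #(ResidueField T))) (hcard : #R ≤ κ)
    (G : Bool → T[X]) :
    ∃ t ∈ maximalIdeal T ^ 2, ∀ b, ∀ J ∈ R.relevantPrimes P, (∃ n ≠ 0, (G b).coeff n ∉ J) →
      R.IsGenericAt ((G b).eval t) J := by
  let ι := {q : R.relevantPrimes P × R[X] × Bool //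
    (∃ n ≠ 0, (G q.2.2).coeff n ∉ q.1.1) ∧ ∃ n, (q.2.1.coeff n : T) ∉ q.1.1}
  have hι : #ι ≤ κ := by
    refine (Cardinal.mk_subtype_le _).trans ?_
    simp only [Cardinal.mk_prod, Cardinal.lift_id, Cardinal.lift_id']
    refine Cardinal.mul_le_of_le hκ (mk_relevantPrimes_le P hκ hcard)
      (Cardinal.mul_le_of_le hκ (Polynomial.cardinalMk_le_max.trans (max_le hcard hκ)) ?_)
    simpa using (Cardinal.natCast_lt_aleph0 (n := 2)).le.trans hκ
  have hprime : ∀ i : ι, (i.1.1.1 : Ideal T).IsPrime := fun i =>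
    isPrime_of_mem_relevantPrimes hP i.1.1.2
  obtain ⟨t, ht, hav⟩ := exists_mem_sq_forall_eval_notMem (fun i : ι => i.1.1.1) hprime
    (fun i => hR.ne_maximalIdeal_of_mem_relevantPrimes hd hPm i.1.1.2)
    (fun i => (i.1.2.1.map R.subtype).comp (G i.1.2.2))
    (fun i => by
      obtain ⟨n, hn, hnJ⟩ := i.2.1
      obtain ⟨k, hk⟩ := i.2.2
      refine Polynomial.map_comp_ne_zero (hprime i) (fun h => hk ?_) hn hnJ
      have := congrArg (fun q => q.coeff k) h
      simpa [Ideal.Quotient.eq_zero_iff_mem] using this)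
    (hκT.imp hι.trans fun h => ⟨h.1, hι.trans_lt h.2⟩)
  refine ⟨t, ht, fun b J hJ hnJ f hf n => ?_⟩
  by_contra hn
  refine hav ⟨(⟨J, hJ⟩, f, b), hnJ, n, hn⟩ ?_
  rw [eval_comp, eval_map]
  exact hf

theorem exists_extension_coset [IsAdicComplete (maximalIdeal T) T] (hd : DepthGE T 2)
    (hP : P.IsPrime) (hPm : P ≠ maximalIdeal T) (hR : R.IsFactorialIn P)
    {κ : Cardinal.{u}} (hκ : ℵ₀ ≤ κ)
    (hκT : κ ≤ ℵ₀ ∨ (ℵ₀ < #(ResidueField T) ∧ κ < #(ResidueField T))) (hcard : #R ≤ κ)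
    (u : T) :
    ∃ S : Subring T, S.IsFactorialIn P ∧ R.IsPrimeExtension S ∧ #S ≤ κ ∧
      ∃ a ∈ S, a - u ∈ maximalIdeal T ^ 2 := by
  obtain ⟨t, ht, hgen⟩ := hR.exists_eval_isGenericAt hd hP hPm hκ hκT hcard
    (fun _ => C u + X)
  obtain ⟨S, hS, hRS, hSκ, hx, -⟩ := hR.exists_extension_of_isGenericAt (y₁ := 0) (y₂ := 1)
    (c := 0) (x₁ := (C u + X).eval t) (x₂ := 0) (zero_mem _) (one_mem _) (zero_mem _)
    one_ne_zero hP.one_notMem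
    (fun p hp _ h => (mem_maximalIdeal p).1 hp.mem_maximalIdeal (isUnit_of_dvd_one h)) (by simp)
    (fun J hJ h1 => hgen true J hJ ⟨1, one_ne_zero, by simpa [coeff_C] using h1⟩)
    (fun J _ h => absurd (zero_mem J) h) hκ hcard
  exact ⟨S, hS, hRS, hSκ, _, hx, by simpa using ht⟩

/-- A linear equation over `R` solvable in `T` is solvable in an extension of `R`. -/
theorem exists_extension_solution [IsAdicComplete (maximalIdeal T) T] (hd : DepthGE T 2)
    (hP : P.IsPrime) (hPm : P ≠ maximalIdeal T) {κ : Cardinal.{u}} (hκ : ℵ₀ ≤ κ)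
    (hκT : κ ≤ ℵ₀ ∨ (ℵ₀ < #(ResidueField T) ∧ κ < #(ResidueField T))) (n : ℕ) {R : Subring T}
    (hR : R.IsFactorialIn P) (hcard : #R ≤ κ) (y : Fin n → R) (t : Fin n → T) {c : T}
    (hc : c ∈ R) (hyt : c = ∑ i, y i * t i) :
    ∃ S : Subring T, S.IsFactorialIn P ∧ R.IsPrimeExtension S ∧ #S ≤ κ ∧
      ∃ x : Fin n → T, (∀ i, x i ∈ S) ∧ c = ∑ i, y i * x i := by
  induction n generalizing R c with
  | zero => exact ⟨R, hR, .refl R, hcard, t, fun i => i.elim0, hyt⟩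
  | succ n ih =>
    have := hR.isDomain
    have := hR.uniqueFactorizationMonoid
    rw [Fin.sum_univ_succ] at hyt
    by_cases hy0 : y 0 = 0
    · obtain ⟨S, hS, hRS, hSκ, x, hx, hcx⟩ := ih hR hcard (fun i => y i.succ)
        (fun i => t i.succ) hc (by simpa [hy0] using hyt)
      refine ⟨S, hS, hRS, hSκ, Fin.cons 0 x, fun i => ?_, ?_⟩
      · cases i using Fin.cases with
        | zero => exact zero_mem _
        | succ i => exact hx i
      · simpa [Fin.sum_univ_succ] using hcx
    have hy0' : (y 0 : T) ≠ 0 := fun h => hy0 (Subtype.ext h)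
    by_cases hys : ∀ i : Fin n, y i.succ = 0
    · have hyt' : c = y 0 * t 0 := by simpa [hys] using hyt
      refine ⟨R, hR, .refl R, hcard, Fin.cons (t 0) 0, fun i => ?_, ?_⟩
      · cases i using Fin.cases with
        | zero => exact hR.saturated _ (y 0).2 hy0' _ (hyt' ▸ hc)
        | succ i => exact zero_mem _
      · simpa [Fin.sum_univ_succ] using hyt'
    push Not at hys
    obtain ⟨j, hj⟩ := hys
    let _ : NormalizedGCDMonoid R := Classical.choice inferInstance
    obtain ⟨z, hz, hz1⟩ := Finset.extract_gcd (s := Finset.univ) (fun i : Fin n => y i.succ)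
      ⟨j, Finset.mem_univ j⟩
    obtain ⟨g, e, h, hrel, hg, he⟩ := UniqueFactorizationMonoid.exists_reduced_factors'
      (Finset.univ.gcd fun i : Fin n => y i.succ) (y 0) hy0
    have hyz : ∀ i : Fin n, (y i.succ : T) = h * g * z i := by
      intro i
      rw [hz i (Finset.mem_univ i), ← hg]
      rfl
    have hy0e : (y 0 : T) = h * e := by
      rw [← he]
      rfl
    have hzj : z j ≠ 0 := by
      intro h0
      apply hj
      rw [hz j (Finset.mem_univ j), h0, mul_zero]
    have h0 : (h : T) ≠ 0 := by
      intro h0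
      exact hy0' (by rw [hy0e, h0, zero_mul])
    have he0 : (e : T) ≠ 0 := by
      intro h0
      exact hy0' (by rw [hy0e, h0, mul_zero])
    have hrelevant : ∀ J ∈ R.relevantPrimes P, ∃ k, (z k : T) ∉ J := by
      intro J hJ
      by_contra! hall
      rcases hR.contraction_of_mem_relevantPrimes hJ with h1 | ⟨p, hp, h1⟩
      · exact hzj (Subtype.ext (h1 _ (z j).2 (hall j)))
      · have h2 : (⟨p, hp.mem⟩ : R) ∣ Finset.univ.gcd z :=
          Finset.dvd_gcd fun i _ => hR.dvd_iff.2 (h1 _ (z i).2 (hall i))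
        rw [hz1] at h2
        exact (hR.prime_of_strongPrime (p := ⟨p, hp.mem⟩) hp).not_isUnit (isUnit_of_dvd_one h2)
    obtain ⟨Z, hZc, hZe⟩ := Polynomial.exists_coeff_succ_eq fun i => (z i : T)
    let A : T := ∑ i, z i * t i.succ
    obtain ⟨l, -, hgen⟩ := hR.exists_eval_isGenericAt hd hP hPm hκ hκT hcard
      (fun b => if b then C A + C (e : T) * Z else C (t 0) - C (g : T) * Z)
    have hcA : c = h * (g * A + e * t 0) := by
      rw [hyt, hy0e, Finset.sum_congr rfl fun i _ => by rw [hyz i]]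
      simp only [A, mul_add, Finset.mul_sum]
      rw [add_comm]
      congr 1
      · exact Finset.sum_congr rfl fun i _ => by ring
      · ring
    obtain ⟨S, hS, hRS, hSκ, hx₁, hx₂⟩ := hR.exists_extension_of_isGenericAt
      (y₁ := g) (y₂ := e) (c := g * A + e * t 0) (x₁ := A + e * Z.eval l)
      (x₂ := t 0 - g * Z.eval l) g.2 e.2 (hR.saturated h h.2 h0 _ (hcA ▸ hc)) he0
      (fun heP => he0 (hR.eq_zero_of_mem _ e.2 heP))
      (fun p hp hpg hpe => (hR.prime_of_strongPrime (p := ⟨p, hp.mem⟩) hp).not_isUnit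
        (hrel (hR.dvd_iff.2 hpg) (hR.dvd_iff.2 hpe))) (by ring)
      (fun J hJ heJ => by
        obtain ⟨k, hk⟩ := hrelevant J hJ
        have := hgen true J hJ ⟨k + 1, Nat.succ_ne_zero _, fun hmem => by
          simp only [if_true, coeff_add, coeff_C_succ, coeff_C_mul, hZc, zero_add] at hmem
          exact ((isPrime_of_mem_relevantPrimes hP hJ).mem_or_mem hmem).elim heJ hk⟩
        simpa using this)
      (fun J hJ hgJ => by
        obtain ⟨k, hk⟩ := hrelevant J hJ
        have := hgen false J hJ ⟨k + 1, Nat.succ_ne_zero _, fun hmem => by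
          simp only [Bool.false_eq_true, if_false, coeff_sub, coeff_C_succ, coeff_C_mul, hZc,
            zero_sub, neg_mem_iff] at hmem
          exact ((isPrime_of_mem_relevantPrimes hP hJ).mem_or_mem hmem).elim hgJ hk⟩
        simpa using this)
      hκ hcard
    obtain ⟨S', hS', hSS', hSκ', x, hx, hax⟩ := ih hS hSκ
      (fun i => ⟨z i, hRS.le (z i).2⟩) (fun i => t i.succ + e * l ^ ((i : ℕ) + 1)) hx₁ (by
        simp only [A, hZe, mul_add, Finset.sum_add_distrib, Finset.mul_sum]
        congr 1
        exact Finset.sum_congr rfl fun i _ => by ring)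
    refine ⟨S', hS', hRS.trans hSS', hSκ', Fin.cons (t 0 - g * Z.eval l) x, fun i => ?_, ?_⟩
    · cases i using Fin.cases with
      | zero => exact hSS'.le hx₂
      | succ i => exact hx i
    · rw [Fin.sum_univ_succ]
      simp only [Fin.cons_zero, Fin.cons_succ, hy0e, hyz]
      have h1 : ∑ i, (h : T) * g * z i * x i = h * g * (A + e * Z.eval l) := by
        rw [hax, Finset.mul_sum]
        exact Finset.sum_congr rfl fun i _ => by ring
      rw [h1, hcA]
      ring

end Subring.IsFactorialIn

end GenericExtensions

section Unions

open Cardinal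

universe u

variable {T : Type u} [CommRing T]

theorem Subring.mk_iSup_le_of_directed {ι : Type u} [Nonempty ι] {S : ι → Subring T}
    (hS : Directed (· ≤ ·) S) {κ : Cardinal.{u}} (hκ : ℵ₀ ≤ κ) (hι : #ι ≤ κ)
    (hcard : ∀ i, #(S i) ≤ κ) : #(⨆ i, S i : Subring T) ≤ κ := by
  have h1 : #(⨆ i, S i : Subring T) = #(⋃ i, (S i : Set T)) := by
    rw [← Subring.coe_iSup_of_directed hS]
    rfl
  rw [h1]
  refine (mk_iUnion_le _).trans ((mul_le_mul' hι (ciSup_le' hcard)).trans ?_)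
  rw [mul_eq_self hκ]

variable [IsLocalRing T]

theorem Subring.IsPrimeExtension.le_iSup {ι : Type*} [Nonempty ι] {S : ι → Subring T}
    (hS : Directed Subring.IsPrimeExtension S) (i : ι) : (S i).IsPrimeExtension (⨆ j, S j) := by
  have hdir : Directed (· ≤ ·) S := hS.mono fun _ _ h => h.le
  refine ⟨_root_.le_iSup S i, fun p hp =>
    ⟨_root_.le_iSup S i hp.mem, hp.ne_zero, hp.mem_maximalIdeal, fun w hw τ h => ?_⟩⟩
  obtain ⟨j, hj⟩ := (Subring.mem_iSup_of_directed hdir).1 hw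
  obtain ⟨k, hik, hjk⟩ := hS i j
  exact (hik.strongPrime p hp).dvd_or_dvd w (hjk.le hj) τ h

theorem Subring.IsFactorialIn.iSup {P : Ideal T} {ι : Type*} [Nonempty ι] {S : ι → Subring T}
    (hS : Directed Subring.IsPrimeExtension S) (hfac : ∀ i, (S i).IsFactorialIn P) :
    (⨆ i, S i).IsFactorialIn P := by
  have hdir : Directed (· ≤ ·) S := hS.mono fun _ _ h => h.le
  have hmem {x : T} := Subring.mem_iSup_of_directed hdir (x := x)
  refine ⟨fun a ha => ?_, fun a ha h0 t hat => ?_, fun a ha => ?_, fun f hf h0 hfm => ?_⟩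
  · obtain ⟨i, hi⟩ := hmem.1 ha
    exact (hfac i).regular a hi
  · obtain ⟨i, hi⟩ := hmem.1 ha
    obtain ⟨j, hj⟩ := hmem.1 hat
    obtain ⟨k, hik, hjk⟩ := hS i j
    exact hmem.2 ⟨k, (hfac k).saturated a (hik.le hi) h0 t (hjk.le hj)⟩
  · obtain ⟨i, hi⟩ := hmem.1 ha
    exact (hfac i).eq_zero_of_mem a hi
  · obtain ⟨i, hi⟩ := hmem.1 hf
    obtain ⟨p, hp, hpf⟩ := (hfac i).exists_strongPrime f hi h0 hfm
    exact ⟨p, (Subring.IsPrimeExtension.le_iSup hS i).strongPrime p hp, hpf⟩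

/-- If each of at most `κ` monotone conditions can be achieved by enlarging a factorial subring of
cardinality at most `κ`, then they can be achieved simultaneously. -/
theorem Subring.IsFactorialIn.exists_extension_forall {P : Ideal T} {R : Subring T}
    (hR : R.IsFactorialIn P) {κ : Cardinal.{u}} (hκ : ℵ₀ ≤ κ) (hcard : #R ≤ κ)
    {ι : Type u} (hι : #ι ≤ κ) (task : ι → Subring T → Prop)
    (hmono : ∀ i S S', S ≤ S' → task i S → task i S')
    (hstep : ∀ i S, R ≤ S → S.IsFactorialIn P → #S ≤ κ →
      ∃ S' : Subring T, S'.IsFactorialIn P ∧ S.IsPrimeExtension S' ∧ #S' ≤ κ ∧ task i S') :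
    ∃ S : Subring T, S.IsFactorialIn P ∧ R.IsPrimeExtension S ∧ #S ≤ κ ∧ ∀ i, task i S := by
  let α := {q : Set ι × Subring T // q.2.IsFactorialIn P ∧ R.IsPrimeExtension q.2 ∧ #q.2 ≤ κ ∧
    ∀ i ∈ q.1, task i q.2}
  let r : α → α → Prop := fun q q' =>
    q.1.1 ⊆ q'.1.1 ∧ q.1.2.IsPrimeExtension q'.1.2 ∧ (q'.1.1 ⊆ q.1.1 → q'.1.2 ≤ q.1.2)
  have hrefl : ∀ q, r q q := fun q => ⟨le_rfl, .refl _, fun _ => le_rfl⟩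
  have htrans : ∀ {q₁ q₂ q₃ : α}, r q₁ q₂ → r q₂ q₃ → r q₁ q₃ := by
    rintro q₁ q₂ q₃ ⟨h1, h2, h3⟩ ⟨h1', h2', h3'⟩
    exact ⟨h1.trans h1', h2.trans h2', fun h => (h3' (h.trans h1)).trans (h3 (h1'.trans h))⟩
  have : Nonempty α := ⟨⟨(∅, R), hR, .refl R, hcard, fun i hi => hi.elim⟩⟩
  obtain ⟨⟨⟨A, S⟩, hS, hRS, hSκ, hA⟩, hmax⟩ :
      ∃ m : α, ∀ a, r m a → r a m := by
    refine exists_maximal_of_nonempty_chains_bounded (fun c hc hne => ?_) htrans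
    have htot : ∀ q ∈ c, ∀ q' ∈ c, r q q' ∨ r q' q := by
      intro q hq q' hq'
      by_cases h : q = q'
      · exact Or.inl (h ▸ hrefl q)
      · exact hc hq hq' h
    by_cases htop : ∃ p ∈ c, ∀ q ∈ c, q.1.1 ⊆ p.1.1
    · obtain ⟨p, hp, hpc⟩ := htop
      refine ⟨p, fun q hq => ?_⟩
      refine (htot q hq p hp).elim id fun ⟨_, h2, h3⟩ => ?_
      have heq : q.1.2 = p.1.2 := le_antisymm (h3 (hpc q hq)) h2.le
      exact ⟨hpc q hq, heq ▸ .refl _, fun _ => heq.ge⟩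
    · push Not at htop
      have hB : ∀ i : ↥(⋃ q ∈ c, q.1.1), ∃ q ∈ c, i.1 ∈ q.1.1 := fun i => by
        simpa only [Set.mem_iUnion, exists_prop] using i.2
      choose f hfc hf using hB
      have hcof : ∀ q ∈ c, ∃ i, ¬ i.1 ∈ q.1.1 ∧ r q (f i) := by
        intro q hq
        obtain ⟨q', hq', hn⟩ := htop q hq
        obtain ⟨i, hi, hiq⟩ := Set.not_subset.1 hn
        let j : ↥(⋃ q ∈ c, q.1.1) := ⟨i, Set.mem_biUnion hq' hi⟩
        exact ⟨j, hiq, (htot q hq _ (hfc j)).resolve_right fun h => hiq (h.1 (hf j))⟩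
      obtain ⟨q₀, hq₀⟩ := hne
      obtain ⟨i₀, -⟩ := hcof q₀ hq₀
      have : Nonempty ↥(⋃ q ∈ c, q.1.1) := ⟨i₀⟩
      have hdir : Directed Subring.IsPrimeExtension fun i => (f i).1.2 := fun i j =>
        (htot _ (hfc i) _ (hfc j)).elim (fun h => ⟨j, h.2.1, .refl _⟩)
          fun h => ⟨i, .refl _, h.2.1⟩
      have hle := Subring.IsPrimeExtension.le_iSup hdir
      refine ⟨⟨(⋃ q ∈ c, q.1.1, ⨆ i, (f i).1.2), .iSup hdir fun i => (f i).2.1,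
        (f i₀).2.2.1.trans (hle i₀), ?_, fun i hi => ?_⟩, fun q hq => ?_⟩
      · exact Subring.mk_iSup_le_of_directed (hdir.mono fun _ _ h => h.le) hκ
          ((mk_set_le _).trans hι) fun i => (f i).2.2.2.1
      · exact hmono i _ _ (hle ⟨i, hi⟩).le ((f ⟨i, hi⟩).2.2.2.2 i (hf ⟨i, hi⟩))
      · obtain ⟨i, hiq, hri⟩ := hcof q hq
        exact ⟨Set.subset_biUnion_of_mem (u := fun q : α => q.1.1) hq, hri.2.1.trans (hle i),
          fun h => absurd (h i.2) hiq⟩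
  refine ⟨S, hS, hRS, hSκ, fun i => hA i ?_⟩
  by_contra hi
  obtain ⟨S', hS', hSS', hS'κ, htask⟩ := hstep i S hRS.le hS hSκ
  have h := hmax ⟨(insert i A, S'), hS', hRS.trans hSS', hS'κ, fun j hj =>
    hj.elim (fun h => h ▸ htask) fun h => hmono j _ _ hSS'.le (hA j h)⟩
    ⟨Set.subset_insert i A, hSS', fun h => absurd (h (Set.mem_insert i A)) hi⟩
  exact hi (h.1 (Set.mem_insert i A))

variable [IsNoetherianRing T] [IsAdicComplete (maximalIdeal T) T] {P : Ideal T}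

theorem Subring.IsFactorialIn.exists_extension_forall_solution (hd : DepthGE T 2)
    (hP : P.IsPrime) (hPm : P ≠ maximalIdeal T) {κ : Cardinal.{u}} (hκ : ℵ₀ ≤ κ)
    (hκT : κ ≤ ℵ₀ ∨ (ℵ₀ < #(ResidueField T) ∧ κ < #(ResidueField T))) {R : Subring T}
    (hR : R.IsFactorialIn P) (hcard : #R ≤ κ) :
    ∃ S : Subring T, S.IsFactorialIn P ∧ R.IsPrimeExtension S ∧ #S ≤ κ ∧
      ∀ (n : ℕ) (y : Fin n → T), (∀ i, y i ∈ R) → ∀ t : Fin n → T, ∑ i, y i * t i ∈ R →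
        ∃ x : Fin n → T, (∀ i, x i ∈ S) ∧ ∑ i, y i * t i = ∑ i, y i * x i := by
  let task : List R × R → Subring T → Prop := fun q S =>
    ∀ t : Fin q.1.length → T, (q.2 : T) = ∑ i, q.1.get i * t i →
      ∃ x : Fin q.1.length → T, (∀ i, x i ∈ S) ∧ (q.2 : T) = ∑ i, q.1.get i * x i
  have hι : #(List R × R) ≤ κ := by
    rw [mk_prod, lift_id, lift_id, ← mul_eq_self hκ]
    exact mul_le_mul' ((mk_list_le_max R).trans (max_le hκ hcard)) hcard
  obtain ⟨S, hS, hRS, hSκ, htask⟩ := hR.exists_extension_forall hκ hcard hι task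
    (fun q S S' hSS' h t ht => (h t ht).imp fun x hx => ⟨fun i => hSS' (hx.1 i), hx.2⟩) (by
      intro q S hRS hS hSκ
      by_cases h : ∃ t : Fin q.1.length → T, (q.2 : T) = ∑ i, q.1.get i * t i
      · obtain ⟨t, ht⟩ := h
        obtain ⟨S', hS', hSS', hS'κ, hx⟩ := Subring.IsFactorialIn.exists_extension_solution hd hP
          hPm hκ hκT _ hS hSκ (fun i => Subring.inclusion hRS (q.1.get i)) t (hRS q.2.2) ht
        exact ⟨S', hS', hSS', hS'κ, fun _ _ => hx⟩
      · exact ⟨S, hS, .refl S, hSκ, fun t ht => absurd ⟨t, ht⟩ h⟩)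
  refine ⟨S, hS, hRS, hSκ, fun n y hy t hc => ?_⟩
  have key : ∀ (l : List R) (e : n = l.length), (∀ i, y i = l.get (Fin.cast e i)) →
      ∃ x : Fin n → T, (∀ i, x i ∈ S) ∧ ∑ i, y i * t i = ∑ i, y i * x i := by
    rintro l rfl h
    obtain rfl : y = fun i => (l.get i : T) := funext h
    exact htask (l, ⟨_, hc⟩) t rfl
  exact key (List.ofFn fun i => ⟨y i, hy i⟩) (List.length_ofFn).symm fun i => by simp

/-- A factorial subring can be enlarged, without increasing its cardinality beyond `κ`, so that
every linear equation over it solvable in `T` is solvable in it. -/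
theorem Subring.IsFactorialIn.exists_extension_pure (hd : DepthGE T 2)
    (hP : P.IsPrime) (hPm : P ≠ maximalIdeal T) {κ : Cardinal.{u}} (hκ : ℵ₀ ≤ κ)
    (hκT : κ ≤ ℵ₀ ∨ (ℵ₀ < #(ResidueField T) ∧ κ < #(ResidueField T))) {R : Subring T}
    (hR : R.IsFactorialIn P) (hcard : #R ≤ κ) :
    ∃ S : Subring T, S.IsFactorialIn P ∧ R.IsPrimeExtension S ∧ #S ≤ κ ∧
      ∀ (n : ℕ) (y : Fin n → T), (∀ i, y i ∈ S) → ∀ t : Fin n → T, ∑ i, y i * t i ∈ S →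
        ∃ x : Fin n → T, (∀ i, x i ∈ S) ∧ ∑ i, y i * t i = ∑ i, y i * x i := by
  choose next hnext hext hnextκ hsol using
    fun S : {S : Subring T // S.IsFactorialIn P ∧ #S ≤ κ} =>
      S.2.1.exists_extension_forall_solution hd hP hPm hκ hκT S.2.2
  let F : ℕ → {S : Subring T // S.IsFactorialIn P ∧ #S ≤ κ} := fun n =>
    Nat.rec ⟨R, hR, hcard⟩ (fun _ S => ⟨next S, hnext S, hnextκ S⟩) n
  have hF : ∀ m n, m ≤ n → (F m).1.IsPrimeExtension (F n).1 := by
    intro m n hmn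
    induction n, hmn using Nat.le_induction with
    | base => exact .refl _
    | succ n _ ih => exact ih.trans (hext (F n))
  have hdir : Directed Subring.IsPrimeExtension fun n : ULift.{u} ℕ => (F n.down).1 :=
    fun m n => ⟨⟨max m.down n.down⟩, hF _ _ (le_max_left _ _), hF _ _ (le_max_right _ _)⟩
  have hdir' := hdir.mono (s := (· ≤ ·)) fun _ _ h => h.le
  refine ⟨⨆ n : ULift.{u} ℕ, (F n.down).1, .iSup hdir fun n => (F n.down).2.1,
    Subring.IsPrimeExtension.le_iSup hdir ⟨0⟩,
    Subring.mk_iSup_le_of_directed hdir' hκ (by simpa using hκ) fun n => (F n.down).2.2,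
    fun n y hy t hc => ?_⟩
  choose k hk using fun i => (Subring.mem_iSup_of_directed hdir').1 (hy i)
  obtain ⟨j, hj⟩ := (Subring.mem_iSup_of_directed hdir').1 hc
  let N := max j.down (Finset.univ.sup fun i => (k i).down)
  obtain ⟨x, hx, hxc⟩ := hsol (F N) n y (fun i => (hF _ N ((Finset.le_sup
    (f := fun i => (k i).down) (Finset.mem_univ i)).trans (le_max_right _ _))).le (hk i)) t
    ((hF _ N (le_max_left _ _)).le hj)
  exact ⟨x, fun i => (Subring.mem_iSup_of_directed hdir').2 ⟨⟨N + 1⟩, hx i⟩, hxc⟩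

/-- Over a subring in which linear equations solvable in `T` are solvable, finitely generated
ideals are contracted from `T`. -/
theorem Subring.comap_map_eq_of_forall_solution {T : Type*} [CommRing T] {S : Subring T}
    (hS : ∀ (n : ℕ) (y : Fin n → T), (∀ i, y i ∈ S) → ∀ t : Fin n → T, ∑ i, y i * t i ∈ S →
        ∃ x : Fin n → T, (∀ i, x i ∈ S) ∧ ∑ i, y i * t i = ∑ i, y i * x i)
    {I : Ideal S} (hI : I.FG) : Ideal.comap S.subtype (Ideal.map S.subtype I) = I := by
  refine le_antisymm (fun c hc => ?_) Ideal.le_comap_map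
  obtain ⟨n, y, rfl⟩ := Submodule.fg_iff_exists_fin_generating_family.1 hI
  rw [Ideal.mem_comap, ← Ideal.span, Ideal.map_span, ← Set.range_comp,
    Ideal.mem_span_range_iff_exists_fun] at hc
  obtain ⟨t, ht⟩ := hc
  have ht' : ∑ i, (y i : T) * t i = c := by
    rw [show (c : T) = S.subtype c from rfl, ← ht]
    exact Finset.sum_congr rfl fun i _ => mul_comm _ _
  obtain ⟨x, hx, hxc⟩ := hS n (fun i => y i) (fun i => (y i).2) t (ht' ▸ c.2)
  rw [← Ideal.span, Ideal.mem_span_range_iff_exists_fun]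
  refine ⟨fun i => ⟨x i, hx i⟩, Subtype.ext ?_⟩
  rw [← ht', hxc]
  simp [mul_comm]

end Unions

/-- Enlarging an N-subring to hit a prescribed coset of `m²`, preserving
avoidance of `p` and primality of prime elements, and achieving `IT ∩ S = I` for all finitely
generated ideals `I` of `S`. -/
theorem NSubring_adjoin_coset_ideal_contraction
    (T : Type*) [CommRing T] [IsLocalRing T] [IsNoetherianRing T]
    [IsAdicComplete (maximalIdeal T) T]
    (hdepth : DepthGE T 2)
    (P : Ideal T) (hP : P.IsPrime) (hPm : P ≠ maximalIdeal T)
    (R : Subring T) (hR : IsNSubring T R)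
    (hRP : Ideal.comap R.subtype P = ⊥) (hRinf : Infinite R) (u : T) :
    ∃ (S : Subring T) (hRS : R ≤ S), IsNSubring T S ∧
      (∃ a ∈ S, a - u ∈ maximalIdeal T ^ 2) ∧
      Cardinal.mk S = Cardinal.mk R ∧
      Ideal.comap S.subtype P = ⊥ ∧
      (∀ r : R, Prime r → Prime (Subring.inclusion hRS r)) ∧
      ∀ I : Ideal S, I.FG → Ideal.comap S.subtype (Ideal.map S.subtype I) = I := by
  have hfac := hR.isFactorialIn hRP
  have hκ : Cardinal.aleph0 ≤ Cardinal.mk R := Cardinal.infinite_iff.1 hRinf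
  have hcard := hR.2.2.2.1
  have hκT : Cardinal.mk R ≤ Cardinal.aleph0 ∨
      (Cardinal.aleph0 < Cardinal.mk (ResidueField T) ∧
        Cardinal.mk R < Cardinal.mk (ResidueField T)) := by
    rcases le_or_gt (Cardinal.mk (ResidueField T)) Cardinal.aleph0 with h | h
    · exact Or.inl (hcard.1.trans (max_le le_rfl h))
    · refine Or.inr ⟨h, ?_⟩
      rw [max_eq_right h.le] at hcard
      exact lt_of_le_of_ne hcard.1 fun heq => h.not_ge (hcard.2 heq)
  obtain ⟨R', hR', hRR', hR'κ, a, ha, hau⟩ :=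
    hfac.exists_extension_coset hdepth hP hPm hκ hκT le_rfl u
  obtain ⟨S, hS, hR'S, hSκ, hsol⟩ := hR'.exists_extension_pure hdepth hP hPm hκ hκT hR'κ
  have hRS := hRR'.trans hR'S
  have hmk : Cardinal.mk S = Cardinal.mk R :=
    le_antisymm hSκ (Cardinal.mk_le_mk_of_subset hRS.le)
  refine ⟨S, hRS.le, hS.isNSubring (by rwa [hmk]), ⟨a, hR'S.le ha, hau⟩, hmk, ?_, ?_, ?_⟩
  · exact eq_bot_iff.2 fun b hb => Subtype.ext (hS.eq_zero_of_mem b b.2 hb)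
  · exact fun r hr => hS.prime_iff.2 (hRS.strongPrime r (hfac.prime_iff.1 hr))
  · exact fun I hI => Subring.comap_map_eq_of_forall_solution hsol hI
end

section
/- Let (T,m) be a catenary reduced Noetherian local ring and let P be a minimal prime ideal of T with dim(T/P) = n ≥ 2. Suppose p is a nonmaximal prime ideal of T. Then there exists a saturated chain of prime ideals of T, P ⊊ q_1 ⊊ ⋯ ⊊ q_{n-1} ⊊ m, such that for each i = 1, …, n−1, q_i ⊄ p and P is the only minimal prime ideal of T contained in q_i. -/
open IsLocalRing

/-- A prime minimal over `Q + (x)`, where `Q` is a prime not containing `x`, covers `Q`. -/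
lemma PrimeSpectrum.covBy_of_mem_minimalPrimes {R : Type*} [CommRing R] [IsNoetherianRing R]
    {Q q : PrimeSpectrum R} {x : R} (hx : x ∉ Q.asIdeal)
    (hq : q.asIdeal ∈ (Q.asIdeal ⊔ Ideal.span {x}).minimalPrimes) : Q ⋖ q := by
  have hxq : x ∈ q.asIdeal :=
    hq.1.2 (Ideal.mem_sup_right (Ideal.mem_span_singleton_self x))
  have hQq : Q.asIdeal ≤ q.asIdeal := le_sup_left.trans hq.1.2
  refine ⟨lt_of_le_of_ne hQq fun h => hx (h ▸ hxq), fun r hQr hrq => ?_⟩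
  have hker (a : PrimeSpectrum R) (ha : Q ≤ a) :
      (a.asIdeal.map (Ideal.Quotient.mk Q.asIdeal)).IsPrime :=
    Ideal.map_isPrime_of_surjective Ideal.Quotient.mk_surjective (by simpa using ha)
  have hlt (a b : PrimeSpectrum R) (ha : Q ≤ a) (hb : Q ≤ b) (hab : a < b) :
      a.asIdeal.map (Ideal.Quotient.mk Q.asIdeal) <
        b.asIdeal.map (Ideal.Quotient.mk Q.asIdeal) := by
    refine lt_of_le_not_ge (Ideal.map_mono hab.le) fun h => hab.not_ge ?_
    have := Ideal.comap_mono (f := Ideal.Quotient.mk Q.asIdeal) h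
    rwa [Ideal.comap_map_mk ha, Ideal.comap_map_mk hb] at this
  have := hker Q le_rfl
  have := hker r hQr.le
  have := hker q hQq
  have h₁ := Ideal.height_add_one_le_of_lt_of_isPrime (hlt Q r le_rfl hQr.le hQr)
  have h₂ := Ideal.height_add_one_le_of_lt_of_isPrime (hlt r q hQr.le hQq hrq)
  have h₃ := h₂.trans (Ideal.map_height_le_one_of_mem_minimalPrimes hq)
  have h₄ : (1 : ℕ∞) + 1 ≤ 1 := (add_le_add_left (le_add_self.trans h₁) 1).trans h₃
  exact absurd h₄ (by decide)

/-- If the maximal ideal does not cover `Q`, some prime covering `Q` avoids a given element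
outside `Q` and is not contained in a given nonmaximal prime. -/
lemma IsLocalRing.exists_covBy_notMem_not_le {R : Type*} [CommRing R] [IsLocalRing R]
    [IsNoetherianRing R] {Q p : PrimeSpectrum R} {a : R} (ha : a ∉ Q.asIdeal)
    (hQ : Q ≠ ⊤) (hcov : ¬ Q ⋖ ⊤) (hp : p ≠ ⊤) :
    ∃ q : PrimeSpectrum R, Q ⋖ q ∧ a ∉ q.asIdeal ∧ ¬ q ≤ p := by
  let S : Set (Ideal R) :=
    insert Q.asIdeal (insert p.asIdeal (Q.asIdeal ⊔ Ideal.span {a}).minimalPrimes)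
  have hS : S.Finite :=
    (((Q.asIdeal ⊔ Ideal.span {a}).finite_minimalPrimes_of_isNoetherianRing R).insert _).insert _
  have hSprime : ∀ I ∈ S, I.IsPrime := by
    rintro I (rfl | rfl | hI)
    exacts [Q.2, p.2, hI.1.1]
  have hSmax : ∀ I ∈ S, ¬ maximalIdeal R ≤ I := by
    rintro I (rfl | rfl | hI) hle
    · exact hQ (top_le_iff.mp hle)
    · exact hp (top_le_iff.mp hle)
    · have hcovI : Q ⋖ ⟨I, hI.1.1⟩ := PrimeSpectrum.covBy_of_mem_minimalPrimes ha hI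
      have htop : (⟨I, hI.1.1⟩ : PrimeSpectrum R) = ⊤ := top_le_iff.mp hle
      exact hcov (htop ▸ hcovI)
  obtain ⟨y, hym, hyS⟩ : ∃ y ∈ maximalIdeal R, ∀ I ∈ S, y ∉ I := by
    by_contra! h
    obtain ⟨I, hI, hle⟩ := (Ideal.subset_union_prime_finite hS (f := id) ⊥ ⊥
      (fun I hI _ _ => hSprime I hI) (I := maximalIdeal R)).mp
      fun y hy => by simpa using h y hy
    exact hSmax I hI hle
  have hne : Q.asIdeal ⊔ Ideal.span {y} ≠ ⊤ := fun h =>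
    (maximalIdeal.isMaximal R).ne_top <| top_le_iff.mp <| h ▸
      sup_le (le_maximalIdeal Q.2.ne_top) ((Ideal.span_singleton_le_iff_mem _).mpr hym)
  obtain ⟨I, hI⟩ := Ideal.nonempty_minimalPrimes hne
  have hIprime : I.IsPrime := hI.1.1
  let q : PrimeSpectrum R := ⟨I, hIprime⟩
  have hyQ : y ∉ Q.asIdeal := hyS _ (Or.inl rfl)
  have hyI : y ∈ I := hI.1.2 (Ideal.mem_sup_right (Ideal.mem_span_singleton_self y))
  have hQq : Q ⋖ q := PrimeSpectrum.covBy_of_mem_minimalPrimes hyQ hI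
  refine ⟨q, hQq, fun haq => ?_, fun h => hyS _ (Or.inr (Or.inl rfl)) (h hyI)⟩
  obtain ⟨J, hJ, hJI⟩ := Ideal.exists_minimalPrimes_le (J := I)
    (sup_le hQq.le ((Ideal.span_singleton_le_iff_mem _).mpr haq))
  have hQJ : Q ⋖ ⟨J, hJ.1.1⟩ := PrimeSpectrum.covBy_of_mem_minimalPrimes ha hJ
  have hJq : (⟨J, hJ.1.1⟩ : PrimeSpectrum R) = q :=
    (hQq.eq_or_eq hQJ.le hJI).resolve_left hQJ.lt.ne'
  have hJI' : J = I := congrArg PrimeSpectrum.asIdeal hJq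
  exact hyS J (Or.inr (Or.inr hJ)) (hJI' ▸ hyI)

/-- A nonmaximal prime not containing `a` is joined to the maximal ideal by a saturated chain
whose intermediate members do not contain `a` and are not contained in `p`. -/
lemma IsLocalRing.exists_covBy_chain_notMem_not_le {R : Type*} [CommRing R] [IsLocalRing R]
    [IsNoetherianRing R] {p : PrimeSpectrum R} (hp : p ≠ ⊤) (a : R) (Q : PrimeSpectrum R)
    (ha : a ∉ Q.asIdeal) (hQ : Q ≠ ⊤) :
    ∃ (k : ℕ) (f : ℕ → PrimeSpectrum R), f 0 = Q ∧ f k = ⊤ ∧ (∀ i < k, f i ⋖ f (i + 1)) ∧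
      ∀ i, 0 < i → i < k → a ∉ (f i).asIdeal ∧ ¬ f i ≤ p := by
  have : WellFoundedGT (PrimeSpectrum R) :=
    ⟨Subrelation.wf (fun {_ _} h => h) (InvImage.wf PrimeSpectrum.asIdeal wellFounded_gt)⟩
  induction Q using WellFoundedGT.induction with
  | ind Q ih =>
  by_cases hcov : Q ⋖ ⊤
  · refine ⟨1, fun i => Nat.casesOn i Q fun _ => ⊤, rfl, rfl, fun i hi => ?_, by lia⟩
    obtain rfl : i = 0 := by lia
    exact hcov
  · obtain ⟨q, hQq, haq, hqp⟩ := exists_covBy_notMem_not_le ha hQ hcov hp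
    obtain ⟨k, f, hf0, hfk, hf, hgood⟩ :=
      ih q hQq.lt haq fun h => hcov (h ▸ hQq)
    refine ⟨k + 1, fun i => Nat.casesOn i Q f, rfl, hfk, ?_, ?_⟩
    · rintro (_ | i) hi
      · change Q ⋖ f 0
        rwa [hf0]
      · exact hf i (by lia)
    · rintro (_ | _ | i) h0 hi
      · lia
      · change a ∉ (f 0).asIdeal ∧ ¬ f 0 ≤ p
        rw [hf0]
        exact ⟨haq, hqp⟩
      · exact hgood (i + 1) (by lia) (by lia)

/-- An element of finite coheight `n` is joined to the top by a saturated chain of length `n`. -/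
lemma Order.exists_covBy_chain_of_coheight_eq {α : Type*} [PartialOrder α] [OrderTop α] (n : ℕ)
    (x : α) (hx : Order.coheight x = n) :
    ∃ f : ℕ → α, f 0 = x ∧ f n = ⊤ ∧ ∀ i < n, f i ⋖ f (i + 1) := by
  induction n generalizing x with
  | zero => exact ⟨fun _ => x, rfl, by simpa using hx, by lia⟩
  | succ n ih =>
    obtain ⟨-, ⟨y, hxy, hy⟩, hle⟩ := Order.coheight_eq_coe_add_one_iff.mp (by exact_mod_cast hx)
    obtain ⟨f, hf0, hfn, hf⟩ := ih y hy
    have hcov : x ⋖ y := by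
      refine ⟨hxy, fun r hxr hry => ?_⟩
      have h := (Order.coheight_add_one_le hry).trans (hle r hxr)
      rw [hy] at h
      exact absurd (by exact_mod_cast h : n + 1 ≤ n) (by lia)
    refine ⟨fun i => Nat.casesOn i x f, rfl, hfn, ?_⟩
    rintro (_ | i) hi
    · change x ⋖ f 0
      rwa [hf0]
    · exact hf i (by lia)

/-- Some element outside a minimal prime `P` lies in all the other minimal primes. -/
lemma minimalPrimes.exists_notMem_forall_mem {R : Type*} [CommRing R] [IsNoetherianRing R]
    {P : Ideal R} (hP : P ∈ minimalPrimes R) :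
    ∃ a ∉ P, ∀ P' ∈ minimalPrimes R, P' ≠ P → a ∈ P' := by
  classical
  have hfin : (minimalPrimes R \ {P}).Finite :=
    (minimalPrimes.finite_of_isNoetherianRing R).subset Set.sdiff_subset
  have hprime : P.IsPrime := hP.1.1
  have hnot : ¬ hfin.toFinset.inf id ≤ P := fun h => by
    obtain ⟨P', hP', hle⟩ := (Ideal.IsPrime.inf_le' hprime).mp h
    obtain ⟨hmin, hne⟩ := hfin.mem_toFinset.mp hP'
    exact hne (le_antisymm hle (hP.2 hmin.1 hle))
  obtain ⟨a, ha, haP⟩ := SetLike.not_le_iff_exists.mp hnot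
  exact ⟨a, haP, fun P' hP' hne =>
    (Finset.inf_le (f := id) (hfin.mem_toFinset.mpr ⟨hP', hne⟩) : _ ≤ P') ha⟩

/-- In a catenary reduced Noetherian local ring, given a minimal prime `P`
with `dim(T/P) = n ≥ 2` and a nonmaximal prime `p`, there is a saturated chain from `P` to `m`
of length `n` whose intermediate members are not contained in `p` and contain no minimal prime
other than `P`. -/
theorem exists_saturated_chain_avoiding_prime
    (T : Type*) [CommRing T] [IsLocalRing T] [IsNoetherianRing T] [IsReduced T]
    (hcat : IsCatenaryRing T)
    (P : Ideal T) (hPmin : P ∈ minimalPrimes T)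
    (n : ℕ) (hn : ringKrullDim (T ⧸ P) = (n : WithBot (WithTop ℕ))) (hn2 : 2 ≤ n)
    (p : Ideal T) (hp : p.IsPrime) (hpm : p ≠ maximalIdeal T) :
    ∃ q : Fin (n + 1) → Ideal T,
      q 0 = P ∧ q (Fin.last n) = maximalIdeal T ∧
      (∀ i, (q i).IsPrime) ∧
      (∀ i : Fin n, q i.castSucc < q i.succ ∧
        ∀ r : Ideal T, r.IsPrime → ¬(q i.castSucc < r ∧ r < q i.succ)) ∧
      ∀ i : Fin (n + 1), i ≠ 0 → i ≠ Fin.last n →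
        (¬ q i ≤ p ∧ ∀ P' ∈ minimalPrimes T, P' ≤ q i → P' = P) := by
  have hPprime : P.IsPrime := hPmin.1.1
  let P₀ : PrimeSpectrum T := ⟨P, hPprime⟩
  have hcoheight : Order.coheight P₀ = n := by
    have hIci : PrimeSpectrum.zeroLocus (P : Set T) = Set.Ici P₀ := by
      ext x
      rfl
    rw [ringKrullDim_quotient, hIci, ← Order.coheight_eq_krullDim_Ici] at hn
    exact WithBot.coe_injective hn
  have hP₀ : P₀ ≠ ⊤ := by
    intro h
    rw [h, Order.coheight_top] at hcoheight
    have : 0 = n := by exact_mod_cast hcoheight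
    lia
  obtain ⟨a, haP, ha⟩ := minimalPrimes.exists_notMem_forall_mem hPmin
  have hp₀ : (⟨p, hp⟩ : PrimeSpectrum T) ≠ ⊤ := fun h => hpm (congrArg PrimeSpectrum.asIdeal h)
  obtain ⟨k, f, hf0, hfk, hf, hgood⟩ := exists_covBy_chain_notMem_not_le hp₀ a P₀ haP hP₀
  obtain ⟨g, hg0, hgn, hg⟩ := Order.exists_covBy_chain_of_coheight_eq n P₀ hcoheight
  obtain rfl : k = n := hcat k n (fun i => f i) (fun i => g i) (hf0.trans hg0.symm)
    (hfk.trans hgn.symm) (fun i => hf i i.2) (fun i => hg i i.2)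
  refine ⟨fun i => (f i).asIdeal, congrArg PrimeSpectrum.asIdeal hf0,
    congrArg PrimeSpectrum.asIdeal hfk, fun i => (f i).2, fun i => ⟨(hf i i.2).lt, ?_⟩, ?_⟩
  · rintro r hr ⟨h₁, h₂⟩
    exact (hf i i.2).2 (c := ⟨r, hr⟩) h₁ h₂
  · intro i hi0 hin
    obtain ⟨hai, hpi⟩ := hgood i (Nat.pos_of_ne_zero fun h => hi0 (Fin.ext h))
      (Fin.val_lt_last hin)
    exact ⟨hpi, fun P' hP' hle => by_contra fun hne => hai (hle (ha P' hP' hne))⟩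
end
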